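/- Let n ≥ 2, s > -1, and let j ≥ 0 be an integer. Then there exist constants 0 < c < C < ∞ depending only on n, s, j such that for every M-harmonic function f on B_n one has (in the extended reals) c·‖f‖²_s ≤ ‖(I+□)^j f‖²_{s+2j} ≤ C·‖f‖²_s, where (I+□)^j is the j-fold iterate of the differential operator I+□. -/

import Mathlib

open MeasureTheory ENNReal NNReal

/-- Pochhammer symbol `(a)_k = Γ(a+k)/Γ(a)`. -/
noncomputable def poch (a : ℝ) (k : ℕ) : ℝ := Real.Gamma (a + k) / Real.Gamma a

/-- Gauss hypergeometric function `₂F₁(a,b;c;t)`, as a sum of its series. -/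
noncomputable def hyp2F1 (a b c t : ℝ) : ℝ :=
  ∑' k : ℕ, (poch a k * poch b k) / (poch c k * (Nat.factorial k)) * t ^ k

/-- `S_pq(t)`. -/
noncomputable def Spq (n p q : ℕ) (t : ℝ) : ℝ :=
  (Real.Gamma (n + p) * Real.Gamma (n + q)) / (Real.Gamma n * Real.Gamma ((n : ℝ) + p + q)) *
    hyp2F1 p q ((p : ℝ) + q + n) t

/-- `c_pq(s)`. -/
noncomputable def cpq (n p q : ℕ) (s : ℝ) : ℝ :=
  poch (s + 1) n / Real.Gamma n *
    ∫ t in Set.Ioo (0:ℝ) 1, t ^ ((p : ℝ) + q + n - 1) * (1 - t) ^ s * (Spq n p q t) ^ 2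
noncomputable instance (n : ℕ) : MeasurableSpace (EuclideanSpace ℂ (Fin n)) := borel _
instance (n : ℕ) : BorelSpace (EuclideanSpace ℂ (Fin n)) := ⟨rfl⟩
/-- Lebesgue measure on `ℂⁿ`. -/
noncomputable instance (n : ℕ) : MeasureSpace (EuclideanSpace ℂ (Fin n)) :=
  ⟨Measure.map (⇑(PiLp.continuousLinearEquiv 2 ℝ (fun _ : Fin n => ℂ)).symm) volume⟩

abbrev En (n : ℕ) := EuclideanSpace ℂ (Fin n)

/-- Wirtinger derivative `∂f/∂z_j`. -/
noncomputable def wd (n : ℕ) (j : Fin n) (f : En n → ℂ) (z : En n) : ℂ :=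
  (1/2 : ℂ) * (fderiv ℝ f z (EuclideanSpace.single j 1) -
    Complex.I * fderiv ℝ f z (EuclideanSpace.single j Complex.I))

/-- Wirtinger derivative `∂f/∂z̄_j`. -/
noncomputable def wdb (n : ℕ) (j : Fin n) (f : En n → ℂ) (z : En n) : ℂ :=
  (1/2 : ℂ) * (fderiv ℝ f z (EuclideanSpace.single j 1) +
    Complex.I * fderiv ℝ f z (EuclideanSpace.single j Complex.I))

/-- The complex-tangential field `L_{jk} = z̄_j ∂/∂z_k − z̄_k ∂/∂z_j`. -/
noncomputable def Lop (n : ℕ) (j k : Fin n) (f : En n → ℂ) : En n → ℂ :=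
  fun z => (starRingEnd ℂ) (z j) * wd n k f z - (starRingEnd ℂ) (z k) * wd n j f z

/-- The complex-tangential field `L̄_{jk} = z_j ∂/∂z̄_k − z_k ∂/∂z̄_j`. -/
noncomputable def Lbarop (n : ℕ) (j k : Fin n) (f : En n → ℂ) : En n → ℂ :=
  fun z => z j * wdb n k f z - z k * wdb n j f z

/-- `□ = −Σ_{j,k} (L_{jk}L̄_{jk} + L̄_{jk}L_{jk})`. -/
noncomputable def BoxOp (n : ℕ) (f : En n → ℂ) : En n → ℂ :=
  fun z => -∑ j : Fin n, ∑ k : Fin n, (Lop n j k (Lbarop n j k f) z + Lbarop n j k (Lop n j k f) z)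

/-- `f` is `M`-harmonic on the unit ball (of smoothness class `m`):
`Δ̃f = 4(1-|z|²) Σ_{j,k}(δ_{jk} - z_j z̄_k) ∂²f/∂z_j∂z̄_k = 0` on the ball. -/
def MHarm (n : ℕ) (m : ℕ∞) (f : En n → ℂ) : Prop :=
  ContDiffOn ℝ m f (Metric.ball 0 1) ∧
  ∀ z ∈ Metric.ball (0 : En n) 1,
    (4 : ℂ) * (1 - (‖z‖ : ℂ) ^ 2) *
      ∑ j : Fin n, ∑ k : Fin n,
        ((if j = k then 1 else 0) - z j * (starRingEnd ℂ) (z k)) * wd n j (wdb n k f) z = 0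

/-- `‖f‖²_s = ∫_{B_n} |f|² dμ_s` as an extended real. -/
noncomputable def nsqE (n : ℕ) (s : ℝ) (f : En n → ℂ) : ℝ≥0∞ :=
  ∫⁻ z in Metric.ball (0 : En n) 1,
    ENNReal.ofReal (poch (s + 1) n / Real.pi ^ n * (1 - ‖z‖ ^ 2) ^ s * ‖f z‖ ^ 2)

/-- `‖f‖²_s = ∫_{B_n} |f|² dμ_s` as a real number. -/
noncomputable def normSqS (n : ℕ) (s : ℝ) (f : En n → ℂ) : ℝ :=
  ∫ z in Metric.ball (0 : En n) 1,
    poch (s + 1) n / Real.pi ^ n * (1 - ‖z‖ ^ 2) ^ s * ‖f z‖ ^ 2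

/-- The normalized surface measure `σ` on the unit sphere `∂B_n`. -/
noncomputable def sphMeas (n : ℕ) : Measure (Metric.sphere (0 : En n) 1) :=
  ((volume : Measure (En n)).toSphere Set.univ)⁻¹ • (volume : Measure (En n)).toSphere

/-- `‖g‖²_{∂B_n} = ∫_{∂B_n} |g|² dσ`. -/
noncomputable def normSqSphere (n : ℕ) (g : En n → ℂ) : ℝ :=
  ∫ ζ : Metric.sphere (0 : En n) 1, ‖g (ζ : En n)‖ ^ 2 ∂ sphMeas n

/-- Membership in `H̃^{pq}`: `P` is a polynomial in `z, z̄`, homogeneous of bidegree `(p,q)`,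
and harmonic for the Euclidean Laplacian `Δ = 4 Σ_j ∂²/∂z_j∂z̄_j` on `ℝ^{2n}`. -/
def InHtilde (n : ℕ) (p q : ℕ) (P : En n → ℂ) : Prop :=
  (∃ Q : MvPolynomial (Fin n ⊕ Fin n) ℂ,
    (∀ z : En n,
      P z = MvPolynomial.eval (Sum.elim (fun j => z j) (fun j => (starRingEnd ℂ) (z j))) Q) ∧
    ∀ d ∈ Q.support,
      (∑ j : Fin n, d (Sum.inl j)) = p ∧ (∑ j : Fin n, d (Sum.inr j)) = q) ∧
  ∀ z : En n, ∑ j : Fin n, wd n j (wdb n j P) z = 0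

/-- The operator `I + □`. -/
noncomputable def IpB (n : ℕ) (f : En n → ℂ) : En n → ℂ := fun z => f z + BoxOp n f z

/-- The algebra of smooth complex valued functions on `ℂⁿ`. -/
noncomputable def SA (n : ℕ) : Subalgebra ℂ (En n → ℂ) where
  carrier := {f | ContDiff ℝ ((⊤ : ℕ∞) : WithTop ℕ∞) f}
  mul_mem' {f g} (hf : ContDiff ℝ _ f) (hg : ContDiff ℝ _ g) :=
    (hf.mul hg : ContDiff ℝ ((⊤ : ℕ∞) : WithTop ℕ∞) (f * g))
  add_mem' {f g} (hf : ContDiff ℝ _ f) (hg : ContDiff ℝ _ g) :=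
    (hf.add hg : ContDiff ℝ ((⊤ : ℕ∞) : WithTop ℕ∞) (f + g))
  algebraMap_mem' c :=
    (contDiff_const : ContDiff ℝ ((⊤ : ℕ∞) : WithTop ℕ∞) (fun _ : En n => c))

/-- Smooth complex valued functions on `ℂⁿ`. -/
noncomputable abbrev SF (n : ℕ) : Type := SA n

namespace SF
variable {n : ℕ}

instance : CoeFun (SF n) (fun _ => En n → ℂ) := ⟨Subtype.val⟩

lemma contDiff (F : SF n) : ContDiff ℝ ((⊤ : ℕ∞) : WithTop ℕ∞) (F : En n → ℂ) := F.2
lemma differentiable (F : SF n) : Differentiable ℝ (F : En n → ℂ) :=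
  F.contDiff.differentiable (by simp)
lemma differentiableAt (F : SF n) (z : En n) : DifferentiableAt ℝ (F : En n → ℂ) z :=
  F.differentiable z
lemma continuous (F : SF n) : Continuous (F : En n → ℂ) := F.contDiff.continuous

lemma ext_val {F G : SF n} (h : ∀ z, F z = G z) : F = G := Subtype.ext (funext h)

@[simp] lemma add_val (F G : SF n) (z : En n) : (F + G) z = F z + G z := rfl
@[simp] lemma sub_val (F G : SF n) (z : En n) : (F - G) z = F z - G z := rfl
@[simp] lemma neg_val (F : SF n) (z : En n) : (-F) z = -F z := rfl
@[simp] lemma mul_val (F G : SF n) (z : En n) : (F * G) z = F z * G z := rfl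
@[simp] lemma smul_val (c : ℂ) (F : SF n) (z : En n) : (c • F) z = c * F z := rfl
@[simp] lemma one_val (z : En n) : (1 : SF n) z = 1 := rfl
@[simp] lemma zero_val (z : En n) : (0 : SF n) z = 0 := rfl
@[simp] lemma natCast_val (k : ℕ) (z : En n) : (k : SF n) z = k := rfl
@[simp] lemma algebraMap_val (c : ℂ) (z : En n) : ((algebraMap ℂ (SF n) c : SF n) : En n → ℂ) z = c := rfl
@[simp] lemma sum_val {ι : Type*} (s : Finset ι) (F : ι → SF n) (z : En n) :
    (∑ i ∈ s, F i) z = ∑ i ∈ s, F i z := by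
  classical
  induction s using Finset.induction_on with
  | empty => simp
  | insert a s ha ih => rw [Finset.sum_insert ha, Finset.sum_insert ha, add_val, ih]

/-- The directional derivative as a derivation. -/
noncomputable def dir (v : En n) : Derivation ℂ (SF n) (SF n) :=
  Derivation.mk'
    { toFun := fun F => ⟨fun z => fderiv ℝ F z v,
        (F.contDiff.fderiv_right (m := ((⊤ : ℕ∞) : WithTop ℕ∞)) (by simp)).clm_apply
          contDiff_const⟩
      map_add' := fun F G => ext_val fun z => by
        have : ((F + G : SF n) : En n → ℂ) = (F : En n → ℂ) + G := rfl
        simp only [this, add_val]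
        rw [fderiv_add (F.differentiableAt z) (G.differentiableAt z)]; rfl
      map_smul' := fun c F => ext_val fun z => by
        have : ((c • F : SF n) : En n → ℂ) = c • (F : En n → ℂ) := rfl
        simp only [this, RingHom.id_apply, smul_val]
        rw [fderiv_const_smul (F.differentiableAt z)]; rfl }
    (fun F G => ext_val fun z => by
        have : ((F * G : SF n) : En n → ℂ) = (F : En n → ℂ) * G := rfl
        simp only [LinearMap.coe_mk, AddHom.coe_mk, this, add_val]
        rw [fderiv_mul (F.differentiableAt z) (G.differentiableAt z)]
        simp [smul_eq_mul])

lemma dir_val (v : En n) (F : SF n) (z : En n) : dir v F z = fderiv ℝ F z v := rfl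

lemma dir_comm (v w : En n) (F : SF n) : dir v (dir w F) = dir w (dir v F) := by
  refine ext_val fun z => ?_
  have h2 : ContDiffAt ℝ 2 (F : En n → ℂ) z := (F.contDiff.of_le (WithTop.coe_le_coe.2 le_top)).contDiffAt
  have hs := h2.isSymmSndFDerivAt (by simp)
  have key : ∀ v w : En n, dir v (dir w F) z = fderiv ℝ (fderiv ℝ F) z v w := by
    intro v w
    rw [dir_val]
    have : ((dir w F : SF n) : En n → ℂ) = fun z => (fderiv ℝ F z) w := rfl
    rw [this]
    have hd : DifferentiableAt ℝ (fderiv ℝ (F : En n → ℂ)) z :=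
      ((F.contDiff.fderiv_right (m := 1) (WithTop.coe_le_coe.2 le_top)).differentiable (by simp)) z
    rw [fderiv_clm_apply hd (by fun_prop)]
    simp
  rw [key, key]
  exact hs.eq v w

/-- `∂/∂z_j` as a derivation. -/
noncomputable def dz (j : Fin n) : Derivation ℂ (SF n) (SF n) :=
  (1/2 : ℂ) • (dir (EuclideanSpace.single j 1) - Complex.I • dir (EuclideanSpace.single j Complex.I))

/-- `∂/∂z̄_j` as a derivation. -/
noncomputable def dzb (j : Fin n) : Derivation ℂ (SF n) (SF n) :=
  (1/2 : ℂ) • (dir (EuclideanSpace.single j 1) + Complex.I • dir (EuclideanSpace.single j Complex.I))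

lemma dz_val (j : Fin n) (F : SF n) (z : En n) : dz j F z = wd n j F z := rfl
lemma dzb_val (j : Fin n) (F : SF n) (z : En n) : dzb j F z = wdb n j F z := rfl
lemma coe_dz (j : Fin n) (F : SF n) : (dz j F : En n → ℂ) = wd n j F := rfl
lemma coe_dzb (j : Fin n) (F : SF n) : (dzb j F : En n → ℂ) = wdb n j F := rfl

lemma dz_eq (j : Fin n) (F : SF n) : dz j F = (1/2 : ℂ) • (dir (EuclideanSpace.single j 1) F -
  Complex.I • dir (EuclideanSpace.single j Complex.I) F) := rfl
lemma dzb_eq (j : Fin n) (F : SF n) : dzb j F = (1/2 : ℂ) • (dir (EuclideanSpace.single j 1) F +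
  Complex.I • dir (EuclideanSpace.single j Complex.I) F) := rfl

lemma dz_dzb (j k : Fin n) (F : SF n) : dz j (dzb k F) = dzb k (dz j F) := by
  simp only [dz_eq, dzb_eq, Derivation.map_smul, map_add, map_sub,
    dir_comm (EuclideanSpace.single k _) (EuclideanSpace.single j _)]
  module
lemma dz_dz (j k : Fin n) (F : SF n) : dz j (dz k F) = dz k (dz j F) := by
  simp only [dz_eq, Derivation.map_smul, map_sub,
    dir_comm (EuclideanSpace.single k _) (EuclideanSpace.single j _)]
  module
lemma dzb_dzb (j k : Fin n) (F : SF n) : dzb j (dzb k F) = dzb k (dzb j F) := by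
  simp only [dzb_eq, Derivation.map_smul, map_add,
    dir_comm (EuclideanSpace.single k _) (EuclideanSpace.single j _)]
  module

/-- Complex conjugation. -/
noncomputable def conj (F : SF n) : SF n :=
  ⟨fun z => (starRingEnd ℂ) (F z), Complex.conjCLE.contDiff.comp F.contDiff⟩

@[simp] lemma conj_val (F : SF n) (z : En n) : conj F z = (starRingEnd ℂ) (F z) := rfl
lemma conj_add (F G : SF n) : conj (F + G) = conj F + conj G := ext_val fun z => by simp
lemma conj_sub (F G : SF n) : conj (F - G) = conj F - conj G := ext_val fun z => by simp
lemma conj_mul (F G : SF n) : conj (F * G) = conj F * conj G := ext_val fun z => by simp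
lemma conj_conj (F : SF n) : conj (conj F) = F := ext_val fun z => by simp
lemma conj_sum {ι : Type*} (s : Finset ι) (F : ι → SF n) :
    conj (∑ i ∈ s, F i) = ∑ i ∈ s, conj (F i) := ext_val fun z => by simp

lemma dir_conj (v : En n) (F : SF n) : dir v (conj F) = conj (dir v F) := by
  refine ext_val fun z => ?_
  rw [dir_val, conj_val, dir_val]
  have : ((conj F : SF n) : En n → ℂ) = Complex.conjCLE ∘ F := rfl
  rw [this, Complex.conjCLE.comp_fderiv]
  simp

lemma dz_conj (j : Fin n) (F : SF n) : dz j (conj F) = conj (dzb j F) := by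
  refine ext_val fun z => ?_
  simp [dz_eq, dzb_eq, dir_conj, Complex.conj_ofNat]
  ring
lemma dzb_conj (j : Fin n) (F : SF n) : dzb j (conj F) = conj (dz j F) := by
  refine ext_val fun z => ?_
  simp [dz_eq, dzb_eq, dir_conj, Complex.conj_ofNat]
  ring

/-- The coordinate function `z_j`. -/
noncomputable def X (j : Fin n) : SF n :=
  ⟨fun z => z j, ((PiLp.proj (𝕜 := ℝ) 2 (fun _ : Fin n => ℂ) j).contDiff :
    ContDiff ℝ ((⊤ : ℕ∞) : WithTop ℕ∞) _)⟩

lemma X_val (j : Fin n) (z : En n) : X j z = z j := rfl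

lemma dir_X (v : En n) (j : Fin n) : dir v (X j) = algebraMap ℂ (SF n) (v j) := by
  refine ext_val fun z => ?_
  have : (X j : En n → ℂ) = PiLp.proj (𝕜 := ℝ) 2 (fun _ : Fin n => ℂ) j := rfl
  rw [dir_val, this, ContinuousLinearMap.fderiv]
  rfl

lemma dz_X (j k : Fin n) : dz j (X k) = if j = k then 1 else 0 := by
  refine ext_val fun z => ?_
  rw [dz_eq, dir_X, dir_X]
  by_cases h : j = k
  · subst h; simp
    norm_num
  · simp [Ne.symm h, h]

lemma dzb_X (j k : Fin n) : dzb j (X k) = 0 := by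
  refine ext_val fun z => ?_
  rw [dzb_eq, dir_X, dir_X]
  by_cases h : j = k
  · subst h; simp
  · simp [Ne.symm h]

lemma dzb_Xb (j k : Fin n) : dzb j (conj (X k)) = if j = k then 1 else 0 := by
  rw [dzb_conj, dz_X]
  split_ifs <;> exact ext_val fun z => by simp

lemma dz_Xb (j k : Fin n) : dz j (conj (X k)) = 0 := by
  rw [dz_conj, dzb_X]; exact ext_val fun z => by simp

/-- Pointwise locality. -/
lemma dz_congr {F G : SF n} {U : Set (En n)} (hU : IsOpen U) (h : ∀ z ∈ U, F z = G z)
    (j : Fin n) : ∀ z ∈ U, dz j F z = dz j G z := by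
  intro z hz
  have : (F : En n → ℂ) =ᶠ[nhds z] G := Filter.eventuallyEq_of_mem (hU.mem_nhds hz) h
  simp only [dz_val, wd, this.fderiv_eq]

lemma dzb_congr {F G : SF n} {U : Set (En n)} (hU : IsOpen U) (h : ∀ z ∈ U, F z = G z)
    (j : Fin n) : ∀ z ∈ U, dzb j F z = dzb j G z := by
  intro z hz
  have : (F : En n → ℂ) =ᶠ[nhds z] G := Filter.eventuallyEq_of_mem (hU.mem_nhds hz) h
  simp only [dzb_val, wdb, this.fderiv_eq]

end SF

namespace SF
variable {n : ℕ}

/-- The coordinate function `z̄_j`. -/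
noncomputable def Xb (j : Fin n) : SF n := conj (X j)
/-- The complex tangential derivation `z̄_j ∂_k − z̄_k ∂_j`. -/
noncomputable def L (j k : Fin n) : Derivation ℂ (SF n) (SF n) := Xb j • dz k - Xb k • dz j
/-- The complex tangential derivation `z_j ∂̄_k − z_k ∂̄_j`. -/
noncomputable def Lb (j k : Fin n) : Derivation ℂ (SF n) (SF n) := X j • dzb k - X k • dzb j
/-- The holomorphic Euler derivation `∑ z_j ∂_j`. -/
noncomputable def R : Derivation ℂ (SF n) (SF n) := ∑ j, X j • dz j
/-- The antiholomorphic Euler derivation `∑ z̄_j ∂̄_j`. -/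
noncomputable def Rb : Derivation ℂ (SF n) (SF n) := ∑ j, Xb j • dzb j
/-- One quarter of the Euclidean Laplacian. -/
noncomputable def Lap : SF n →ₗ[ℂ] SF n :=
  ∑ j, ((dz j : Derivation ℂ (SF n) (SF n)) : SF n →ₗ[ℂ] SF n) ∘ₗ (dzb j : SF n →ₗ[ℂ] SF n)
/-- The function `|z|²`. -/
noncomputable def tt : SF n := ∑ j, X j * Xb j

lemma L_apply (j k : Fin n) (F : SF n) : L j k F = Xb j * dz k F - Xb k * dz j F := rfl
lemma Lb_apply (j k : Fin n) (F : SF n) : Lb j k F = X j * dzb k F - X k * dzb j F := rfl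
lemma sum_derivation_apply {ι : Type*} (s : Finset ι) (d : ι → Derivation ℂ (SF n) (SF n)) (F : SF n) :
    (∑ j ∈ s, d j) F = ∑ j ∈ s, d j F := by
  classical
  induction s using Finset.induction_on with
  | empty => simp
  | insert a s ha ih => rw [Finset.sum_insert ha, Finset.sum_insert ha, Derivation.add_apply, ih]
lemma R_apply (F : SF n) : R F = ∑ j, X j * dz j F := by
  rw [R, sum_derivation_apply]; rfl
lemma Rb_apply (F : SF n) : Rb F = ∑ j, Xb j * dzb j F := by
  rw [Rb, sum_derivation_apply]; rfl
lemma Lap_apply (F : SF n) : Lap F = ∑ j, dz j (dzb j F) := by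
  simp [Lap]

lemma dz_Xb' (j k : Fin n) : dz j (Xb k) = 0 := dz_Xb j k
lemma dzb_Xb' (j k : Fin n) : dzb j (Xb k) = if j = k then 1 else 0 := dzb_Xb j k

lemma dz_mul (j : Fin n) (F G : SF n) : dz j (F * G) = dz j F * G + F * dz j G := by
  rw [Derivation.leibniz, smul_eq_mul, smul_eq_mul]; ring
lemma dzb_mul (j : Fin n) (F G : SF n) : dzb j (F * G) = dzb j F * G + F * dzb j G := by
  rw [Derivation.leibniz, smul_eq_mul, smul_eq_mul]; ring
lemma R_mul (F G : SF n) : R (F * G) = R F * G + F * R G := by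
  rw [Derivation.leibniz, smul_eq_mul, smul_eq_mul]; ring
lemma Rb_mul (F G : SF n) : Rb (F * G) = Rb F * G + F * Rb G := by
  rw [Derivation.leibniz, smul_eq_mul, smul_eq_mul]; ring

lemma dz_R (j : Fin n) (F : SF n) : dz j (R F) = R (dz j F) + dz j F := by
  simp only [R_apply, map_sum, dz_mul, dz_X, Finset.sum_add_distrib, ite_mul, one_mul, zero_mul,
    Finset.sum_ite_eq, Finset.mem_univ, if_true]
  rw [add_comm]
  congr 1
  exact Finset.sum_congr rfl fun k _ => by rw [dz_dz]
lemma dzb_R (j : Fin n) (F : SF n) : dzb j (R F) = R (dzb j F) := by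
  simp only [R_apply, map_sum, dzb_mul, dzb_X, zero_mul, zero_add]
  exact Finset.sum_congr rfl fun k _ => by rw [dz_dzb]
lemma dzb_Rb (j : Fin n) (F : SF n) : dzb j (Rb F) = Rb (dzb j F) + dzb j F := by
  simp only [Rb_apply, map_sum, dzb_mul, dzb_Xb', Finset.sum_add_distrib, ite_mul, one_mul, zero_mul,
    Finset.sum_ite_eq, Finset.mem_univ, if_true]
  rw [add_comm]
  congr 1
  exact Finset.sum_congr rfl fun k _ => by rw [dzb_dzb]
lemma dz_Rb (j : Fin n) (F : SF n) : dz j (Rb F) = Rb (dz j F) := by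
  simp only [Rb_apply, map_sum, dz_mul, dz_Xb', zero_mul, zero_add]
  exact Finset.sum_congr rfl fun k _ => by rw [dz_dzb]

lemma R_X (j : Fin n) : R (X j) = X j := by
  simp [R_apply, dz_X]
lemma R_Xb (j : Fin n) : R (Xb j : SF n) = 0 := by
  simp [R_apply, dz_Xb']
lemma Rb_X (j : Fin n) : Rb (X j) = 0 := by
  simp [Rb_apply, dzb_X]
lemma Rb_Xb (j : Fin n) : Rb (Xb j : SF n) = Xb j := by
  simp [Rb_apply, dzb_Xb']

lemma R_Rb (F : SF n) : R (Rb F) = Rb (R F) := by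
  rw [Rb_apply, map_sum, Rb_apply]
  exact Finset.sum_congr rfl fun k _ => by rw [R_mul, R_Xb, dzb_R]; ring

lemma R_tt : R (tt : SF n) = tt := by
  simp [tt, R_X, R_Xb, mul_comm]
lemma Rb_tt : Rb (tt : SF n) = tt := by
  simp [tt, Rb_X, Rb_Xb]

lemma Lap_R (F : SF n) : Lap (R F) = R (Lap F) + Lap F := by
  simp only [Lap_apply, map_sum, dzb_R, dz_R, Finset.sum_add_distrib]
lemma Lap_Rb (F : SF n) : Lap (Rb F) = Rb (Lap F) + Lap F := by
  simp only [Lap_apply, map_sum, dzb_Rb, dz_Rb, map_add, Finset.sum_add_distrib]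

lemma dz_tt (j : Fin n) : dz j (tt : SF n) = Xb j := by
  simp [tt, dz_X, dz_Xb']
lemma dzb_tt (j : Fin n) : dzb j (tt : SF n) = X j := by
  simp [tt, dzb_X, dzb_Xb']

lemma Lap_tt_mul (F : SF n) : Lap (tt * F) = tt * Lap F + R F + Rb F + (n : SF n) * F := by
  simp only [Lap_apply, R_apply, Rb_apply, dzb_mul, map_add, dz_mul, dz_tt, dzb_tt, dz_X, if_true,
    Finset.sum_add_distrib, ← Finset.mul_sum, one_mul, Finset.sum_const, Finset.card_univ,
    Fintype.card_fin, nsmul_eq_mul]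
  ring

lemma R_Rb_apply (F : SF n) : R (Rb F) = ∑ j, ∑ k, X j * Xb k * dz j (dzb k F) := by
  simp only [R_apply, dz_Rb]
  simp only [Rb_apply, Finset.mul_sum]
  refine Finset.sum_congr rfl fun j _ => Finset.sum_congr rfl fun k _ => ?_
  rw [dz_dzb]; ring

/-- `∑ L_{jk} L̄_{jk}`. -/
noncomputable def PP : SF n →ₗ[ℂ] SF n :=
  ∑ j, ∑ k, ((L j k : Derivation ℂ (SF n) (SF n)) : SF n →ₗ[ℂ] SF n) ∘ₗ ((Lb j k : Derivation ℂ (SF n) (SF n)) : SF n →ₗ[ℂ] SF n)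
/-- `∑ L̄_{jk} L_{jk}`. -/
noncomputable def QQ : SF n →ₗ[ℂ] SF n :=
  ∑ j, ∑ k, ((Lb j k : Derivation ℂ (SF n) (SF n)) : SF n →ₗ[ℂ] SF n) ∘ₗ ((L j k : Derivation ℂ (SF n) (SF n)) : SF n →ₗ[ℂ] SF n)
/-- The operator `□`. -/
noncomputable def Box : SF n →ₗ[ℂ] SF n := -(PP + QQ)

lemma PP_apply (F : SF n) : PP F = ∑ j, ∑ k, L j k (Lb j k F) := by
  simp [PP, LinearMap.sum_apply]
lemma QQ_apply (F : SF n) : QQ F = ∑ j, ∑ k, Lb j k (L j k F) := by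
  simp [QQ, LinearMap.sum_apply]

lemma PP_eq (F : SF n) : PP F = 2 * tt * Lap F - 2 * R (Rb F) - 2 * ((n : SF n) - 1) * Rb F := by
  have h : ∀ j k : Fin n, L j k (Lb j k F) =
      ((if k = j then Xb j * dzb k F else 0) + (X j * Xb j) * dz k (dzb k F) - Xb j * dzb j F
        - X k * Xb j * dz k (dzb j F)) +
      ((if j = k then Xb k * dzb j F else 0) + (X k * Xb k) * dz j (dzb j F) - Xb k * dzb k F
        - X j * Xb k * dz j (dzb k F)) := by
    intro j k
    simp only [L_apply, Lb_apply, map_sub, dz_mul, dz_X, if_true]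
    split_ifs <;> ring
  have h1 : ∑ j : Fin n, ∑ k : Fin n, ((if k = j then Xb j * dzb k F else 0) +
      (X j * Xb j) * dz k (dzb k F) - Xb j * dzb j F - X k * Xb j * dz k (dzb j F))
      = tt * Lap F - R (Rb F) - ((n : SF n) - 1) * Rb F := by
    simp only [Finset.sum_add_distrib, Finset.sum_sub_distrib, Finset.sum_ite_eq',
      Finset.mem_univ, if_true, Finset.sum_const, Finset.card_univ, Fintype.card_fin,
      nsmul_eq_mul, ← Finset.mul_sum, ← Finset.sum_mul]
    rw [Finset.sum_comm (f := fun j k => X k * Xb j * dz k (dzb j F)), ← R_Rb_apply,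
      ← Rb_apply, ← Lap_apply, ← tt]
    ring
  rw [PP_apply]
  simp only [h, Finset.sum_add_distrib (f := fun k => _ - _)]
  rw [Finset.sum_add_distrib, h1, Finset.sum_comm (f := fun j k => ((if j = k then Xb k * dzb j F else 0) + (X k * Xb k) * dz j (dzb j F) - Xb k * dzb k F
        - X j * Xb k * dz j (dzb k F))), h1]
  ring

lemma conj_X (j : Fin n) : conj (X j) = Xb j := rfl
lemma conj_Xb (j : Fin n) : conj (Xb j) = X j := conj_conj _
lemma conj_L (j k : Fin n) (F : SF n) : conj (L j k F) = Lb j k (conj F) := by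
  simp only [L_apply, Lb_apply, conj_sub, conj_mul, conj_Xb, dzb_conj]
lemma conj_Lb (j k : Fin n) (F : SF n) : conj (Lb j k F) = L j k (conj F) := by
  simp only [L_apply, Lb_apply, conj_sub, conj_mul, conj_X, dz_conj]
lemma conj_R (F : SF n) : conj (R F) = Rb (conj F) := by
  simp only [R_apply, Rb_apply, conj_sum, conj_mul, conj_X, dzb_conj]
lemma conj_Rb (F : SF n) : conj (Rb F) = R (conj F) := by
  simp only [R_apply, Rb_apply, conj_sum, conj_mul, conj_Xb, dz_conj]
lemma conj_tt : conj (tt : SF n) = tt := by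
  simp only [tt, conj_sum, conj_mul, conj_X, conj_Xb, mul_comm]
lemma conj_Lap (F : SF n) : conj (Lap F) = Lap (conj F) := by
  simp only [Lap_apply, conj_sum, dzb_conj, dz_conj, dz_dzb]
lemma conj_natCast (k : ℕ) : conj (k : SF n) = k := ext_val fun z => by simp
lemma conj_two : conj (2 : SF n) = 2 := conj_natCast 2
lemma conj_one : conj (1 : SF n) = 1 := ext_val fun z => by simp

lemma QQ_eq (F : SF n) : QQ F = 2 * tt * Lap F - 2 * R (Rb F) - 2 * ((n : SF n) - 1) * R F := by
  have h : QQ F = conj (PP (conj F)) := by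
    simp only [QQ_apply, PP_apply, conj_sum, conj_L, conj_Lb, conj_conj]
  rw [h, PP_eq]
  simp only [conj_sub, conj_mul, conj_R, conj_Rb, conj_tt, conj_Lap, conj_conj, conj_natCast,
    conj_two, conj_one, R_Rb]

lemma Box_eq (F : SF n) : Box F =
    4 * R (Rb F) - 4 * tt * Lap F + 2 * ((n : SF n) - 1) * (R F + Rb F) := by
  have : Box F = -(PP F + QQ F) := rfl
  rw [this, PP_eq, QQ_eq]; ring

lemma Box_sub (F : SF n) : QQ F - PP F = -(2 * ((n : SF n) - 1) * (R F - Rb F)) := by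
  rw [PP_eq, QQ_eq]; ring

/-- The number operator `R + R̄ = r ∂_r`. -/
noncomputable def N : Derivation ℂ (SF n) (SF n) := R + Rb
/-- The rotation `R - R̄`. -/
noncomputable def D : Derivation ℂ (SF n) (SF n) := R - Rb

lemma N_apply (F : SF n) : N F = R F + Rb F := rfl
lemma D_apply (F : SF n) : D F = R F - Rb F := rfl

lemma R_Box (F : SF n) : R (Box F) = Box (R F) := by
  have h4 : (4 : SF n) = ((4 : ℕ) : SF n) := by norm_cast
  have h2 : (2 : SF n) * ((n : SF n) - 1) = 2 * n - 2 := by ring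
  have h2' : (2 : SF n) = ((2 : ℕ) : SF n) := by norm_cast
  rw [Box_eq, Box_eq]
  simp only [sub_mul, mul_sub, mul_one, h4, h2', map_add, map_sub, mul_assoc,
    R_mul, R_tt, Lap_R, R_Rb, Derivation.map_natCast]
  ring
lemma Rb_Box (F : SF n) : Rb (Box F) = Box (Rb F) := by
  have h4 : (4 : SF n) = ((4 : ℕ) : SF n) := by norm_cast
  have h2' : (2 : SF n) = ((2 : ℕ) : SF n) := by norm_cast
  rw [Box_eq, Box_eq]
  simp only [sub_mul, mul_sub, mul_one, h4, h2', map_add, map_sub, mul_assoc,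
    Rb_mul, Rb_tt, Lap_Rb, R_Rb, Derivation.map_natCast]
  ring
lemma N_Box (F : SF n) : N (Box F) = Box (N F) := by
  simp only [N_apply, R_Box, Rb_Box, map_add]
lemma D_Box (F : SF n) : D (Box F) = Box (D F) := by
  simp only [D_apply, R_Box, Rb_Box, map_sub]
lemma N_D (F : SF n) : N (D F) = D (N F) := by
  simp only [N_apply, D_apply, map_sub, map_add, R_Rb]; ring

/-- The operator whose kernel consists of the `M`-harmonic functions. -/
noncomputable def MM : SF n →ₗ[ℂ] SF n := Lap - ((R : Derivation ℂ (SF n) (SF n)) : SF n →ₗ[ℂ] SF n) ∘ₗ ((Rb : Derivation ℂ (SF n) (SF n)) : SF n →ₗ[ℂ] SF n)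

lemma MM_apply (F : SF n) : MM F = Lap F - R (Rb F) := rfl

lemma Lap_natCast_mul (F : SF n) (k : ℕ) : Lap ((k : SF n) * F) = k * Lap F := by
  rw [← nsmul_eq_mul, map_nsmul, nsmul_eq_mul]

lemma MM_Box (F : SF n) : MM (Box F) = Box (MM F) := by
  have h4 : (4 : SF n) = ((4 : ℕ) : SF n) := by norm_cast
  have h2' : (2 : SF n) = ((2 : ℕ) : SF n) := by norm_cast
  rw [MM_apply, Rb_Box, R_Box, MM_apply, map_sub]
  congr 1
  rw [Box_eq, Box_eq]
  simp only [sub_mul, mul_sub, mul_one, h4, h2', map_add, map_sub, Lap_natCast_mul, mul_assoc,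
    Lap_tt_mul, Lap_R, Lap_Rb]
  push_cast
  ring

lemma Box_val (F : SF n) (z : En n) : Box F z = BoxOp n F z := by
  have : Box F = -(PP F + QQ F) := rfl
  rw [this, PP_apply, QQ_apply]
  simp only [neg_val, add_val, sum_val, BoxOp, Finset.sum_add_distrib]
  rfl

lemma MM_val (F : SF n) (z : En n) : MM F z = ∑ j : Fin n, ∑ k : Fin n,
    ((if j = k then 1 else 0) - z j * (starRingEnd ℂ) (z k)) * wd n j (wdb n k F) z := by
  rw [MM_apply, R_Rb_apply, Lap_apply]
  simp only [sub_val, sum_val, sub_mul, Finset.sum_sub_distrib, ite_mul, one_mul, zero_mul,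
    Finset.sum_ite_eq, Finset.mem_univ, if_true]
  rfl

end SF

instance (n : ℕ) : Measure.IsAddHaarMeasure (volume : Measure (En n)) :=
  ContinuousLinearEquiv.isAddHaarMeasure_map
    (PiLp.continuousLinearEquiv 2 ℝ (fun _ : Fin n => ℂ)).symm volume

/-- Radial weights, as smooth functions of `x = 1 - |z|²` vanishing near `x ≤ 0`. -/
noncomputable def WtS : Submodule ℝ (ℝ → ℝ) where
  carrier := {p | ContDiff ℝ ((⊤ : ℕ∞) : WithTop ℕ∞) p ∧ ∃ δ > 0, ∀ x ≤ δ, p x = 0}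
  add_mem' := by
    rintro p q ⟨hp, δ, hδ, h⟩ ⟨hq, ε, hε, h'⟩
    refine ⟨ContDiff.add hp hq, min δ ε, lt_min hδ hε, fun x hx => ?_⟩
    simp [h x (hx.trans (min_le_left _ _)), h' x (hx.trans (min_le_right _ _))]
  zero_mem' := ⟨contDiff_const, 1, one_pos, fun _ _ => rfl⟩
  smul_mem' := by
    rintro c p ⟨hp, δ, hδ, h⟩
    exact ⟨contDiff_const.smul hp, δ, hδ, fun x hx => by simp [h x hx]⟩

/-- Radial weights. -/
abbrev Wt : Type := WtS

namespace Wt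
instance : CoeFun Wt (fun _ => ℝ → ℝ) := ⟨Subtype.val⟩

@[simp] lemma add_val (p q : Wt) (x : ℝ) : (p + q) x = p x + q x := rfl
@[simp] lemma sub_val (p q : Wt) (x : ℝ) : (p - q) x = p x - q x := rfl
@[simp] lemma smul_val (c : ℝ) (p : Wt) (x : ℝ) : (c • p) x = c * p x := rfl
lemma contDiff (p : Wt) : ContDiff ℝ ((⊤ : ℕ∞) : WithTop ℕ∞) p := p.2.1
lemma differentiable (p : Wt) : Differentiable ℝ p := p.contDiff.differentiable (by simp)

/-- The derivative of a weight. -/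
noncomputable def der (p : Wt) : Wt :=
  ⟨deriv p, by
    refine ⟨ContDiff.deriv' (n := ((⊤ : ℕ∞) : WithTop ℕ∞)) p.contDiff, ?_⟩
    obtain ⟨δ, hδ, h⟩ := p.2.2
    refine ⟨δ / 2, half_pos hδ, fun x hx => ?_⟩
    have : p.1 =ᶠ[nhds x] fun _ => 0 :=
      Filter.eventuallyEq_of_mem (Iio_mem_nhds (show x < δ by linarith)) fun y hy => h y (le_of_lt hy)
    rw [this.deriv_eq]; simp⟩

lemma der_val (p : Wt) (x : ℝ) : der p x = deriv p x := rfl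

/-- Multiplication of a weight by `x`. -/
noncomputable def xm (p : Wt) : Wt :=
  ⟨fun x => x * p x, contDiff_id.mul p.contDiff, by
    obtain ⟨δ, hδ, h⟩ := p.2.2
    exact ⟨δ, hδ, fun x hx => by simp [h x hx]⟩⟩

@[simp] lemma xm_val (p : Wt) (x : ℝ) : xm p x = x * p x := rfl

/-- The weight `2(1-x)p' - 2np` arising from integration by parts. -/
noncomputable def st (n : ℕ) (p : Wt) : Wt := (2 : ℝ) • (der p - xm (der p)) - (2 * n : ℝ) • p

lemma st_val (n : ℕ) (p : Wt) (x : ℝ) : st n p x = 2 * (1 - x) * deriv p x - 2 * n * p x := by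
  simp [st, der_val]; ring

end Wt

namespace SF
variable {n : ℕ}

lemma tt_val (z : En n) : (tt : SF n) z = ((‖z‖ ^ 2 : ℝ) : ℂ) := by
  rw [EuclideanSpace.norm_sq_eq]
  simp [tt, Xb, X_val, Complex.mul_conj, Complex.normSq_eq_norm_sq]

lemma contDiff_normSq : ContDiff ℝ ((⊤ : ℕ∞) : WithTop ℕ∞) (fun z : En n => 1 - ‖z‖ ^ 2) := by
  have : (fun z : En n => 1 - ‖z‖ ^ 2) = fun z => 1 - Complex.reCLM ((tt : SF n) z) := by
    funext z; rw [tt_val, Complex.reCLM_apply, Complex.ofReal_re]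
  rw [this]
  exact contDiff_const.sub (Complex.reCLM.contDiff.comp tt.contDiff)

/-- The smooth radial function attached to a smooth function of `x = 1 - |z|²`. -/
noncomputable def rad (p : ℝ → ℝ) (hp : ContDiff ℝ ((⊤ : ℕ∞) : WithTop ℕ∞) p) : SF n :=
  ⟨fun z => Complex.ofRealCLM (p (1 - ‖z‖ ^ 2)),
    Complex.ofRealCLM.contDiff.comp (hp.comp contDiff_normSq)⟩

lemma rad_val (p : ℝ → ℝ) (hp) (z : En n) : (rad p hp : SF n) z = (p (1 - ‖z‖ ^ 2) : ℂ) := rfl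

lemma dir_rad (v : En n) (p : ℝ → ℝ) (hp) : dir v (rad p hp : SF n) =
    -(rad (deriv p) (ContDiff.deriv' (n := ((⊤ : ℕ∞) : WithTop ℕ∞)) hp)) * dir v tt := by
  refine ext_val fun z => ?_
  have h1 : HasFDerivAt (fun z : En n => 1 - ‖z‖ ^ 2)
      (-(Complex.reCLM.comp (fderiv ℝ (tt : SF n) z))) z := by
    have : (fun z : En n => 1 - ‖z‖ ^ 2) = fun z => 1 - Complex.reCLM ((tt : SF n) z) := by
      funext z; rw [tt_val, Complex.reCLM_apply, Complex.ofReal_re]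
    rw [this]
    exact (Complex.reCLM.hasFDerivAt.comp z (tt.differentiableAt z).hasFDerivAt).const_sub 1
  have h2 : HasDerivAt p (deriv p (1 - ‖z‖ ^ 2)) (1 - ‖z‖ ^ 2) :=
    (hp.differentiable (by simp) _).hasDerivAt
  have h3 := Complex.ofRealCLM.hasFDerivAt.comp z (h2.hasFDerivAt.comp z h1)
  have h4 : ((rad p hp : SF n) : En n → ℂ) = Complex.ofRealCLM ∘ (p ∘ fun z : En n => 1 - ‖z‖ ^ 2) := rfl
  have h5 : (starRingEnd ℂ) (dir v (tt : SF n) z) = dir v tt z := by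
    rw [← conj_val, ← dir_conj, conj_tt]
  rw [dir_val, h4, h3.fderiv]
  rw [Complex.conj_eq_iff_re] at h5
  rw [mul_val, ← h5, neg_val, rad_val]
  simp [dir_val]
  ring

lemma dz_rad (j : Fin n) (p : ℝ → ℝ) (hp) : dz j (rad p hp : SF n) =
    -(rad (deriv p) (ContDiff.deriv' (n := ((⊤ : ℕ∞) : WithTop ℕ∞)) hp)) * Xb j := by
  rw [← dz_tt, dz_eq, dz_eq, dir_rad, dir_rad]
  simp only [Algebra.smul_def]; ring
lemma dzb_rad (j : Fin n) (p : ℝ → ℝ) (hp) : dzb j (rad p hp : SF n) =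
    -(rad (deriv p) (ContDiff.deriv' (n := ((⊤ : ℕ∞) : WithTop ℕ∞)) hp)) * X j := by
  rw [← dzb_tt, dzb_eq, dzb_eq, dir_rad, dir_rad]
  simp only [Algebra.smul_def]; ring

/-- The smooth function on `ℂⁿ` attached to a weight. -/
noncomputable def W (p : Wt) : SF n := rad p p.contDiff

lemma W_val (p : Wt) (z : En n) : (W p : SF n) z = (p (1 - ‖z‖ ^ 2) : ℂ) := rfl

lemma W_add (p q : Wt) : (W (p + q) : SF n) = W p + W q := ext_val fun z => by simp [W_val]
lemma W_smul (c : ℝ) (p : Wt) : (W (c • p) : SF n) = (c : ℂ) • W p :=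
  ext_val fun z => by simp [W_val]
lemma W_sub (p q : Wt) : (W (p - q) : SF n) = W p - W q := ext_val fun z => by simp [W_val]
lemma W_xm (p : Wt) : (W p.xm : SF n) = (1 - tt) * W p :=
  ext_val fun z => by simp [W_val, tt_val]
lemma dz_W (j : Fin n) (p : Wt) : dz j (W p : SF n) = -(W p.der) * Xb j := dz_rad j p _
lemma dzb_W (j : Fin n) (p : Wt) : dzb j (W p : SF n) = -(W p.der) * X j := dzb_rad j p _

lemma R_W (p : Wt) : R (W p : SF n) = -(W p.der) * tt := by
  simp only [R_apply, dz_W, tt, Finset.mul_sum]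
  exact Finset.sum_congr rfl fun _ _ => by ring
lemma Rb_W (p : Wt) : Rb (W p : SF n) = -(W p.der) * tt := by
  simp only [Rb_apply, dzb_W, tt, Finset.mul_sum]
  exact Finset.sum_congr rfl fun _ _ => by ring
lemma L_W (j k : Fin n) (p : Wt) : L j k (W p : SF n) = 0 := by
  rw [L_apply, dz_W, dz_W]; ring

/-! ### Integration by parts -/

lemma hcs_W (p : Wt) : HasCompactSupport ((W p : SF n) : En n → ℂ) := by
  obtain ⟨δ, hδ, h⟩ := p.2.2
  refine HasCompactSupport.intro (isCompact_closedBall (0 : En n) 1) fun z hz => ?_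
  rw [Metric.mem_closedBall, dist_zero_right, not_le] at hz
  rw [W_val, h _ (by nlinarith)]; simp

lemma integrable_of_hcs {F : SF n} (h : HasCompactSupport (F : En n → ℂ)) :
    Integrable (F : En n → ℂ) := F.continuous.integrable_of_hasCompactSupport h

end SF

lemma integral_fderiv_eq_zero {n : ℕ} {G : En n → ℂ} (hG : ContDiff ℝ 1 G)
    (hc : HasCompactSupport G) (v : En n) : ∫ z, fderiv ℝ G z v = 0 := by
  have hi : Integrable (fun z => fderiv ℝ G z v) :=
    ((hG.continuous_fderiv (by simp)).clm_apply continuous_const).integrable_of_hasCompactSupport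
      (hc.fderiv_apply (𝕜 := ℝ) v)
  have := integral_mul_fderiv_eq_neg_fderiv_mul_of_integrable (𝕜 := ℂ) (μ := (volume : Measure (En n)))
    (f := fun _ => (1 : ℂ)) (g := G) (v := v) (by simp)
    (by simpa using hi)
    (by simpa using hG.continuous.integrable_of_hasCompactSupport hc) (by simp)
    (fun x _ => hG.differentiable (by simp) x)
  simpa using this

lemma integral_wd_eq_zero {n : ℕ} {G : En n → ℂ} (hG : ContDiff ℝ 1 G)
    (hc : HasCompactSupport G) (j : Fin n) : ∫ z, wd n j G z = 0 := by
  have hi : ∀ v, Integrable (fun z => fderiv ℝ G z v) := fun v =>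
    ((hG.continuous_fderiv (by simp)).clm_apply continuous_const).integrable_of_hasCompactSupport
      (hc.fderiv_apply (𝕜 := ℝ) v)
  simp only [wd]
  rw [integral_const_mul, integral_sub (hi _) ((hi _).const_mul _), integral_const_mul,
    integral_fderiv_eq_zero hG hc, integral_fderiv_eq_zero hG hc]
  simp

lemma integral_wdb_eq_zero {n : ℕ} {G : En n → ℂ} (hG : ContDiff ℝ 1 G)
    (hc : HasCompactSupport G) (j : Fin n) : ∫ z, wdb n j G z = 0 := by
  have hi : ∀ v, Integrable (fun z => fderiv ℝ G z v) := fun v =>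
    ((hG.continuous_fderiv (by simp)).clm_apply continuous_const).integrable_of_hasCompactSupport
      (hc.fderiv_apply (𝕜 := ℝ) v)
  simp only [wdb]
  rw [integral_const_mul, integral_add (hi _) ((hi _).const_mul _), integral_const_mul,
    integral_fderiv_eq_zero hG hc, integral_fderiv_eq_zero hG hc]
  simp

namespace SF
variable {n : ℕ}

lemma hcs_mul {F : SF n} (h : HasCompactSupport (F : En n → ℂ)) (G : SF n) :
    HasCompactSupport ((F * G : SF n) : En n → ℂ) := HasCompactSupport.mul_right h

lemma hcs_dz {F : SF n} (h : HasCompactSupport (F : En n → ℂ)) (j : Fin n) :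
    HasCompactSupport ((dz j F : SF n) : En n → ℂ) := by
  refine h.mono' fun z hz => ?_
  by_contra h0
  refine hz ?_
  have : fderiv ℝ (F : En n → ℂ) z = 0 := by
    have := (notMem_tsupport_iff_eventuallyEq.1 h0).fderiv_eq (𝕜 := ℝ)
    rw [this]; simp
  simp [dz_val, wd, this]
lemma hcs_dzb {F : SF n} (h : HasCompactSupport (F : En n → ℂ)) (j : Fin n) :
    HasCompactSupport ((dzb j F : SF n) : En n → ℂ) := by
  refine h.mono' fun z hz => ?_
  by_contra h0
  refine hz ?_
  have : fderiv ℝ (F : En n → ℂ) z = 0 := by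
    have := (notMem_tsupport_iff_eventuallyEq.1 h0).fderiv_eq (𝕜 := ℝ)
    rw [this]; simp
  simp [dzb_val, wdb, this]

lemma integral_dz {F : SF n} (h : HasCompactSupport (F : En n → ℂ)) (j : Fin n) :
    ∫ z, dz j F z = 0 :=
  integral_wd_eq_zero (F.contDiff.of_le (WithTop.coe_le_coe.2 le_top)) h j
lemma integral_dzb {F : SF n} (h : HasCompactSupport (F : En n → ℂ)) (j : Fin n) :
    ∫ z, dzb j F z = 0 :=
  integral_wdb_eq_zero (F.contDiff.of_le (WithTop.coe_le_coe.2 le_top)) h j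

lemma integral_L {F : SF n} (h : HasCompactSupport (F : En n → ℂ)) (j k : Fin n) :
    ∫ z, L j k F z = 0 := by
  have e : L j k F = dz k (F * Xb j) - dz j (F * Xb k) := by
    rw [L_apply, dz_mul, dz_mul, dz_Xb', dz_Xb']; ring
  rw [e]
  simp only [sub_val]
  rw [integral_sub (integrable_of_hcs (hcs_dz (hcs_mul h _) _))
    (integrable_of_hcs (hcs_dz (hcs_mul h _) _)), integral_dz (hcs_mul h _),
    integral_dz (hcs_mul h _), sub_zero]

lemma integrable_R {F : SF n} (h : HasCompactSupport (F : En n → ℂ)) :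
    Integrable (fun z => R F z) := by
  rw [R_apply]; simp only [sum_val]
  exact integrable_finsetSum _ fun j _ => by
    rw [mul_comm]; exact integrable_of_hcs (hcs_mul (hcs_dz h _) _)
lemma integrable_Rb {F : SF n} (h : HasCompactSupport (F : En n → ℂ)) :
    Integrable (fun z => Rb F z) := by
  rw [Rb_apply]; simp only [sum_val]
  exact integrable_finsetSum _ fun j _ => by
    rw [mul_comm]; exact integrable_of_hcs (hcs_mul (hcs_dzb h _) _)
lemma integral_R {F : SF n} (h : HasCompactSupport (F : En n → ℂ)) :
    ∫ z, R F z = -n * ∫ z, F z := by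
  have e : R F = (∑ j, dz j (F * X j)) - (n : SF n) * F := by
    simp only [R_apply, dz_mul, dz_X, if_true, Finset.sum_add_distrib, mul_one, Finset.sum_const,
      Finset.card_univ, Fintype.card_fin, nsmul_eq_mul, add_sub_cancel_right]
    exact Finset.sum_congr rfl fun _ _ => mul_comm _ _
  rw [e]
  simp only [sub_val, sum_val]
  simp only [mul_val (n : SF n), natCast_val]
  rw [integral_sub (integrable_finsetSum _ fun j _ =>
      integrable_of_hcs (hcs_dz (hcs_mul h _) _)) ((integrable_of_hcs h).const_mul _),
    integral_finsetSum _ fun j _ => integrable_of_hcs (hcs_dz (hcs_mul h _) _),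
    integral_const_mul]
  simp only [integral_dz (hcs_mul h _)]; simp
lemma integral_Rb {F : SF n} (h : HasCompactSupport (F : En n → ℂ)) :
    ∫ z, Rb F z = -n * ∫ z, F z := by
  have e : Rb F = (∑ j, dzb j (F * Xb j)) - (n : SF n) * F := by
    simp only [Rb_apply, dzb_mul, dzb_Xb', if_true, Finset.sum_add_distrib, mul_one, Finset.sum_const,
      Finset.card_univ, Fintype.card_fin, nsmul_eq_mul, add_sub_cancel_right]
    exact Finset.sum_congr rfl fun _ _ => mul_comm _ _
  rw [e]
  simp only [sub_val, sum_val]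
  simp only [mul_val (n : SF n), natCast_val]
  rw [integral_sub (integrable_finsetSum _ fun j _ =>
      integrable_of_hcs (hcs_dzb (hcs_mul h _) _)) ((integrable_of_hcs h).const_mul _),
    integral_finsetSum _ fun j _ => integrable_of_hcs (hcs_dzb (hcs_mul h _) _),
    integral_const_mul]
  simp only [integral_dzb (hcs_mul h _)]; simp

/-! ### The weighted sesquilinear pairing -/

/-- The pairing `∫ w F Ḡ`. -/
noncomputable def br (p : Wt) (F G : SF n) : ℂ := ∫ z, (W p * F * conj G : SF n) z

lemma hcs_br (p : Wt) (F G : SF n) :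
    HasCompactSupport ((W p * F * conj G : SF n) : En n → ℂ) :=
  hcs_mul (hcs_mul (hcs_W p) F) _

lemma br_add_left (p : Wt) (F F' G : SF n) : br p (F + F') G = br p F G + br p F' G := by
  rw [br, br, br, ← integral_add (integrable_of_hcs (hcs_br _ _ _)) (integrable_of_hcs (hcs_br _ _ _))]
  congr 1; funext z; simp; ring
lemma br_add_right (p : Wt) (F G G' : SF n) : br p F (G + G') = br p F G + br p F G' := by
  rw [br, br, br, ← integral_add (integrable_of_hcs (hcs_br _ _ _)) (integrable_of_hcs (hcs_br _ _ _))]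
  congr 1; funext z; simp; ring
lemma br_smul_left (p : Wt) (c : ℂ) (F G : SF n) : br p (c • F) G = c * br p F G := by
  rw [br, br, ← integral_const_mul]
  congr 1; funext z; simp only [mul_val, smul_val]; ring
lemma br_neg_left (p : Wt) (F G : SF n) : br p (-F) G = -br p F G := by
  rw [← neg_one_smul ℂ, br_smul_left]; ring
lemma br_sub_left (p : Wt) (F F' G : SF n) : br p (F - F') G = br p F G - br p F' G := by
  rw [sub_eq_add_neg, br_add_left, br_neg_left]; ring
lemma br_conj (p : Wt) (F G : SF n) : (starRingEnd ℂ) (br p F G) = br p G F := by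
  rw [br, br, ← integral_conj]
  congr 1; funext z
  simp [W_val]; ring
lemma br_sum_left {ι : Type*} (s : Finset ι) (p : Wt) (F : ι → SF n) (G : SF n) :
    br p (∑ i ∈ s, F i) G = ∑ i ∈ s, br p (F i) G := by
  classical
  induction s using Finset.induction_on with
  | empty => simp [br]
  | insert a s ha ih => rw [Finset.sum_insert ha, Finset.sum_insert ha, br_add_left, ih]
lemma br_add_wt (p q : Wt) (F G : SF n) : br (p + q) F G = br p F G + br q F G := by
  rw [br, br, br, ← integral_add (integrable_of_hcs (hcs_br _ _ _)) (integrable_of_hcs (hcs_br _ _ _))]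
  congr 1; funext z; simp [W_add]; ring
lemma br_smul_wt (c : ℝ) (p : Wt) (F G : SF n) : br (c • p) F G = c * br p F G := by
  rw [br, br, ← integral_const_mul]
  congr 1; funext z; simp only [W_smul, mul_val, smul_val]; ring
lemma br_xm (p : Wt) (F G : SF n) : br p ((1 - tt) * F) G = br p.xm F G := by
  rw [br, br, W_xm]; congr 1; funext z; simp only [mul_val]; ring

lemma br_congr (p : Wt) {F F' : SF n} (G : SF n) (h : W p * F = W p * F') : br p F G = br p F' G := by
  rw [br, br, h]

lemma R_conj (F : SF n) : R (conj F) = conj (Rb F) := (conj_Rb F).symm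
lemma Rb_conj (F : SF n) : Rb (conj F) = conj (R F) := (conj_R F).symm

lemma br_N (p : Wt) (F G : SF n) : br p (N F) G = br (p.st n) F G - br p F (N G) := by
  have h := integral_R (hcs_br p F G)
  have h' := integral_Rb (hcs_br p F G)
  have e : (W p * N F * conj G : SF n) = R (W p * F * conj G) + Rb (W p * F * conj G)
      + (2 : ℂ) • (W p.der * tt * F * conj G) - W p * F * conj (N G) := by
    simp only [R_mul, Rb_mul, R_W, Rb_W, N_apply, R_conj, Rb_conj, conj_add, two_smul]
    ring
  have e2 : (W (p.st n) * F * conj G : SF n) = (2 : ℂ) • (W p.der * tt * F * conj G)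
      - (2 * n : ℂ) • (W p * F * conj G) := by
    refine ext_val fun z => ?_
    simp [Wt.st, W_sub, W_smul, W_xm]
    ring
  have i1 : Integrable (fun z => R (W p * F * conj G) z) := integrable_R (hcs_br _ _ _)
  have i2 : Integrable (fun z => Rb (W p * F * conj G) z) := integrable_Rb (hcs_br _ _ _)
  have i3 : Integrable (fun z => (W p.der * tt * F * conj G : SF n) z) :=
    integrable_of_hcs (hcs_mul (hcs_mul (hcs_mul (hcs_W _) _) _) _)
  have i4 := integrable_of_hcs (hcs_br p F (N G))
  have i5 := integrable_of_hcs (hcs_br p F G)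
  have s1 : br p (N F) G = (-n * ∫ z, (W p * F * conj G : SF n) z)
      + (-n * ∫ z, (W p * F * conj G : SF n) z)
      + 2 * (∫ z, (W p.der * tt * F * conj G : SF n) z) - br p F (N G) := by
    rw [← h]; nth_rw 2 [h]; rw [← h', br, e]
    simp only [sub_val, add_val, smul_val]
    rw [integral_sub, integral_add, integral_add i1 i2, integral_const_mul, br]
    exacts [i1.add i2, i3.const_mul 2, (i1.add i2).add (i3.const_mul 2), i4]
  have s2 : br (p.st n) F G = 2 * (∫ z, (W p.der * tt * F * conj G : SF n) z)
      - 2 * n * ∫ z, (W p * F * conj G : SF n) z := by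
    rw [br, e2]
    simp only [sub_val, smul_val]
    rw [integral_sub (i3.const_mul _) (i5.const_mul _), integral_const_mul, integral_const_mul]
  rw [s1, s2]; ring

lemma br_D (p : Wt) (F G : SF n) : br p (D F) G = br p F (D G) := by
  have h := integral_R (hcs_br p F G)
  have h' := integral_Rb (hcs_br p F G)
  have e : (W p * D F * conj G - W p * F * conj (D G) : SF n)
      = R (W p * F * conj G) - Rb (W p * F * conj G) := by
    simp only [R_mul, Rb_mul, R_W, Rb_W, D_apply, R_conj, Rb_conj, conj_sub]
    ring
  have i1 : Integrable (fun z => R (W p * F * conj G) z) := integrable_R (hcs_br _ _ _)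
  have i2 : Integrable (fun z => Rb (W p * F * conj G) z) := integrable_Rb (hcs_br _ _ _)
  rw [← sub_eq_zero, br, br, ← integral_sub (integrable_of_hcs (hcs_br _ _ _))
    (integrable_of_hcs (hcs_br _ _ _))]
  calc _ = ∫ z, ((W p * D F * conj G - W p * F * conj (D G) : SF n)) z := rfl
    _ = _ := by
      rw [e]; simp only [sub_val]; rw [integral_sub i1 i2, h, h', sub_self]

lemma br_L (p : Wt) (j k : Fin n) (F G : SF n) : br p (L j k F) G = -br p F (Lb j k G) := by
  have h := integral_L (hcs_br p F G) j k
  have e : (W p * L j k F * conj G + W p * F * conj (Lb j k G) : SF n)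
      = L j k (W p * F * conj G) := by
    rw [conj_Lb]
    simp only [Derivation.leibniz, L_W, smul_eq_mul]
    ring
  rw [← add_eq_zero_iff_eq_neg, br, br, ← integral_add (integrable_of_hcs (hcs_br _ _ _))
    (integrable_of_hcs (hcs_br _ _ _)), ← h, ← e]
  rfl
lemma br_Lb (p : Wt) (j k : Fin n) (F G : SF n) : br p (Lb j k F) G = -br p F (L j k G) := by
  rw [← br_conj p (L j k G), br_L, map_neg, neg_neg, br_conj]

lemma br_PP (p : Wt) (F G : SF n) : br p (PP F) G = -∑ j, ∑ k, br p (Lb j k F) (Lb j k G) := by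
  simp only [PP_apply, br_sum_left, br_L, Finset.sum_neg_distrib]
lemma br_QQ (p : Wt) (F G : SF n) : br p (QQ F) G = -∑ j, ∑ k, br p (L j k F) (L j k G) := by
  simp only [QQ_apply, br_sum_left, br_Lb, Finset.sum_neg_distrib]
lemma br_Box (p : Wt) (F G : SF n) : br p (Box F) G =
    ∑ j, ∑ k, (br p (Lb j k F) (Lb j k G) + br p (L j k F) (L j k G)) := by
  have : Box F = -(PP F + QQ F) := rfl
  rw [this, br_neg_left, br_add_left, br_PP, br_QQ]
  simp only [Finset.sum_add_distrib]; ring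
lemma br_Box_symm (p : Wt) (F G : SF n) : br p (Box F) G = br p F (Box G) := by
  rw [← br_conj p (Box G), br_Box, br_Box]
  simp only [map_sum, map_add, br_conj]

end SF

namespace SF
variable {n : ℕ}

/-- The weighted energy `∫ p |F|²`. -/
noncomputable def en (p : Wt) (F : SF n) : ℝ := (br p F F).re
/-- The weighted energy `∫ p □F F̄`. -/
noncomputable def eb (p : Wt) (F : SF n) : ℝ := (br p (Box F) F).re

lemma re_br (p : Wt) (F G : SF n) :
    (br p F G).re = ∫ z : En n, p (1 - ‖z‖ ^ 2) * (F z * (starRingEnd ℂ) (G z)).re := by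
  have h := integral_re (integrable_of_hcs (hcs_br p F G))
  rw [br]
  refine h.symm.trans ?_
  congr 1; funext z
  simp [W_val]; ring

lemma integrable_re_br (p : Wt) (F G : SF n) : Integrable
    (fun z : En n => p (1 - ‖z‖ ^ 2) * (F z * (starRingEnd ℂ) (G z)).re) := by
  have h := (integrable_of_hcs (hcs_br p F G)).re
  convert h using 1
  funext z
  simp [W_val]; ring

lemma en_eq (p : Wt) (F : SF n) : en p F = ∫ z : En n, p (1 - ‖z‖ ^ 2) * ‖F z‖ ^ 2 := by
  rw [en, re_br]
  congr 1; funext z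
  rw [Complex.mul_conj, Complex.ofReal_re, Complex.normSq_eq_norm_sq]

lemma integrable_en (p : Wt) (F : SF n) :
    Integrable (fun z : En n => p (1 - ‖z‖ ^ 2) * ‖F z‖ ^ 2) := by
  have := integrable_re_br p F F
  simpa only [Complex.mul_conj, Complex.ofReal_re, Complex.normSq_eq_norm_sq] using this

lemma en_mono {p q : Wt} (h : ∀ x ≤ 1, p x ≤ q x) (F : SF n) : en p F ≤ en q F := by
  rw [en_eq, en_eq]
  refine integral_mono (integrable_en p F) (integrable_en q F) fun z => ?_
  exact mul_le_mul_of_nonneg_right (h _ (by nlinarith [norm_nonneg z])) (by positivity)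

lemma en_nonneg {p : Wt} (h : ∀ x ≤ 1, 0 ≤ p x) (F : SF n) : 0 ≤ en p F := by
  rw [en_eq]
  exact integral_nonneg fun z => mul_nonneg (h _ (by nlinarith [norm_nonneg z])) (by positivity)

lemma en_add_wt (p q : Wt) (F : SF n) : en (p + q) F = en p F + en q F := by
  simp [en, br_add_wt]
lemma en_smul_wt (c : ℝ) (p : Wt) (F : SF n) : en (c • p) F = c * en p F := by
  simp [en, br_smul_wt]
lemma eb_smul_wt (c : ℝ) (p : Wt) (F : SF n) : eb (c • p) F = c * eb p F := by
  simp [eb, br_smul_wt]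

lemma eb_eq (p : Wt) (F : SF n) : eb p F = ∑ j, ∑ k, (en p (Lb j k F) + en p (L j k F)) := by
  simp only [eb, br_Box, Complex.re_sum, Complex.add_re, en]

lemma eb_mono {p q : Wt} (h : ∀ x ≤ 1, p x ≤ q x) (F : SF n) : eb p F ≤ eb q F := by
  rw [eb_eq, eb_eq]
  exact Finset.sum_le_sum fun j _ => Finset.sum_le_sum fun k _ =>
    add_le_add (en_mono h _) (en_mono h _)
lemma eb_nonneg {p : Wt} (h : ∀ x ≤ 1, 0 ≤ p x) (F : SF n) : 0 ≤ eb p F := by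
  rw [eb_eq]
  exact Finset.sum_nonneg fun j _ => Finset.sum_nonneg fun k _ =>
    add_nonneg (en_nonneg h _) (en_nonneg h _)

/-- A weighted Cauchy–Schwarz inequality. -/
lemma two_re_br_le {p q₁ q₂ : Wt} (h₁ : ∀ x ≤ 1, 0 ≤ q₁ x) (h₂ : ∀ x ≤ 1, 0 ≤ q₂ x)
    (h : ∀ x ≤ 1, p x ^ 2 ≤ q₁ x * q₂ x) (F G : SF n) :
    |2 * (br p F G).re| ≤ en q₁ F + en q₂ G := by
  rw [re_br, en_eq, en_eq, ← integral_const_mul, ← integral_add (integrable_en _ _) (integrable_en _ _)]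
  refine (abs_integral_le_integral_abs).trans ?_
  refine integral_mono ((integrable_re_br p F G).const_mul 2).abs
    ((integrable_en _ _).add (integrable_en _ _)) fun z => ?_
  have hx : 1 - ‖z‖ ^ 2 ≤ 1 := by nlinarith [norm_nonneg z]
  generalize 1 - ‖z‖ ^ 2 = x at *
  have hre : |(F z * (starRingEnd ℂ) (G z)).re| ≤ ‖F z‖ * ‖G z‖ := by
    refine (Complex.abs_re_le_norm _).trans ?_
    simp
  have a1 := h₁ x hx
  have a2 := h₂ x hx
  have a3 := h x hx
  have hp : |p x| ≤ Real.sqrt (q₁ x) * Real.sqrt (q₂ x) := by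
    rw [← Real.sqrt_mul a1]
    exact Real.abs_le_sqrt a3
  simp only [abs_mul, abs_two]
  calc 2 * (|p x| * |(F z * (starRingEnd ℂ) (G z)).re|)
      ≤ 2 * ((Real.sqrt (q₁ x) * Real.sqrt (q₂ x)) * (‖F z‖ * ‖G z‖)) := by gcongr
    _ ≤ (Real.sqrt (q₁ x) * ‖F z‖) ^ 2 + (Real.sqrt (q₂ x) * ‖G z‖) ^ 2 := by
        nlinarith [sq_nonneg (Real.sqrt (q₁ x) * ‖F z‖ - Real.sqrt (q₂ x) * ‖G z‖)]
    _ = _ := by rw [mul_pow, mul_pow, Real.sq_sqrt a1, Real.sq_sqrt a2]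

lemma abs_re_br_D_le {p : Wt} (h : ∀ x ≤ 1, 0 ≤ p x) (F : SF n) :
    |2 * ((n : ℝ) - 1) * (br p (D F) F).re| ≤ eb p F := by
  have e : 2 * ((n : ℝ) - 1) * (br p (D F) F).re =
      ∑ j, ∑ k, en p (L j k F) - ∑ j, ∑ k, en p (Lb j k F) := by
    have h0 : QQ F - PP F = -((2 * ((n : ℝ) - 1) : ℝ) : ℂ) • D F := by
      rw [Box_sub, D_apply]
      refine ext_val fun z => ?_
      simp
      exact Or.inl (Or.inl rfl)
    have h1 := congrArg (fun G => (br p G F).re) h0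
    simp only [br_sub_left, br_PP, br_QQ, br_smul_left, Complex.sub_re, Complex.neg_re,
      Complex.re_sum, Complex.re_ofReal_mul, ← Complex.ofReal_neg] at h1
    simp only [en]
    linarith
  have n1 : 0 ≤ ∑ j, ∑ k, en p (L j k F) :=
    Finset.sum_nonneg fun j _ => Finset.sum_nonneg fun k _ => en_nonneg h _
  have n2 : 0 ≤ ∑ j, ∑ k, en p (Lb j k F) :=
    Finset.sum_nonneg fun j _ => Finset.sum_nonneg fun k _ => en_nonneg h _
  rw [e, eb_eq]
  simp only [Finset.sum_add_distrib]
  rw [abs_le]; constructor <;> linarith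

/-- The weight `(xp)* + 2(n-1)p`. -/
noncomputable def _root_.Wt.qw (n : ℕ) (p : Wt) : Wt := p.xm.st n + (2 * ((n : ℝ) - 1)) • p

lemma br_MH {p : Wt} {F : SF n} (hM : W p * MM F = 0) (G : SF n) :
    br p (Box F) G = br p.xm (N (N F)) G - br p.xm (D (D F)) G
      + (2 * ((n : ℝ) - 1) : ℝ) * br p (N F) G := by
  rw [← br_sub_left, ← br_xm, ← br_smul_left, ← br_add_left]
  refine br_congr p G ?_
  have h1 : W p * Lap F = W p * R (Rb F) := by
    rw [MM_apply, mul_sub, sub_eq_zero] at hM; exact hM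
  have h2 : (((2 * ((n : ℝ) - 1) : ℝ) : ℂ) • N F : SF n) = 2 * ((n : SF n) - 1) * N F := by
    refine ext_val fun z => ?_
    simp
    exact Or.inl (Or.inl rfl)
  rw [h2, Box_eq]
  simp only [N_apply, D_apply, map_add, map_sub]
  rw [← R_Rb]
  linear_combination (-4 * tt) * h1

/-- The weighted energy of a derivative along `N`. -/
lemma en_st (p : Wt) (F : SF n) : en (p.st n) F = 2 * (br p (N F) F).re := by
  have h := congrArg Complex.re (br_N p F F)
  rw [Complex.sub_re, ← br_conj p (N F) F, Complex.conj_re] at h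
  rw [en]; linarith
lemma eb_st (p : Wt) (F : SF n) : eb (p.st n) F = 2 * (br p (Box F) (N F)).re := by
  have h := congrArg Complex.re (br_N p (Box F) F)
  rw [N_Box, br_Box_symm p (N F) F, Complex.sub_re, ← br_conj p (N F) (Box F), Complex.conj_re] at h
  rw [eb, ← br_conj p (N F) (Box F), Complex.conj_re]
  linarith

lemma energy_en {p : Wt} {F : SF n} (hM : W p * MM F = 0) :
    eb p F + en p.xm (N F) + en p.xm (D F) = 1 / 2 * en ((p.qw n).st n) F := by
  have h := congrArg Complex.re (br_MH hM F)
  rw [br_N, br_D] at h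
  rw [en_st, Wt.qw, br_add_wt, br_smul_wt]
  simp only [Complex.add_re, Complex.sub_re, Complex.re_ofReal_mul] at h ⊢
  simp only [eb, en]
  linarith

lemma energy_eb {p : Wt} {F : SF n} (hM : W p * MM F = 0) :
    en p (Box F) + eb p.xm (N F) + eb p.xm (D F) = 1 / 2 * eb ((p.qw n).st n) F := by
  have h := congrArg Complex.re (br_MH hM (Box F))
  rw [br_N, br_D, N_Box, D_Box, ← br_Box_symm p.xm (N F), ← br_Box_symm p.xm (D F)] at h
  have h2 : eb ((p.qw n).st n) F = 2 * (br (p.qw n) (N F) (Box F)).re := by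
    rw [eb_st, ← br_conj, Complex.conj_re]
  rw [h2, Wt.qw, br_add_wt, br_smul_wt]
  simp only [Complex.add_re, Complex.sub_re, Complex.re_ofReal_mul] at h ⊢
  simp only [eb, en]
  linarith

lemma energy_N {p : Wt} {F : SF n} (hM : W p * MM F = 0) :
    eb (p.st n) F = en (p.xm.st n) (N F) + 4 * ((n : ℝ) - 1) * en p (N F) - en (p.xm.st n) (D F) := by
  have h := congrArg Complex.re (br_MH hM (N F))
  rw [br_D, ← N_D, ← br_conj p.xm (N (D F)), Complex.add_re, Complex.sub_re, Complex.conj_re,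
    Complex.re_ofReal_mul] at h
  rw [eb_st, en_st, en_st, h, en]; ring

end SF

namespace SF
variable {n : ℕ}

lemma clm_eq_sum (A : En n →L[ℝ] ℂ) (v : En n) : A v = ∑ j,
    (v j * ((1/2 : ℂ) * (A (EuclideanSpace.single j 1) - Complex.I * A (EuclideanSpace.single j Complex.I)))
    + (starRingEnd ℂ) (v j) *
      ((1/2 : ℂ) * (A (EuclideanSpace.single j 1) + Complex.I * A (EuclideanSpace.single j Complex.I)))) := by
  have hv : v = ∑ j, ((v j).re • EuclideanSpace.single j (1 : ℂ)
      + (v j).im • EuclideanSpace.single j Complex.I) := by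
    ext i
    simp [Finset.sum_add_distrib, Pi.single_apply]
  conv_lhs => rw [hv]
  rw [map_sum]
  refine Finset.sum_congr rfl fun j _ => ?_
  rw [map_add, map_smul, map_smul]
  have h1 : v j = (v j).re + (v j).im * Complex.I := (Complex.re_add_im _).symm
  have h2 : (starRingEnd ℂ) (v j) = (v j).re - (v j).im * Complex.I := by
    apply Complex.ext <;> simp
  rw [h2]
  nth_rw 3 [h1]
  simp only [Complex.real_smul]
  linear_combination (((v j).im : ℂ) * A (EuclideanSpace.single j Complex.I)) * Complex.I_mul_I

lemma fderiv_eq_sum (F : SF n) (z v : En n) : fderiv ℝ F z v =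
    ∑ j, (v j * dz j F z + (starRingEnd ℂ) (v j) * dzb j F z) := clm_eq_sum _ v

/-- The Fourier coefficient of `F` along the circle action. -/
noncomputable def avg (m : ℤ) (F : SF n) (z : En n) : ℂ :=
  ∫ θ in (0 : ℝ)..(2 * Real.pi), Complex.exp (-(m * θ * Complex.I)) * F (Complex.exp (θ * Complex.I) • z)

lemma continuous_rot (F : SF n) :
    Continuous (fun q : En n × ℝ => F (Complex.exp (q.2 * Complex.I) • q.1)) :=
  F.continuous.comp (by fun_prop)

lemma rot_integrable (m : ℤ) (F : SF n) (z : En n) : IntervalIntegrable (fun θ : ℝ =>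
    Complex.exp (-(m * θ * Complex.I)) * F (Complex.exp (θ * Complex.I) • z)) volume 0 (2 * Real.pi) := by
  refine Continuous.intervalIntegrable ?_ _ _
  have := (continuous_rot F).comp (f := fun θ : ℝ => (z, θ)) (by fun_prop)
  exact Continuous.mul (by fun_prop) this

/-- `ℂ`-linear multiplication by a scalar, as a real continuous linear map. -/
noncomputable def rotL (e : ℂ) : En n →L[ℝ] En n := e • ContinuousLinearMap.id ℝ (En n)

lemma hasFDerivAt_rot (F : SF n) (e : ℂ) (z : En n) :
    HasFDerivAt (fun z => F (e • z)) ((fderiv ℝ F (e • z)).comp (rotL e)) z :=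
  ((F.differentiableAt _).hasFDerivAt).comp z (rotL e : En n →L[ℝ] En n).hasFDerivAt

lemma hasFDerivAt_avg (m : ℤ) (F : SF n) (z₀ : En n) : HasFDerivAt (avg m F)
    (∫ θ in (0 : ℝ)..(2 * Real.pi), Complex.exp (-(m * θ * Complex.I)) •
      (fderiv ℝ F (Complex.exp (θ * Complex.I) • z₀)).comp (rotL (Complex.exp (θ * Complex.I)))) z₀ ∧
    IntervalIntegrable (fun θ : ℝ => Complex.exp (-(m * θ * Complex.I)) •
      (fderiv ℝ F (Complex.exp (θ * Complex.I) • z₀)).comp (rotL (Complex.exp (θ * Complex.I))))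
      volume 0 (2 * Real.pi) := by
  have hcd : Continuous (fderiv ℝ (F : En n → ℂ)) := F.contDiff.continuous_fderiv (by simp)
  have hc : Continuous (fun q : En n × ℝ => Complex.exp (-(m * q.2 * Complex.I)) •
      (fderiv ℝ F (Complex.exp (q.2 * Complex.I) • q.1)).comp (rotL (Complex.exp (q.2 * Complex.I)))) := by
    have h1 : Continuous (fun q : En n × ℝ => fderiv ℝ F (Complex.exp (q.2 * Complex.I) • q.1)) :=
      hcd.comp (g := fderiv ℝ (F : En n → ℂ)) (f := fun q : En n × ℝ => Complex.exp (q.2 * Complex.I) • q.1)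
        (by fun_prop)
    have h2 : Continuous (fun q : En n × ℝ => (rotL (Complex.exp (q.2 * Complex.I)) : En n →L[ℝ] En n)) := by
      exact Continuous.smul (f := fun q : En n × ℝ => Complex.exp (q.2 * Complex.I)) (by fun_prop) continuous_const
    have h3 : Continuous (fun q : En n × ℝ => Complex.exp (-(m * q.2 * Complex.I))) := by fun_prop
    exact h3.smul (h1.clm_comp h2)
  have hc0 := hc.comp (f := fun θ : ℝ => (z₀, θ)) (by fun_prop)
  obtain ⟨C, hC⟩ := ((isCompact_closedBall z₀ 1).prod (isCompact_uIcc (a := (0 : ℝ)) (b := 2 * Real.pi))).exists_bound_of_continuousOn hc.continuousOn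
  refine ⟨?_, hc0.intervalIntegrable _ _⟩
  refine (intervalIntegral.hasFDerivAt_integral_of_dominated_of_fderiv_le
    (F := fun z θ => Complex.exp (-(m * θ * Complex.I)) * F (Complex.exp (θ * Complex.I) • z))
    (F' := fun z θ => Complex.exp (-(m * θ * Complex.I)) •
      (fderiv ℝ F (Complex.exp (θ * Complex.I) • z)).comp (rotL (Complex.exp (θ * Complex.I))))
    (bound := fun _ => C)
    (Metric.closedBall_mem_nhds z₀ one_pos) ?_ (rot_integrable m F z₀)
    hc0.aestronglyMeasurable ?_ (by simp) ?_)
  · refine Filter.Eventually.of_forall fun z => ?_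
    have := (continuous_rot F).comp (f := fun θ : ℝ => (z, θ)) (by fun_prop)
    exact (Continuous.mul (by fun_prop) this).aestronglyMeasurable
  · refine Filter.Eventually.of_forall fun θ hθ z hz => hC (z, θ) ⟨hz, Set.uIoc_subset_uIcc hθ⟩
  · refine Filter.Eventually.of_forall fun θ hθ z hz => ?_
    exact (hasFDerivAt_rot F _ z).const_mul _

lemma conj_exp (θ : ℝ) : (starRingEnd ℂ) (Complex.exp (θ * Complex.I)) = Complex.exp (-(θ * Complex.I)) := by
  rw [← Complex.exp_conj]; simp

lemma fderiv_avg (m : ℤ) (F : SF n) (z v : En n) : fderiv ℝ (avg m F) z v =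
    ∑ j, (v j * avg (m - 1) (dz j F) z + (starRingEnd ℂ) (v j) * avg (m + 1) (dzb j F) z) := by
  obtain ⟨h1, h2⟩ := hasFDerivAt_avg m F z
  rw [h1.fderiv, ContinuousLinearMap.intervalIntegral_apply h2]
  simp only [avg]
  simp_rw [← intervalIntegral.integral_const_mul]
  have hi : ∀ j ∈ Finset.univ, IntervalIntegrable (fun θ : ℝ =>
      v j * (Complex.exp (-(((m - 1 : ℤ) : ℂ) * θ * Complex.I)) * dz j F (Complex.exp (θ * Complex.I) • z))
      + (starRingEnd ℂ) (v j) * (Complex.exp (-(((m + 1 : ℤ) : ℂ) * θ * Complex.I)) *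
        dzb j F (Complex.exp (θ * Complex.I) • z))) volume 0 (2 * Real.pi) := fun j _ =>
    ((rot_integrable _ (dz j F) z).const_mul _).add ((rot_integrable _ (dzb j F) z).const_mul _)
  rw [show (∑ j, ((∫ θ in (0 : ℝ)..(2 * Real.pi), v j * (Complex.exp (-(((m - 1 : ℤ) : ℂ) * θ * Complex.I)) * dz j F (Complex.exp (θ * Complex.I) • z)))
      + ∫ θ in (0 : ℝ)..(2 * Real.pi), (starRingEnd ℂ) (v j) * (Complex.exp (-(((m + 1 : ℤ) : ℂ) * θ * Complex.I)) *
        dzb j F (Complex.exp (θ * Complex.I) • z)))) = ∑ j, ∫ θ in (0 : ℝ)..(2 * Real.pi), (v j * (Complex.exp (-(((m - 1 : ℤ) : ℂ) * θ * Complex.I)) * dz j F (Complex.exp (θ * Complex.I) • z))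
      + (starRingEnd ℂ) (v j) * (Complex.exp (-(((m + 1 : ℤ) : ℂ) * θ * Complex.I)) *
        dzb j F (Complex.exp (θ * Complex.I) • z))) from Finset.sum_congr rfl fun j _ =>
      (intervalIntegral.integral_add ((rot_integrable _ (dz j F) z).const_mul _) ((rot_integrable _ (dzb j F) z).const_mul _)).symm,
    ← intervalIntegral.integral_finsetSum hi]
  refine intervalIntegral.integral_congr fun θ _ => ?_
  simp only [smul_apply, ContinuousLinearMap.comp_apply, smul_eq_mul]
  rw [fderiv_eq_sum, Finset.mul_sum]
  refine Finset.sum_congr rfl fun j _ => ?_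
  have e1 : (rotL (Complex.exp (θ * Complex.I)) v : En n) j = Complex.exp (θ * Complex.I) * v j := rfl
  rw [e1, map_mul, conj_exp]
  have e2 : Complex.exp (-(((m - 1 : ℤ) : ℂ) * θ * Complex.I)) =
      Complex.exp (-(m * θ * Complex.I)) * Complex.exp (θ * Complex.I) := by
    rw [← Complex.exp_add]; congr 1; push_cast; ring
  have e3 : Complex.exp (-(((m + 1 : ℤ) : ℂ) * θ * Complex.I)) =
      Complex.exp (-(m * θ * Complex.I)) * Complex.exp (-(θ * Complex.I)) := by
    rw [← Complex.exp_add]; congr 1; push_cast; ring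
  rw [e2, e3]
  ring

lemma contDiff_avg (k : ℕ) : ∀ (m : ℤ) (F : SF n), ContDiff ℝ k (avg m F) := by
  induction k with
  | zero =>
    intro m F
    exact contDiff_zero.2 (Differentiable.continuous (𝕜 := ℝ) fun z => (hasFDerivAt_avg m F z).1.differentiableAt)
  | succ k ih =>
    intro m F
    have : ((k + 1 : ℕ) : WithTop ℕ∞) = (k : WithTop ℕ∞) + 1 := by push_cast; rfl
    rw [this, contDiff_succ_iff_fderiv]
    refine ⟨fun z => (hasFDerivAt_avg m F z).1.differentiableAt, by simp, ?_⟩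
    rw [contDiff_clm_apply_iff]
    intro v
    simp only [fderiv_avg]
    exact ContDiff.sum fun j _ => (contDiff_const.mul (ih _ _)).add (contDiff_const.mul (ih _ _))

/-- The Fourier coefficient of `F` along the circle action as a smooth function. -/
noncomputable def av (m : ℤ) (F : SF n) : SF n :=
  ⟨avg m F, contDiff_infty.2 fun k => contDiff_avg k m F⟩

lemma av_val (m : ℤ) (F : SF n) (z : En n) : av m F z = avg m F z := rfl

lemma dz_av (m : ℤ) (F : SF n) (j : Fin n) : dz j (av m F) = av (m - 1) (dz j F) := by
  refine ext_val fun z => ?_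
  rw [dz_val, wd]
  have h : ∀ v, fderiv ℝ (av m F) z v = _ := fderiv_avg m F z
  rw [h, h]
  simp [Finset.sum_add_distrib, apply_ite (starRingEnd ℂ)]
  rw [av_val]
  linear_combination (1 / 2 * (avg (m + 1) (dzb j F) z - avg (m - 1) (dz j F) z)) * Complex.I_mul_I

lemma dzb_av (m : ℤ) (F : SF n) (j : Fin n) : dzb j (av m F) = av (m + 1) (dzb j F) := by
  refine ext_val fun z => ?_
  rw [dzb_val, wdb]
  have h : ∀ v, fderiv ℝ (av m F) z v = _ := fderiv_avg m F z
  rw [h, h]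
  simp [Finset.sum_add_distrib, apply_ite (starRingEnd ℂ)]
  rw [av_val]
  linear_combination (1 / 2 * (avg (m - 1) (dz j F) z - avg (m + 1) (dzb j F) z)) * Complex.I_mul_I

lemma av_add (m : ℤ) (F G : SF n) : av m (F + G) = av m F + av m G := by
  refine ext_val fun z => ?_
  simp only [av_val, add_val, avg, mul_add]
  exact intervalIntegral.integral_add (rot_integrable m F z) (rot_integrable m G z)
lemma av_neg (m : ℤ) (F : SF n) : av m (-F) = -av m F := by
  refine ext_val fun z => ?_
  simp [av_val, avg]
lemma av_sub (m : ℤ) (F G : SF n) : av m (F - G) = av m F - av m G := by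
  rw [sub_eq_add_neg, av_add, av_neg, ← sub_eq_add_neg]
lemma av_zero (m : ℤ) : av m (0 : SF n) = 0 := by
  refine ext_val fun z => ?_
  simp [av_val, avg]
lemma av_sum {ι : Type*} (s : Finset ι) (m : ℤ) (F : ι → SF n) :
    av m (∑ i ∈ s, F i) = ∑ i ∈ s, av m (F i) := by
  classical
  induction s using Finset.induction_on with
  | empty => simp [av_zero]
  | insert a s ha ih => rw [Finset.sum_insert ha, Finset.sum_insert ha, av_add, ih]

lemma X_mul_av (m : ℤ) (F : SF n) (j : Fin n) : X j * av m F = av (m + 1) (X j * F) := by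
  refine ext_val fun z => ?_
  simp only [mul_val, av_val, avg, ← intervalIntegral.integral_const_mul]
  refine intervalIntegral.integral_congr fun θ _ => ?_
  have e3 : Complex.exp (-(((m + 1 : ℤ) : ℂ) * θ * Complex.I)) * Complex.exp (θ * Complex.I) =
      Complex.exp (-(m * θ * Complex.I)) := by
    rw [← Complex.exp_add]; congr 1; push_cast; ring
  have e : X j (Complex.exp (θ * Complex.I) • z) = Complex.exp (θ * Complex.I) * X j z := rfl
  simp only [e, ← e3]; ring
lemma Xb_mul_av (m : ℤ) (F : SF n) (j : Fin n) : Xb j * av m F = av (m - 1) (Xb j * F) := by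
  refine ext_val fun z => ?_
  simp only [mul_val, av_val, avg, ← intervalIntegral.integral_const_mul]
  refine intervalIntegral.integral_congr fun θ _ => ?_
  have e3 : Complex.exp (-(((m - 1 : ℤ) : ℂ) * θ * Complex.I)) * Complex.exp (-(θ * Complex.I)) =
      Complex.exp (-(m * θ * Complex.I)) := by
    rw [← Complex.exp_add]; congr 1; push_cast; ring
  have e : Xb j (Complex.exp (θ * Complex.I) • z) = Complex.exp (-(θ * Complex.I)) * Xb j z := by
    rw [← conj_exp, Xb, conj_val, conj_val, ← map_mul]; rfl
  simp only [e, ← e3]; ring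

lemma L_av (m : ℤ) (F : SF n) (j k : Fin n) : L j k (av m F) = av (m - 2) (L j k F) := by
  rw [L_apply, L_apply, dz_av, dz_av, Xb_mul_av, Xb_mul_av, av_sub]
  congr 2 <;> ring
lemma Lb_av (m : ℤ) (F : SF n) (j k : Fin n) : Lb j k (av m F) = av (m + 2) (Lb j k F) := by
  rw [Lb_apply, Lb_apply, dzb_av, dzb_av, X_mul_av, X_mul_av, av_sub]
  congr 2 <;> ring
lemma Box_av (m : ℤ) (F : SF n) : Box (av m F) = av m (Box F) := by
  have h : ∀ F : SF n, Box F = -(PP F + QQ F) := fun _ => rfl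
  rw [h, h, PP_apply, QQ_apply, PP_apply, QQ_apply]
  simp only [Lb_av, L_av, av_neg, av_add, av_sum, add_sub_cancel_right, sub_add_cancel]
lemma D_av (m : ℤ) (F : SF n) : D (av m F) = av m (D F) := by
  simp only [D_apply, R_apply, Rb_apply, dz_av, dzb_av, X_mul_av, Xb_mul_av, av_sub, av_sum,
    sub_add_cancel, add_sub_cancel_right]

end SF

namespace SF
variable {n : ℕ}

lemma hasDerivAt_rot (F : SF n) (z : En n) (θ : ℝ) :
    HasDerivAt (fun θ : ℝ => F (Complex.exp (θ * Complex.I) • z))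
      (Complex.I * D F (Complex.exp (θ * Complex.I) • z)) θ := by
  have h1 : HasDerivAt (fun θ : ℝ => Complex.exp (θ * Complex.I)) (Complex.exp (θ * Complex.I) * Complex.I) θ := by
    have := ((Complex.ofRealCLM.hasDerivAt (x := θ)).mul_const Complex.I).cexp
    simpa using this
  have h2 : HasDerivAt (fun θ : ℝ => Complex.exp (θ * Complex.I) • z)
      ((Complex.exp (θ * Complex.I) * Complex.I) • z) θ := h1.smul_const z
  have h3 := (F.differentiableAt (Complex.exp (θ * Complex.I) • z)).hasFDerivAt.comp_hasDerivAt θ h2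
  refine HasDerivAt.congr_deriv h3 ?_
  rw [fderiv_eq_sum, D_apply, sub_val, R_apply, Rb_apply, sum_val, sum_val, mul_sub, Finset.mul_sum,
    Finset.mul_sum, ← Finset.sum_sub_distrib]
  refine Finset.sum_congr rfl fun j _ => ?_
  have e1 : ((Complex.exp (θ * Complex.I) * Complex.I) • z) j = Complex.I * (Complex.exp (θ * Complex.I) • z) j := by
    simp only [PiLp.smul_apply, smul_eq_mul]; ring
  rw [e1, map_mul, Complex.conj_I, mul_val, mul_val]
  simp only [X_val, Xb, conj_val]
  ring

lemma avg_D (m : ℤ) (F : SF n) (z : En n) : avg m (D F) z = m * avg m F z := by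
  have hd : ∀ θ : ℝ, HasDerivAt (fun θ : ℝ => Complex.exp (-(m * θ * Complex.I)) * F (Complex.exp (θ * Complex.I) • z))
      (Complex.I * (Complex.exp (-(m * θ * Complex.I)) * D F (Complex.exp (θ * Complex.I) • z))
        - (m * Complex.I) * (Complex.exp (-(m * θ * Complex.I)) * F (Complex.exp (θ * Complex.I) • z))) θ := by
    intro θ
    have h1 : HasDerivAt (fun θ : ℝ => Complex.exp (-(m * θ * Complex.I)))
        (Complex.exp (-(m * θ * Complex.I)) * -(m * 1 * Complex.I)) θ := by
      have := ((((Complex.ofRealCLM.hasDerivAt (x := θ)).const_mul (m : ℂ)).mul_const Complex.I).neg).cexp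
      simpa using this
    refine HasDerivAt.congr_deriv (h1.mul (hasDerivAt_rot F z θ)) ?_
    ring
  have hi := ((rot_integrable m (D F) z).const_mul Complex.I).sub ((rot_integrable m F z).const_mul (m * Complex.I))
  have h := intervalIntegral.integral_eq_sub_of_hasDerivAt (fun θ _ => hd θ) hi
  rw [intervalIntegral.integral_sub ((rot_integrable m (D F) z).const_mul Complex.I) ((rot_integrable m F z).const_mul (m * Complex.I)),
    intervalIntegral.integral_const_mul, intervalIntegral.integral_const_mul] at h
  have e1 : Complex.exp (((2 * Real.pi : ℝ) : ℂ) * Complex.I) = 1 := by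
    push_cast; exact Complex.exp_two_pi_mul_I
  have e2 : Complex.exp (-((m : ℂ) * ((2 * Real.pi : ℝ) : ℂ) * Complex.I)) = 1 := by
    rw [Complex.exp_eq_one_iff]
    exact ⟨-m, by push_cast; ring⟩
  rw [e1, e2] at h
  simp only [Complex.ofReal_zero, mul_zero, zero_mul, neg_zero, Complex.exp_zero, sub_self] at h
  have h' : Complex.I * (avg m (D F) z - m * avg m F z) = 0 := by
    rw [← h]; simp only [avg]; ring
  exact sub_eq_zero.1 ((mul_eq_zero.1 h').resolve_left Complex.I_ne_zero)

lemma D_av_eq (m : ℤ) (F : SF n) : D (av m F) = (m : ℂ) • av m F := by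
  rw [D_av]
  exact ext_val fun z => avg_D m F z

lemma en_av_le {p : Wt} (hp : ∀ x ≤ 1, 0 ≤ p x) (m : ℤ) (F : SF n) :
    (2 * ((n : ℝ) - 1)) ^ 2 * en p (av m (D F)) ≤ en p (av m (Box F)) := by
  have e0 : av m (D F) = (m : ℂ) • av m F := by rw [← D_av, D_av_eq]
  have e1 : en p (av m (D F)) = (m : ℝ) ^ 2 * en p (av m F) := by
    rw [e0, en_eq, en_eq, ← integral_const_mul]
    congr 1; funext z
    rw [smul_val, norm_mul, Complex.norm_intCast, mul_pow, sq_abs]; ring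
  set a : ℝ := |2 * ((n : ℝ) - 1) * m| with ha
  have h1 : a * en p (av m F) ≤ eb p (av m F) := by
    have h := abs_re_br_D_le hp (av m F)
    rw [D_av_eq, br_smul_left, show ((m : ℂ) * br p (av m F) (av m F)).re = m * en p (av m F) by
      rw [en, ← Complex.re_ofReal_mul]; simp, ← mul_assoc, abs_mul, abs_of_nonneg (en_nonneg hp _)] at h
    exact h
  have key : a ^ 2 * en p (av m F) ≤ en p (av m (Box F)) := by
    rcases (abs_nonneg (2 * ((n : ℝ) - 1) * m)).eq_or_lt with h0 | h0
    · rw [← ha] at h0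
      rw [← h0]; simpa using en_nonneg hp _
    · rw [← ha] at h0
      have h2 := two_re_br_le (p := p) (q₁ := a⁻¹ • p) (q₂ := a • p)
        (fun x hx => by rw [Wt.smul_val]; exact mul_nonneg (by positivity) (hp x hx))
        (fun x hx => by rw [Wt.smul_val]; exact mul_nonneg (by positivity) (hp x hx))
        (fun x hx => by rw [Wt.smul_val, Wt.smul_val]; apply le_of_eq; field_simp) (Box (av m F)) (av m F)
      rw [en_smul_wt, en_smul_wt] at h2
      have h3 : 2 * eb p (av m F) ≤ a⁻¹ * en p (Box (av m F)) + a * en p (av m F) :=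
        (le_abs_self _).trans h2
      rw [Box_av] at h3
      have h4 : a * en p (av m F) ≤ a⁻¹ * en p (av m (Box F)) := by linarith
      have h5 := mul_le_mul_of_nonneg_left h4 h0.le
      rw [← mul_assoc, ← mul_assoc, mul_inv_cancel₀ h0.ne', one_mul] at h5
      rw [pow_two]; exact h5
  rw [e1, ← mul_assoc, ← mul_pow]
  rwa [ha, sq_abs] at key

lemma map_rot (e : ℂ) (he : ‖e‖ = 1) : Measure.map (fun z : En n => e • z) volume = volume := by
  have he0 : e ≠ 0 := by rintro rfl; simp at he
  have hdet : LinearMap.det ((rotL e : En n →L[ℝ] En n) : En n →ₗ[ℝ] En n) ≠ 0 := by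
    have : ((rotL e : En n →L[ℝ] En n) : En n →ₗ[ℝ] En n) ∘ₗ ((rotL e⁻¹ : En n →L[ℝ] En n) : En n →ₗ[ℝ] En n) = LinearMap.id := by
      ext1 v
      exact smul_inv_smul₀ he0 v
    intro h0
    have h1 := congrArg LinearMap.det this
    rw [LinearMap.det_comp, h0, zero_mul, LinearMap.det_id] at h1
    exact zero_ne_one h1
  have h := Measure.map_linearMap_addHaar_eq_smul_addHaar (volume : Measure (En n)) hdet
  have h' : Measure.map (fun z : En n => e • z) volume = ENNReal.ofReal |(LinearMap.det ((rotL e : En n →L[ℝ] En n) : En n →ₗ[ℝ] En n))⁻¹| • volume := h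
  have hb := congrArg (fun μ : Measure (En n) => μ (Metric.ball 0 1)) h'
  simp only [Measure.smul_apply, smul_eq_mul] at hb
  rw [Measure.map_apply (by fun_prop) Metric.isOpen_ball.measurableSet] at hb
  have hpre : (fun z : En n => e • z) ⁻¹' Metric.ball 0 1 = Metric.ball 0 1 := by
    ext z; simp [norm_smul, he]
  rw [hpre] at hb
  have hpos : volume (Metric.ball (0 : En n) 1) ≠ 0 := (Metric.measure_ball_pos _ _ one_pos).ne'
  have hfin : volume (Metric.ball (0 : En n) 1) ≠ ⊤ := measure_ball_lt_top.ne
  have : ENNReal.ofReal |(LinearMap.det ((rotL e : En n →L[ℝ] En n) : En n →ₗ[ℝ] En n))⁻¹| = 1 :=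
    (ENNReal.eq_div_iff hpos hfin).2 (by rw [mul_comm]; exact hb.symm) |>.trans (ENNReal.div_self hpos hfin)
  rw [h', this, one_smul]

lemma ofReal_en {p : Wt} (hp : ∀ x ≤ 1, 0 ≤ p x) (F : SF n) :
    ENNReal.ofReal (en p F) = ∫⁻ z : En n, ENNReal.ofReal (p (1 - ‖z‖ ^ 2)) * ENNReal.ofReal (‖F z‖ ^ 2) := by
  rw [en_eq, ofReal_integral_eq_lintegral_ofReal (integrable_en p F)
    (Filter.Eventually.of_forall fun z => mul_nonneg (hp _ (by nlinarith [norm_nonneg z])) (by positivity))]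
  refine lintegral_congr fun z => ?_
  rw [ENNReal.ofReal_mul (hp _ (by nlinarith [norm_nonneg z]))]

lemma parseval_pt (F : SF n) (z : En n) : ∑' m : ℤ, ENNReal.ofReal (‖avg m F z‖ ^ 2) =
    ENNReal.ofReal (2 * Real.pi) * ∫⁻ θ in Set.Ioc 0 (2 * Real.pi),
      ENNReal.ofReal (‖F (Complex.exp ((θ : ℝ) * Complex.I) • z)‖ ^ 2) := by
  have hab : (0 : ℝ) < 2 * Real.pi := Real.two_pi_pos
  have hc : Continuous fun θ : ℝ => F (Complex.exp (θ * Complex.I) • z) :=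
    (continuous_rot F).comp (f := fun θ : ℝ => (z, θ)) (by fun_prop)
  have hL2 : MemLp (fun θ : ℝ => F (Complex.exp (θ * Complex.I) • z)) 2
      (volume.restrict (Set.Ioc 0 (2 * Real.pi))) := by
    obtain ⟨C, hC⟩ := (isCompact_Icc (a := (0 : ℝ)) (b := 2 * Real.pi)).exists_bound_of_continuousOn hc.continuousOn
    refine MemLp.of_bound hc.aestronglyMeasurable C ?_
    rw [ae_restrict_iff' measurableSet_Ioc]
    exact Filter.Eventually.of_forall fun θ hθ => hC θ (Set.Ioc_subset_Icc_self hθ)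
  have h := hasSum_sq_fourierCoeffOn hab hL2
  have hco : ∀ m : ℤ, ‖fourierCoeffOn hab (fun θ : ℝ => F (Complex.exp (θ * Complex.I) • z)) m‖ ^ 2
      = (2 * Real.pi)⁻¹ ^ 2 * ‖avg m F z‖ ^ 2 := by
    intro m
    rw [fourierCoeffOn_eq_integral, norm_smul, mul_pow]
    congr 1
    · simp [abs_of_pos Real.pi_pos]
    · congr 2
      rw [avg]
      refine intervalIntegral.integral_congr fun θ _ => ?_
      simp only [fourier_coe_apply, smul_eq_mul, sub_zero]
      congr 2
      have : (Real.pi : ℂ) ≠ 0 := by exact_mod_cast Real.pi_ne_zero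
      push_cast
      field_simp
  simp_rw [hco] at h
  have h2 := h.mul_left ((2 * Real.pi) ^ 2)
  have h3 : HasSum (fun m : ℤ => ‖avg m F z‖ ^ 2)
      (2 * Real.pi * ∫ θ in (0 : ℝ)..(2 * Real.pi), ‖F (Complex.exp (θ * Complex.I) • z)‖ ^ 2) := by
    have e1 : (fun m : ℤ => (2 * Real.pi) ^ 2 * ((2 * Real.pi)⁻¹ ^ 2 * ‖avg m F z‖ ^ 2)) =
        fun m : ℤ => ‖avg m F z‖ ^ 2 := by
      funext m; field_simp
    have e2 : (2 * Real.pi) ^ 2 * (2 * Real.pi - 0)⁻¹ • ∫ θ in (0 : ℝ)..(2 * Real.pi), ‖F (Complex.exp (θ * Complex.I) • z)‖ ^ 2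
        = 2 * Real.pi * ∫ θ in (0 : ℝ)..(2 * Real.pi), ‖F (Complex.exp (θ * Complex.I) • z)‖ ^ 2 := by
      rw [smul_eq_mul, sub_zero, ← mul_assoc, pow_two, mul_assoc (2 * Real.pi), mul_inv_cancel₀ hab.ne', mul_one]
    rw [e1, e2] at h2
    exact h2
  rw [← ENNReal.ofReal_tsum_of_nonneg (fun m => by positivity) h3.summable, h3.tsum_eq,
    ENNReal.ofReal_mul hab.le, intervalIntegral.integral_of_le hab.le,
    ofReal_integral_eq_lintegral_ofReal]
  · exact ((hc.norm.pow 2).integrableOn_Icc).mono_set Set.Ioc_subset_Icc_self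
  · exact Filter.Eventually.of_forall fun θ => by positivity

lemma parseval {p : Wt} (hp : ∀ x ≤ 1, 0 ≤ p x) (F : SF n) :
    ∑' m : ℤ, ENNReal.ofReal (en p (av m F)) =
      ENNReal.ofReal (2 * Real.pi) * (ENNReal.ofReal (2 * Real.pi) * ENNReal.ofReal (en p F)) := by
  have hpc : Continuous fun z : En n => p (1 - ‖z‖ ^ 2) := p.contDiff.continuous.comp (by fun_prop)
  simp_rw [ofReal_en hp]
  rw [← lintegral_tsum fun m => ?_]
  swap
  · exact ((ENNReal.continuous_ofReal.comp hpc).measurable.mul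
      (ENNReal.continuous_ofReal.comp ((av m F).continuous.norm.pow 2)).measurable).aemeasurable
  simp_rw [ENNReal.tsum_mul_left, av_val, parseval_pt]
  have hm : ∀ z : En n, ENNReal.ofReal (p (1 - ‖z‖ ^ 2)) * (ENNReal.ofReal (2 * Real.pi) * ∫⁻ θ in Set.Ioc 0 (2 * Real.pi),
      ENNReal.ofReal (‖F (Complex.exp ((θ : ℝ) * Complex.I) • z)‖ ^ 2)) =
      ENNReal.ofReal (2 * Real.pi) * ∫⁻ θ in Set.Ioc 0 (2 * Real.pi), ENNReal.ofReal (p (1 - ‖z‖ ^ 2)) *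
      ENNReal.ofReal (‖F (Complex.exp ((θ : ℝ) * Complex.I) • z)‖ ^ 2) := by
    intro z
    rw [lintegral_const_mul' _ _ ENNReal.ofReal_ne_top]; ring
  simp_rw [hm]
  rw [lintegral_const_mul' _ _ ENNReal.ofReal_ne_top, lintegral_lintegral_swap]
  swap
  · refine Measurable.aemeasurable ?_
    have m1 : Measurable fun q : En n × ℝ => ENNReal.ofReal (p (1 - ‖q.1‖ ^ 2)) :=
      (ENNReal.continuous_ofReal.comp hpc).measurable.comp measurable_fst
    have m2 : Measurable fun q : En n × ℝ => ENNReal.ofReal (‖F (Complex.exp (q.2 * Complex.I) • q.1)‖ ^ 2) :=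
      (ENNReal.continuous_ofReal.comp ((continuous_rot F).norm.pow 2)).measurable
    exact m1.mul m2
  congr 1
  have hr : ∀ θ : ℝ, ∫⁻ z : En n, ENNReal.ofReal (p (1 - ‖z‖ ^ 2)) *
      ENNReal.ofReal (‖F (Complex.exp ((θ : ℝ) * Complex.I) • z)‖ ^ 2) =
      ∫⁻ z : En n, ENNReal.ofReal (p (1 - ‖z‖ ^ 2)) * ENNReal.ofReal (‖F z‖ ^ 2) := by
    intro θ
    have he : ‖Complex.exp (θ * Complex.I)‖ = 1 := Complex.norm_exp_ofReal_mul_I θ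
    conv_rhs => rw [← map_rot _ he]
    rw [lintegral_map]
    · simp only [norm_smul, he, one_mul]
    · exact (ENNReal.continuous_ofReal.comp hpc).measurable.mul
        (ENNReal.continuous_ofReal.comp (F.continuous.norm.pow 2)).measurable
    · fun_prop
  simp_rw [hr]
  rw [lintegral_const, Measure.restrict_apply_univ, Real.volume_Ioc, sub_zero, mul_comm]

lemma en_D_le {p : Wt} (hp : ∀ x ≤ 1, 0 ≤ p x) (F : SF n) :
    (2 * ((n : ℝ) - 1)) ^ 2 * en p (D F) ≤ en p (Box F) := by
  have hpos : (0 : ℝ) < 2 * Real.pi := Real.two_pi_pos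
  have h : ∑' m : ℤ, ENNReal.ofReal ((2 * ((n : ℝ) - 1)) ^ 2) * ENNReal.ofReal (en p (av m (D F))) ≤
      ∑' m : ℤ, ENNReal.ofReal (en p (av m (Box F))) := by
    refine ENNReal.tsum_le_tsum fun m => ?_
    rw [← ENNReal.ofReal_mul (by positivity)]
    exact ENNReal.ofReal_le_ofReal (en_av_le hp m F)
  rw [ENNReal.tsum_mul_left, parseval hp, parseval hp, ← ENNReal.ofReal_mul hpos.le,
    ← ENNReal.ofReal_mul hpos.le, ← ENNReal.ofReal_mul hpos.le, ← ENNReal.ofReal_mul hpos.le, ← ENNReal.ofReal_mul (by positivity)] at h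
  have hB := en_nonneg hp (Box F)
  rw [ENNReal.ofReal_le_ofReal_iff (by positivity)] at h
  have h2 : (2 * Real.pi) ^ 2 * ((2 * ((n : ℝ) - 1)) ^ 2 * en p (D F)) ≤ (2 * Real.pi) ^ 2 * en p (Box F) := by
    nlinarith
  exact le_of_mul_le_mul_left h2 (by positivity)

end SF

namespace Wt

/-- The power weight `x ^ α`, cut off smoothly at `x ~ 2⁻ᵏ`. -/
noncomputable def pw (α : ℝ) (k : ℕ) : Wt :=
  ⟨fun x => Real.smoothTransition (2 ^ k * x - 1) * x ^ α, by
    have hz : ∀ x : ℝ, x ≤ (2 ^ k)⁻¹ → Real.smoothTransition (2 ^ k * x - 1) = 0 := fun x hx => by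
      refine Real.smoothTransition.zero_of_nonpos ?_
      have := mul_le_mul_of_nonneg_left hx (by positivity : (0 : ℝ) ≤ 2 ^ k)
      rw [mul_inv_cancel₀ (by positivity)] at this
      linarith
    have hpos : (0 : ℝ) < (2 ^ k)⁻¹ := by positivity
    refine ⟨contDiff_iff_contDiffAt.2 fun x => ?_, (2 ^ k)⁻¹, by positivity, fun x hx => by simp [hz x hx]⟩
    rcases lt_or_ge x (2 ^ k)⁻¹ with hx | hx
    · refine (contDiffAt_const (c := (0 : ℝ))).congr_of_eventuallyEq ?_
      filter_upwards [Iio_mem_nhds hx] with y hy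
      simp [hz y (le_of_lt hy)]
    · refine ContDiffAt.mul ?_ (Real.contDiffAt_rpow_const_of_ne (hpos.trans_le hx).ne')
      exact Real.smoothTransition.contDiff.contDiffAt.comp x (by fun_prop)⟩

lemma pw_val (α : ℝ) (k : ℕ) (x : ℝ) :
    pw α k x = Real.smoothTransition (2 ^ k * x - 1) * x ^ α := rfl

lemma pw_zero {α : ℝ} {k : ℕ} {x : ℝ} (hx : 2 ^ k * x ≤ 1) : pw α k x = 0 := by
  rw [pw_val, Real.smoothTransition.zero_of_nonpos (by linarith), zero_mul]

lemma pos_of_cut {k : ℕ} {x : ℝ} (hx : 1 ≤ 2 ^ k * x) : 0 < x := by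
  by_contra h
  have := mul_nonpos_of_nonneg_of_nonpos (by positivity : (0 : ℝ) ≤ 2 ^ k) (not_lt.1 h)
  linarith

lemma pw_one {α : ℝ} {k : ℕ} {x : ℝ} (hx : 2 ≤ 2 ^ k * x) : pw α k x = x ^ α := by
  rw [pw_val, Real.smoothTransition.one_of_one_le (by linarith), one_mul]

lemma pw_nonneg (α : ℝ) (k : ℕ) (x : ℝ) : 0 ≤ pw α k x := by
  rcases le_total (2 ^ k * x) 1 with h | h
  · rw [pw_zero h]
  · exact mul_nonneg (Real.smoothTransition.nonneg _) (Real.rpow_nonneg (pos_of_cut h).le _)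

lemma pw_mono_exp {α β : ℝ} (h : β ≤ α) (k : ℕ) {x : ℝ} (hx : x ≤ 1) : pw α k x ≤ pw β k x := by
  rcases le_total (2 ^ k * x) 1 with h1 | h1
  · rw [pw_zero h1, pw_zero h1]
  · exact mul_le_mul_of_nonneg_left (Real.rpow_le_rpow_of_exponent_ge (pos_of_cut h1) hx h)
      (Real.smoothTransition.nonneg _)

lemma pw_mono_cut (α : ℝ) {k l : ℕ} (hkl : k ≤ l) (x : ℝ) : pw α k x ≤ pw α l x := by
  rcases le_total (2 ^ k * x) 1 with h1 | h1
  · rw [pw_zero h1]; exact pw_nonneg _ _ _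
  · refine mul_le_mul_of_nonneg_right (Real.smoothTransition.monotone ?_) (Real.rpow_nonneg (pos_of_cut h1).le _)
    have := mul_le_mul_of_nonneg_right (pow_le_pow_right₀ (by norm_num : (1 : ℝ) ≤ 2) hkl) (pos_of_cut h1).le
    linarith

lemma xm_pw (α : ℝ) (k : ℕ) : (pw α k).xm = pw (α + 1) k := by
  refine Subtype.ext (funext fun x => ?_)
  rcases le_total (2 ^ k * x) 1 with h1 | h1
  · exact (xm_val _ _).trans (by rw [pw_zero h1, mul_zero]; exact (pw_zero h1).symm)
  · refine (xm_val _ _).trans ?_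
    rw [pw_val]
    refine Eq.trans ?_ (pw_val _ _ _).symm
    rw [Real.rpow_add_one (pos_of_cut h1).ne']; ring

lemma pw_scale (α : ℝ) (k : ℕ) (x : ℝ) : pw α k x = ((2 : ℝ) ^ k) ^ (-α) * pw α 0 (2 ^ k * x) := by
  rcases le_total (2 ^ k * x) 1 with h1 | h1
  · rw [pw_zero h1, pw_zero (by simpa using h1), mul_zero]
  · rw [pw_val, pw_val, Real.mul_rpow (by positivity) (pos_of_cut h1).le, pow_zero, one_mul,
      Real.rpow_neg (by positivity)]
    field_simp

lemma der_pw_scale (α : ℝ) (k : ℕ) (x : ℝ) :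
    (pw α k).der x = ((2 : ℝ) ^ k) ^ (1 - α) * (pw α 0).der (2 ^ k * x) := by
  have h : (pw α k : ℝ → ℝ) = fun x => ((2 : ℝ) ^ k) ^ (-α) * pw α 0 (2 ^ k * x) := funext (pw_scale α k)
  rw [der_val, h, der_val, deriv_const_mul_field, deriv_comp_mul_left, smul_eq_mul, ← mul_assoc,
    mul_comm _ ((2 : ℝ) ^ k), sub_eq_add_neg, Real.rpow_add (by positivity), Real.rpow_one]

lemma der2_pw_scale (α : ℝ) (k : ℕ) (x : ℝ) :
    (pw α k).der.der x = ((2 : ℝ) ^ k) ^ (2 - α) * (pw α 0).der.der (2 ^ k * x) := by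
  have h : ((pw α k).der : ℝ → ℝ) = fun x => ((2 : ℝ) ^ k) ^ (1 - α) * (pw α 0).der (2 ^ k * x) :=
    funext (der_pw_scale α k)
  rw [der_val, h, der_val, deriv_const_mul_field, deriv_comp_mul_left, smul_eq_mul, ← mul_assoc,
    mul_comm _ ((2 : ℝ) ^ k), show (2 : ℝ) - α = 1 + (1 - α) by ring, Real.rpow_add (by positivity), Real.rpow_one]

/-- The family `P` of weights is `O(x ^ α)`, uniformly, and vanishes below the cutoff. -/
def Ord (α : ℝ) (P : ℕ → Wt) : Prop :=
  ∃ C : ℝ, 0 ≤ C ∧ ∀ k x, x ≤ 1 → |P k x| ≤ C * if 1 ≤ 2 ^ k * x then x ^ α else 0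

lemma Ord.add {α : ℝ} {P Q : ℕ → Wt} (hP : Ord α P) (hQ : Ord α Q) : Ord α (fun k => P k + Q k) := by
  obtain ⟨C, hC, h⟩ := hP
  obtain ⟨C', hC', h'⟩ := hQ
  refine ⟨C + C', by positivity, fun k x hx => ?_⟩
  rw [add_val, add_mul]
  exact (abs_add_le _ _).trans (add_le_add (h k x hx) (h' k x hx))

lemma Ord.smul {α : ℝ} {P : ℕ → Wt} (hP : Ord α P) (c : ℝ) : Ord α (fun k => c • P k) := by
  obtain ⟨C, hC, h⟩ := hP
  refine ⟨|c| * C, by positivity, fun k x hx => ?_⟩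
  rw [smul_val, abs_mul, mul_assoc]
  exact mul_le_mul_of_nonneg_left (h k x hx) (abs_nonneg c)

lemma Ord.sub {α : ℝ} {P Q : ℕ → Wt} (hP : Ord α P) (hQ : Ord α Q) : Ord α (fun k => P k - Q k) := by
  have e : (fun k => P k - Q k) = fun k => P k + (-1 : ℝ) • Q k :=
    funext fun k => Subtype.ext (funext fun x => by
      rw [sub_val, add_val, smul_val]; ring)
  rw [e]
  exact hP.add (hQ.smul (-1))

lemma Ord.mono {α β : ℝ} {P : ℕ → Wt} (hP : Ord α P) (hab : β ≤ α) : Ord β P := by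
  obtain ⟨C, hC, h⟩ := hP
  refine ⟨C, hC, fun k x hx => (h k x hx).trans (mul_le_mul_of_nonneg_left ?_ hC)⟩
  split_ifs with h1
  · exact Real.rpow_le_rpow_of_exponent_ge (pos_of_cut h1) hx hab
  · exact le_rfl

lemma Ord.xm {α : ℝ} {P : ℕ → Wt} (hP : Ord α P) : Ord (α + 1) (fun k => (P k).xm) := by
  obtain ⟨C, hC, h⟩ := hP
  refine ⟨C, hC, fun k x hx => ?_⟩
  rw [xm_val, abs_mul]
  have := h k x hx
  split_ifs at this ⊢ with h1
  · rw [Real.rpow_add_one (pos_of_cut h1).ne', abs_of_pos (pos_of_cut h1)]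
    nlinarith [pos_of_cut h1]
  · nlinarith [abs_nonneg x, abs_nonneg (P k x)]

lemma exists_bound {g : ℝ → ℝ} (hg : Continuous g) {c β : ℝ} (h : ∀ y > 2, g y = c * y ^ β) :
    ∃ C : ℝ, 0 ≤ C ∧ ∀ y ≥ 1, |g y| ≤ C * y ^ β := by
  obtain ⟨C, hC⟩ := (isCompact_Icc (a := (1 : ℝ)) (b := 2)).exists_bound_of_continuousOn
    (f := fun y => g y * y ^ (-β)) (hg.continuousOn.mul (ContinuousOn.rpow_const continuousOn_id
      fun x hx => Or.inl (zero_lt_one.trans_le hx.1).ne'))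
  refine ⟨max C |c|, (abs_nonneg c).trans (le_max_right _ _), fun y hy => ?_⟩
  have hy0 : 0 < y := zero_lt_one.trans_le hy
  have hp := Real.rpow_pos_of_pos hy0 β
  rcases le_or_gt y 2 with h2 | h2
  · have := hC y ⟨hy, h2⟩
    rw [Real.norm_eq_abs, abs_mul, abs_of_nonneg (Real.rpow_nonneg hy0.le _), Real.rpow_neg hy0.le,
      ← div_eq_mul_inv, div_le_iff₀ hp] at this
    exact this.trans (mul_le_mul_of_nonneg_right (le_max_left _ _) hp.le)
  · rw [h y h2, abs_mul, abs_of_pos hp]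
    exact mul_le_mul_of_nonneg_right (le_max_right _ _) hp.le

lemma ord_of_scale {P : ℕ → Wt} {β c : ℝ} (hs : ∀ k x, P k x = ((2 : ℝ) ^ k) ^ (-β) * P 0 (2 ^ k * x))
    (h0 : ∀ y < 1, P 0 y = 0) (h : ∀ y > 2, P 0 y = c * y ^ β) : Ord β P := by
  obtain ⟨C, hC, hb⟩ := exists_bound (P 0).contDiff.continuous h
  refine ⟨C, hC, fun k x hx => ?_⟩
  rw [hs]
  split_ifs with h1
  · rw [abs_mul, abs_of_nonneg (Real.rpow_nonneg (by positivity) _)]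
    have := mul_le_mul_of_nonneg_left (hb _ h1) (Real.rpow_nonneg (by positivity : (0 : ℝ) ≤ 2 ^ k) (-β))
    refine this.trans (le_of_eq ?_)
    rw [Real.mul_rpow (by positivity) (pos_of_cut h1).le, Real.rpow_neg (by positivity)]
    have : (0 : ℝ) < ((2 : ℝ) ^ k) ^ β := by positivity
    field_simp
  · rw [h0 _ (not_le.1 h1)]; simp

lemma der_zero_of {p : Wt} (h : ∀ y < 1, p y = 0) : ∀ y < 1, p.der y = 0 := by
  intro y hy
  have : (p : ℝ → ℝ) =ᶠ[nhds y] fun _ => 0 := by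
    filter_upwards [Iio_mem_nhds hy] with z hz using h z hz
  rw [der_val, this.deriv_eq, deriv_const]

lemma der_pow_of {p : Wt} {c β : ℝ} (h : ∀ y > 2, p y = c * y ^ β) :
    ∀ y > 2, p.der y = (c * β) * y ^ (β - 1) := by
  intro y hy
  have : (p : ℝ → ℝ) =ᶠ[nhds y] fun y => c * y ^ β := by
    filter_upwards [Ioi_mem_nhds hy] with z hz using h z hz
  rw [der_val, this.deriv_eq, deriv_const_mul_field, Real.deriv_rpow_const, mul_assoc]

lemma pw0_zero (α : ℝ) : ∀ y < 1, pw α 0 y = 0 := fun y hy => pw_zero (by simpa using hy.le)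
lemma pw0_pow (α : ℝ) : ∀ y > 2, pw α 0 y = 1 * y ^ α := fun y hy => by
  rw [one_mul, pw_one (by simpa using hy.le)]

lemma ord_pw (α : ℝ) : Ord α (pw α) :=
  ord_of_scale (pw_scale α) (pw0_zero α) (pw0_pow α)
lemma ord_der_pw (α : ℝ) : Ord (α - 1) (fun k => (pw α k).der) :=
  ord_of_scale (fun k x => by rw [neg_sub]; exact der_pw_scale α k x) (der_zero_of (pw0_zero α))
    (der_pow_of (pw0_pow α))
lemma ord_der2_pw (α : ℝ) : Ord (α - 1 - 1) (fun k => (pw α k).der.der) :=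
  ord_of_scale (fun k x => by rw [show -(α - 1 - 1) = 2 - α by ring]; exact der2_pw_scale α k x)
    (der_zero_of (der_zero_of (pw0_zero α))) (der_pow_of (der_pow_of (pw0_pow α)))

lemma der_add (p q : Wt) : (p + q).der = p.der + q.der := by
  refine Subtype.ext (funext fun x => ?_)
  exact deriv_add (p.differentiable x) (q.differentiable x)
lemma der_smul (c : ℝ) (p : Wt) : (c • p).der = c • p.der := by
  refine Subtype.ext (funext fun x => ?_)
  exact deriv_const_mul_field (v := (p : ℝ → ℝ)) c
lemma der_sub (p q : Wt) : (p - q).der = p.der - q.der := by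
  refine Subtype.ext (funext fun x => ?_)
  exact deriv_sub (p.differentiable x) (q.differentiable x)
lemma der_xm (p : Wt) : p.xm.der = p + p.der.xm := by
  refine Subtype.ext (funext fun x => ?_)
  have := ((hasDerivAt_id x).mul (p.differentiable x).hasDerivAt).deriv
  refine Eq.trans this ?_
  simp [der_val]

lemma ord_st {α : ℝ} {P : ℕ → Wt} (n : ℕ) (hP : Ord α P) (hP' : Ord (α - 1) (fun k => (P k).der)) :
    Ord (α - 1) (fun k => (P k).st n) :=
  ((hP'.sub (hP'.xm.mono (by linarith))).smul 2).sub ((hP.mono (by linarith)).smul (2 * n))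

lemma ord_st_xm_pw (n : ℕ) (α : ℝ) : Ord α (fun k => (pw α k).xm.st n) := by
  have h := ord_st n (ord_pw (α + 1)) (ord_der_pw (α + 1))
  simp only [← xm_pw, add_sub_cancel_right] at h
  exact h

lemma ord_qw_pw (n : ℕ) (α : ℝ) : Ord α (fun k => (pw α k).qw n) :=
  (ord_st_xm_pw n α).add ((ord_pw α).smul _)

lemma ord_der_st {α : ℝ} {P : ℕ → Wt} (n : ℕ) (hP' : Ord (α - 1) (fun k => (P k).der))
    (hP'' : Ord (α - 1 - 1) (fun k => (P k).der.der)) : Ord (α - 1 - 1) (fun k => ((P k).st n).der) := by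
  simp only [st, der_sub, der_smul, der_xm]
  exact ((hP''.sub ((hP'.mono (by linarith)).add (hP''.xm.mono (by linarith)))).smul 2).sub
    ((hP'.mono (by linarith)).smul (2 * n))

lemma ord_st_qw_pw (n : ℕ) (α : ℝ) : Ord (α - 1) (fun k => ((pw α k).qw n).st n) := by
  refine ord_st n (ord_qw_pw n α) ?_
  simp only [qw, der_add, der_smul]
  refine Ord.add ?_ ((ord_der_pw α).smul _)
  simp only [xm_pw]
  have h := ord_der_st n (ord_der_pw (α + 1)) (ord_der2_pw (α + 1))
  simpa only [add_sub_cancel_right] using h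

lemma Ord.le_pw {α : ℝ} {P : ℕ → Wt} (hP : Ord α P) :
    ∃ C : ℝ, 0 ≤ C ∧ ∀ k x, x ≤ 1 → |P k x| ≤ (C • pw α (k + 1)) x := by
  obtain ⟨C, hC, h⟩ := hP
  refine ⟨C, hC, fun k x hx => (h k x hx).trans ?_⟩
  rw [smul_val]
  refine mul_le_mul_of_nonneg_left ?_ hC
  split_ifs with h1
  · rw [pw_one]
    rw [pow_succ]; linarith
  · exact pw_nonneg _ _ _

end Wt

namespace SF
variable {n : ℕ}
open Wt

lemma en_neg_wt (p : Wt) (F : SF n) : en (-p) F = -en p F := by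
  rw [← neg_one_smul ℝ p, en_smul_wt, neg_one_mul]

lemma Ord.en_le {α : ℝ} {P : ℕ → Wt} (hP : Ord α P) :
    ∃ C : ℝ, 0 ≤ C ∧ ∀ k (F : SF n), |en (P k) F| ≤ C * en (pw α (k + 1)) F := by
  obtain ⟨C, hC, h⟩ := hP.le_pw
  refine ⟨C, hC, fun k F => ?_⟩
  rw [← en_smul_wt, abs_le, ← en_neg_wt]
  constructor
  · exact en_mono (fun x hx => by rw [show (-(C • pw α (k+1))) x = -((C • pw α (k+1)) x) from rfl]; exact (abs_le.1 (h k x hx)).1) F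
  · exact en_mono (fun x hx => (abs_le.1 (h k x hx)).2) F

lemma Ord.eb_le {α : ℝ} {P : ℕ → Wt} (hP : Ord α P) :
    ∃ C : ℝ, 0 ≤ C ∧ ∀ k (F : SF n), eb (P k) F ≤ C * eb (pw α (k + 1)) F := by
  obtain ⟨C, hC, h⟩ := hP.le_pw
  refine ⟨C, hC, fun k F => ?_⟩
  rw [← eb_smul_wt]
  exact eb_mono (fun x hx => (abs_le.1 (h k x hx)).2) F

lemma en_pw_nonneg (α : ℝ) (k : ℕ) (F : SF n) : 0 ≤ en (pw α k) F := en_nonneg (fun _ _ => pw_nonneg _ _ _) F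
lemma eb_pw_nonneg (α : ℝ) (k : ℕ) (F : SF n) : 0 ≤ eb (pw α k) F := eb_nonneg (fun _ _ => pw_nonneg _ _ _) F
lemma en_pw_mono (α : ℝ) {k l : ℕ} (h : k ≤ l) (F : SF n) : en (pw α k) F ≤ en (pw α l) F :=
  en_mono (fun _ _ => pw_mono_cut _ h _) F
lemma en_pw_exp {α β : ℝ} (h : β ≤ α) (k : ℕ) (F : SF n) : en (pw α k) F ≤ en (pw β k) F :=
  en_mono (fun _ hx => pw_mono_exp h _ hx) F

/-- `F` is `M`-harmonic where the weights with cutoff `2⁻ᵏ` live. -/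
def HarmTo (k : ℕ) (F : SF n) : Prop := ∀ z : En n, 1 < 2 ^ k * (1 - ‖z‖ ^ 2) → MM F z = 0

lemma HarmTo.W_mul {k l : ℕ} {F : SF n} (h : HarmTo l F) (hkl : k ≤ l) (α : ℝ) :
    W (pw α k) * MM F = 0 := by
  refine ext_val fun z => ?_
  rw [mul_val, W_val, zero_val]
  rcases le_or_gt (2 ^ l * (1 - ‖z‖ ^ 2)) 1 with h1 | h1
  · have : pw α k (1 - ‖z‖ ^ 2) = 0 := by
      refine le_antisymm ?_ (pw_nonneg _ _ _)
      rw [← pw_zero (α := α) h1]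
      exact pw_mono_cut α hkl _
    rw [this]; simp
  · rw [h z h1, mul_zero]

lemma en_xm_N_nonneg (α : ℝ) (k : ℕ) (F : SF n) : 0 ≤ en (pw α k).xm F := by
  rw [xm_pw]; exact en_pw_nonneg _ _ _

lemma energy_upper (n : ℕ) (α : ℝ) : ∃ C : ℝ, 0 ≤ C ∧ ∀ k l (F : SF n), k ≤ l → HarmTo l F →
    eb (pw α k) F + en (pw (α + 1) k) (N F) ≤ C * en (pw (α - 1) (k + 1)) F := by
  obtain ⟨C, hC, h⟩ := Ord.en_le (n := n) (ord_st_qw_pw n α)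
  refine ⟨C, hC, fun k l F hkl hF => ?_⟩
  have h1 := energy_en (hF.W_mul hkl α)
  have h2 := (abs_le.1 (h k F)).2
  have h3 := en_xm_N_nonneg α k (D F)
  have h4 := mul_nonneg hC (en_pw_nonneg (α - 1) (k + 1) F)
  rw [xm_pw] at h1 h3
  linarith

lemma upper_Box (n : ℕ) (s : ℝ) : ∃ C : ℝ, 0 ≤ C ∧ ∀ k (F : SF n), HarmTo (k + 1) F →
    en (pw (s + 2) k) (Box F) ≤ C * en (pw s (k + 2)) F := by
  obtain ⟨C, hC, h⟩ := Ord.eb_le (n := n) (ord_st_qw_pw n (s + 2))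
  obtain ⟨C', hC', h'⟩ := energy_upper n (s + 1)
  refine ⟨C * C', by positivity, fun k F hF => ?_⟩
  have h1 := energy_eb (hF.W_mul (Nat.le_succ k) (s + 2))
  have h2 := h k F
  have h3 := h' (k + 1) (k + 1) F le_rfl hF
  rw [xm_pw] at h1
  rw [show s + 2 - 1 = s + 1 by ring] at h2
  rw [show s + 1 - 1 = s by ring] at h3
  have h4 := mul_le_mul_of_nonneg_left h3 hC
  have h5 := mul_nonneg hC (en_pw_nonneg (s + 1 + 1) (k + 1) (N F))
  have h6 := eb_pw_nonneg (s + 2 + 1) k (N F)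
  have h7 := eb_pw_nonneg (s + 2 + 1) k (D F)
  have h8 := mul_nonneg hC (eb_pw_nonneg (s + 1) (k + 1) F)
  rw [mul_assoc]
  have : k + 1 + 1 = k + 2 := rfl
  rw [this] at h4
  linarith

end SF

namespace SF
variable {n : ℕ}
open Wt

lemma le_der_pw (β : ℝ) (k : ℕ) (x : ℝ) : β * pw (β - 1) k x ≤ (pw β k).der x := by
  rcases le_or_gt x 0 with hx | hx
  · have hz : ∀ y : ℝ, y < (2 ^ k)⁻¹ → 2 ^ k * y ≤ 1 := fun y hy => by
      have := mul_le_mul_of_nonneg_left hy.le (by positivity : (0 : ℝ) ≤ 2 ^ k)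
      rwa [mul_inv_cancel₀ (by positivity)] at this
    have hx' : x < (2 ^ k)⁻¹ := hx.trans_lt (by positivity)
    have h : (pw β k : ℝ → ℝ) =ᶠ[nhds x] fun _ => 0 := by
      filter_upwards [Iio_mem_nhds hx'] with y hy using pw_zero (hz y hy)
    rw [pw_zero (hz x hx'), der_val, h.deriv_eq]; simp
  · have hm : Monotone fun x : ℝ => Real.smoothTransition (2 ^ k * x - 1) := fun a b hab =>
      Real.smoothTransition.monotone (by
        have := mul_le_mul_of_nonneg_left hab (by positivity : (0 : ℝ) ≤ 2 ^ k)
        linarith)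
    have hd : DifferentiableAt ℝ (fun x : ℝ => Real.smoothTransition (2 ^ k * x - 1)) x := by
      have : ContDiff ℝ 1 (fun x : ℝ => Real.smoothTransition (2 ^ k * x - 1)) :=
        (Real.smoothTransition.contDiff (n := 1)).comp (by fun_prop)
      exact this.differentiable (by simp) x
    have h := (hd.hasDerivAt.mul (Real.hasDerivAt_rpow_const (p := β) (Or.inl hx.ne'))).deriv
    have h' : (pw β k).der x = _ := h
    rw [h', pw_val]
    have := mul_nonneg (hm.deriv_nonneg (x := x)) (Real.rpow_nonneg hx.le β)
    linarith

lemma pw_succ_eq (α : ℝ) (k : ℕ) (x : ℝ) : pw (α + 1) k x = x * pw α k x := by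
  rw [← xm_pw, xm_val]

lemma en_interp (α : ℝ) {μ : ℝ} (hμ : 0 < μ) (k : ℕ) (F : SF n) :
    en (pw (α + 1) k) F ≤ μ * en (pw α k) F + μ⁻¹ * en (pw (α + 2) k) F := by
  rw [← en_smul_wt, ← en_smul_wt, ← en_add_wt]
  refine en_mono (fun x _ => ?_) F
  rw [Wt.add_val, Wt.smul_val, Wt.smul_val, show α + 2 = α + 1 + 1 by ring, pw_succ_eq, pw_succ_eq, pw_succ_eq]
  have h : x ≤ μ + μ⁻¹ * x ^ 2 := by
    have : μ + μ⁻¹ * x ^ 2 - x = μ⁻¹ * ((x - μ / 2) ^ 2 + 3 / 4 * μ ^ 2) := by field_simp; ring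
    have h2 : 0 ≤ μ⁻¹ * ((x - μ / 2) ^ 2 + 3 / 4 * μ ^ 2) := by positivity
    linarith
  nlinarith [mul_le_mul_of_nonneg_right h (pw_nonneg α k x)]

lemma hardy (n : ℕ) {s : ℝ} (hs : -1 < s) : ∃ C : ℝ, 0 ≤ C ∧ ∀ k (F : SF n),
    en (pw s k) F ≤ C * (en (pw (s + 2) k) F + en (pw (s + 2) k) (N F)) := by
  obtain ⟨σ, hσ⟩ : ∃ σ, σ = s + 1 := ⟨_, rfl⟩
  have hσ0 : 0 < σ := by linarith
  have hn : (0 : ℝ) ≤ n := Nat.cast_nonneg n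
  refine ⟨σ⁻¹ * (8 * (σ + n) ^ 2 / σ + 2 / σ), by positivity, fun k F => ?_⟩
  have h1 : 2 * σ * en (pw s k) F + -(2 * (σ + n)) * en (pw (s + 1) k) F ≤ en ((pw (s + 1) k).st n) F := by
    rw [← en_smul_wt, ← en_smul_wt, ← en_add_wt]
    refine en_mono (fun x hx => ?_) F
    rw [Wt.add_val, Wt.smul_val, Wt.smul_val, st_val, pw_succ_eq]
    have := mul_le_mul_of_nonneg_left (le_der_pw (s + 1) k x) (by linarith : 0 ≤ 2 * (1 - x))
    rw [add_sub_cancel_right, der_val, ← hσ] at this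
    rw [← hσ]
    nlinarith
  rw [en_st] at h1
  have h2 := two_re_br_le (p := pw (s + 1) k) (q₁ := (σ / 2)⁻¹ • pw (s + 2) k) (q₂ := (σ / 2) • pw s k)
    (fun x _ => by rw [Wt.smul_val]; exact mul_nonneg (by positivity) (pw_nonneg _ _ _))
    (fun x _ => by rw [Wt.smul_val]; exact mul_nonneg (by positivity) (pw_nonneg _ _ _))
    (fun x _ => by
      rw [Wt.smul_val, Wt.smul_val, show s + 2 = s + 1 + 1 by ring, pw_succ_eq (s + 1), pw_succ_eq s]
      apply le_of_eq; field_simp) (N F) F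
  rw [en_smul_wt, en_smul_wt] at h2
  have h3 := en_interp s (μ := σ / (4 * (σ + n))) (by positivity) k F
  have h4 := (le_abs_self _).trans h2
  have hA := en_pw_nonneg (s + 2) k (N F)
  have ha := en_pw_nonneg (s + 2) k F
  set a0 := en (pw s k) F
  set a1 := en (pw (s + 1) k) F
  set a2 := en (pw (s + 2) k) F
  set A := en (pw (s + 2) k) (N F)
  have h5 : 2 * (σ + n) * a1 ≤ σ / 2 * a0 + 8 * (σ + n) ^ 2 / σ * a2 := by
    have := mul_le_mul_of_nonneg_left h3 (by positivity : 0 ≤ 2 * (σ + n))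
    refine this.trans (le_of_eq ?_)
    field_simp; ring
  have h6 : (σ / 2)⁻¹ * A = 2 / σ * A := by field_simp
  rw [h6] at h4
  have h7 : σ * a0 ≤ (8 * (σ + n) ^ 2 / σ + 2 / σ) * (a2 + A) := by
    have p1 : 0 ≤ 2 / σ * a2 := by positivity
    have p2 : 0 ≤ 8 * (σ + n) ^ 2 / σ * A := by positivity
    nlinarith
  have h8 := mul_le_mul_of_nonneg_left h7 (by positivity : 0 ≤ σ⁻¹)
  rwa [← mul_assoc, inv_mul_cancel₀ hσ0.ne', one_mul, ← mul_assoc] at h8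

lemma lower_N {n : ℕ} (hn : 2 ≤ n) {s : ℝ} (hs : -1 < s) : ∃ C : ℝ, 0 ≤ C ∧ ∀ k (F : SF n),
    HarmTo k F → en (pw (s + 2) k) (N F) ≤
      C * (en (pw (s + 2) (k + 1)) F + en (pw (s + 2) (k + 1)) (Box F)) := by
  have hn' : (2 : ℝ) ≤ n := by exact_mod_cast hn
  obtain ⟨C1, hC1, hd⟩ := Ord.en_le (n := n) (ord_st_xm_pw n (s + 2))
  obtain ⟨C2, hC2, hu⟩ := energy_upper n (s + 3)
  refine ⟨8 * C2 + (2 + C1), by positivity, fun k F hF => ?_⟩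
  have e1 := energy_N (hF.W_mul le_rfl (s + 2))
  have e2 : 2 * en (pw (s + 2) k) (N F) + -2 * en (pw (s + 3) k) (N F) ≤
      en ((pw (s + 2) k).xm.st n) (N F) + 4 * ((n : ℝ) - 1) * en (pw (s + 2) k) (N F) := by
    rw [← en_smul_wt, ← en_smul_wt, ← en_smul_wt, ← en_add_wt, ← en_add_wt]
    refine en_mono (fun x hx => ?_) _
    have h0 := le_der_pw (s + 3) k x
    rw [show s + 3 - 1 = s + 2 by ring, der_val] at h0
    have h1 := mul_le_mul_of_nonneg_left h0 (by linarith : 0 ≤ 2 * (1 - x))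
    have hx3 : s + 3 = s + 2 + 1 := by ring
    simp only [Wt.add_val, Wt.smul_val, xm_pw, st_val, ← hx3]
    rw [show pw (s + 3) k x = x * pw (s + 2) k x by rw [hx3, pw_succ_eq]]
    have hp := pw_nonneg (s + 2) k x
    have h2 : 0 ≤ (2 * (1 - x) * (s + 2) + (4 * ((n : ℝ) - 1) - 2 * n * x)) * pw (s + 2) k x := by
      refine mul_nonneg ?_ hp
      have : 0 ≤ 2 * (1 - x) * (s + 2) := mul_nonneg (by linarith) (by linarith)
      nlinarith
    nlinarith
  have e3 : |eb ((pw (s + 2) k).st n) F| ≤ 2 * en (pw (s + 2) k) (Box F) + 1 / 2 * en (pw (s + 2) k) (N F) := by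
    rw [eb_st, ← en_smul_wt, ← en_smul_wt]
    refine two_re_br_le (fun x _ => ?_) (fun x _ => ?_) (fun x _ => ?_) _ _
    · rw [Wt.smul_val]; exact mul_nonneg (by positivity) (pw_nonneg _ _ _)
    · rw [Wt.smul_val]; exact mul_nonneg (by positivity) (pw_nonneg _ _ _)
    · rw [Wt.smul_val, Wt.smul_val]; apply le_of_eq; ring
  have e4 := en_interp (s + 2) (μ := 1 / 4) (by norm_num) k (N F)
  have e5 := hu k k F le_rfl hF
  have e6 := (abs_le.1 (hd k (D F))).2
  have e7 := en_D_le (p := pw (s + 2) (k + 1)) (fun _ _ => pw_nonneg _ _ _) F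
  have e8 : en (pw (s + 2) (k + 1)) (D F) ≤ en (pw (s + 2) (k + 1)) (Box F) := by
    have := en_pw_nonneg (s + 2) (k + 1) (D F)
    have h4 : 1 ≤ (2 * ((n : ℝ) - 1)) ^ 2 := by nlinarith
    have := mul_le_mul_of_nonneg_right h4 this
    linarith
  have e9 := en_pw_mono (s + 2) (Nat.le_succ k) (Box F)
  have e10 := eb_pw_nonneg (s + 3) k F
  rw [show s + 2 + 1 = s + 3 by ring, show s + 2 + 2 = s + 3 + 1 by ring] at e4
  rw [show s + 3 - 1 = s + 2 by ring] at e5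
  have e11 := mul_le_mul_of_nonneg_left e8 hC1
  have e12 := (abs_le.1 e3).2
  have e13 := en_pw_nonneg (s + 2) (k + 1) (F)
  have e14 := en_pw_nonneg (s + 2) (k + 1) (Box F)
  have e15 := mul_nonneg hC2 e14
  have e16 := mul_nonneg hC1 e13
  norm_num at e4
  nlinarith

lemma en_add_Box (p : Wt) (F : SF n) : en p (F + Box F) = en p F + 2 * eb p F + en p (Box F) := by
  simp only [en, eb, br_add_left, br_add_right, Complex.add_re]
  rw [← br_conj p (Box F) F, Complex.conj_re]; ring

lemma lower_main {n : ℕ} (hn : 2 ≤ n) {s : ℝ} (hs : -1 < s) : ∃ C : ℝ, 0 < C ∧ ∀ k (F : SF n),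
    HarmTo (k + 2) F → en (pw s k) F ≤ C * en (pw (s + 2) (k + 2)) (F + Box F) := by
  obtain ⟨C1, h1, H1⟩ := hardy n hs
  obtain ⟨C2, h2, H2⟩ := lower_N hn hs
  refine ⟨C1 * (1 + C2) + 1, by positivity, fun k F hF => ?_⟩
  have hFk : HarmTo k F := fun z hz => hF z (hz.trans_le (by
    have h0 : 0 < 1 - ‖z‖ ^ 2 := pos_of_cut hz.le
    exact mul_le_mul_of_nonneg_right (pow_le_pow_right₀ (by norm_num) (by omega)) h0.le))
  have e1 := H1 k F
  have e2 := H2 k F hFk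
  have e3 := en_pw_mono (s + 2) (Nat.le_succ k) F
  rw [en_add_Box]
  have m1 := en_pw_mono (s + 2) (Nat.le_succ (k + 1)) F
  have m2 := en_pw_mono (s + 2) (Nat.le_succ (k + 1)) (Box F)
  have m3 := eb_pw_nonneg (s + 2) (k + 2) F
  have m4 := en_pw_nonneg (s + 2) (k + 2) F
  have m5 := en_pw_nonneg (s + 2) (k + 2) (Box F)
  have m6 := en_pw_nonneg (s + 2) (k + 1) (Box F)
  simp only [Nat.succ_eq_add_one] at *
  rw [show k + 1 + 1 = k + 2 from rfl] at *
  set T := en (pw (s + 2) (k + 2)) F + 2 * eb (pw (s + 2) (k + 2)) F + en (pw (s + 2) (k + 2)) (Box F)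
  have hT : en (pw (s + 2) (k + 1)) F + en (pw (s + 2) (k + 1)) (Box F) ≤ T := by
    simp only [T]; linarith
  have e4 : en (pw (s + 2) k) F + en (pw (s + 2) k) (N F) ≤ (1 + C2) * T := by
    have := mul_le_mul_of_nonneg_left hT h2
    nlinarith
  have e5 := mul_le_mul_of_nonneg_left e4 h1
  have hT0 : 0 ≤ T := by simp only [T]; positivity
  nlinarith

lemma upper_main (n : ℕ) (s : ℝ) : ∃ C : ℝ, 0 < C ∧ ∀ k (F : SF n),
    HarmTo (k + 2) F → en (pw (s + 2) k) (F + Box F) ≤ C * en (pw s (k + 2)) F := by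
  obtain ⟨C1, h1, H1⟩ := upper_Box n s
  refine ⟨2 * (1 + C1), by positivity, fun k F hF => ?_⟩
  have hFk : HarmTo (k + 1) F := fun z hz => hF z (hz.trans_le (by
    have h0 : 0 < 1 - ‖z‖ ^ 2 := pos_of_cut hz.le
    exact mul_le_mul_of_nonneg_right (pow_le_pow_right₀ (by norm_num) (by omega)) h0.le))
  have e1 := H1 k F hFk
  have e2 : en (pw (s + 2) k) F ≤ en (pw s (k + 2)) F :=
    (en_pw_exp (by linarith) k F).trans (en_pw_mono s (by omega) F)
  have e3 : 2 * eb (pw (s + 2) k) F ≤ en (pw (s + 2) k) (Box F) + en (pw (s + 2) k) F := 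
    (le_abs_self _).trans (two_re_br_le (fun _ _ => pw_nonneg _ _ _) (fun _ _ => pw_nonneg _ _ _)
      (fun _ _ => (pow_two _).le) (Box F) F)
  rw [en_add_Box]
  linarith

end SF

namespace SF
variable {n : ℕ}
open Wt

/-- Composition of a smooth function of a real variable with the real part of `F`. -/
noncomputable def cmp (ψ : ℝ → ℝ) (hψ : ContDiff ℝ ((⊤ : ℕ∞) : WithTop ℕ∞) ψ) (F : SF n) : SF n :=
  ⟨fun z => Complex.ofRealCLM (ψ (Complex.reCLM (F z))),
    Complex.ofRealCLM.contDiff.comp (hψ.comp (Complex.reCLM.contDiff.comp F.contDiff))⟩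

lemma cmp_val (ψ : ℝ → ℝ) (hψ) (F : SF n) (z : En n) : cmp ψ hψ F z = (ψ (F z).re : ℂ) := rfl

lemma dir_cmp (v : En n) (ψ : ℝ → ℝ) (hψ) {F : SF n} (hF : conj F = F) : dir v (cmp ψ hψ F) =
    cmp (deriv ψ) (ContDiff.deriv' (n := ((⊤ : ℕ∞) : WithTop ℕ∞)) hψ) F * dir v F := by
  refine ext_val fun z => ?_
  have h1 := Complex.reCLM.hasFDerivAt.comp z (F.differentiableAt z).hasFDerivAt
  have h2 : HasDerivAt ψ (deriv ψ (F z).re) (F z).re := (hψ.differentiable (by simp) _).hasDerivAt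
  have h3 := Complex.ofRealCLM.hasFDerivAt.comp z (h2.hasFDerivAt.comp z h1)
  have h4 : ((cmp ψ hψ F : SF n) : En n → ℂ) =
    Complex.ofRealCLM ∘ (ψ ∘ (Complex.reCLM ∘ (F : En n → ℂ))) := rfl
  have h5 : (starRingEnd ℂ) (dir v F z) = dir v F z := by
    rw [← conj_val, ← dir_conj, hF]
  rw [dir_val, h4, h3.fderiv]
  rw [Complex.conj_eq_iff_re] at h5
  rw [mul_val, ← h5, cmp_val]
  simp [dir_val]
  ring

lemma dz_cmp (j : Fin n) (ψ : ℝ → ℝ) (hψ) {F : SF n} (hF : conj F = F) : dz j (cmp ψ hψ F) =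
    cmp (deriv ψ) (ContDiff.deriv' (n := ((⊤ : ℕ∞) : WithTop ℕ∞)) hψ) F * dz j F := by
  rw [dz_eq, dz_eq, dir_cmp _ _ _ hF, dir_cmp _ _ _ hF]
  simp only [Algebra.smul_def]; ring

lemma dzb_cmp (j : Fin n) (ψ : ℝ → ℝ) (hψ) {F : SF n} (hF : conj F = F) : dzb j (cmp ψ hψ F) =
    cmp (deriv ψ) (ContDiff.deriv' (n := ((⊤ : ℕ∞) : WithTop ℕ∞)) hψ) F * dzb j F := by
  rw [dzb_eq, dzb_eq, dir_cmp _ _ _ hF, dir_cmp _ _ _ hF]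
  simp only [Algebra.smul_def]; ring

lemma R_cmp (ψ : ℝ → ℝ) (hψ) {F : SF n} (hF : conj F = F) : R (cmp ψ hψ F) =
    cmp (deriv ψ) (ContDiff.deriv' (n := ((⊤ : ℕ∞) : WithTop ℕ∞)) hψ) F * R F := by
  simp only [R_apply, dz_cmp _ _ _ hF, Finset.mul_sum]
  exact Finset.sum_congr rfl fun _ _ => by ring

lemma Rb_cmp (ψ : ℝ → ℝ) (hψ) {F : SF n} (hF : conj F = F) : Rb (cmp ψ hψ F) =
    cmp (deriv ψ) (ContDiff.deriv' (n := ((⊤ : ℕ∞) : WithTop ℕ∞)) hψ) F * Rb F := by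
  simp only [Rb_apply, dzb_cmp _ _ _ hF, Finset.mul_sum]
  exact Finset.sum_congr rfl fun _ _ => by ring

/-- The square of the gradient associated with `MM`. -/
noncomputable def gr (F : SF n) : SF n := ∑ j, dz j F * dzb j F - R F * Rb F

lemma MM_cmp (ψ : ℝ → ℝ) (hψ) {F : SF n} (hF : conj F = F) : MM (cmp ψ hψ F) =
    cmp (deriv (deriv ψ)) (ContDiff.deriv' (n := ((⊤ : ℕ∞) : WithTop ℕ∞))
      (ContDiff.deriv' (n := ((⊤ : ℕ∞) : WithTop ℕ∞)) hψ)) F * gr F +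
    cmp (deriv ψ) (ContDiff.deriv' (n := ((⊤ : ℕ∞) : WithTop ℕ∞)) hψ) F * MM F := by
  rw [MM_apply, MM_apply, Rb_cmp _ _ hF, R_mul, R_cmp _ _ hF, Lap_apply, Lap_apply]
  simp only [dzb_cmp _ _ _ hF, dz_mul, dz_cmp _ _ _ hF, Finset.sum_add_distrib, mul_assoc,
    ← Finset.mul_sum, gr]
  ring

/-- The holomorphic function `1 - ⟨z, a⟩`. -/
noncomputable def wa (a : En n) : SF n := 1 - ∑ j, (starRingEnd ℂ) (a j) • X j

lemma wa_val (a z : En n) : wa a z = 1 - inner ℂ a z := by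
  simp [wa, X_val, PiLp.inner_apply, mul_comm]

lemma dz_wa (j : Fin n) (a : En n) : dz j (wa a) = algebraMap ℂ (SF n) (-(starRingEnd ℂ) (a j)) := by
  simp [wa, dz_X, Algebra.algebraMap_eq_smul_one]

lemma dzb_wa (j : Fin n) (a : En n) : dzb j (wa a) = 0 := by
  simp [wa, dzb_X]

lemma dz_wab (j : Fin n) (a : En n) : dz j (conj (wa a)) = 0 := by
  rw [dz_conj, dzb_wa]; exact ext_val fun z => by simp

lemma dzb_wab (j : Fin n) (a : En n) : dzb j (conj (wa a)) = algebraMap ℂ (SF n) (-(a j)) := by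
  rw [dzb_conj, dz_wa]; exact ext_val fun z => by simp

lemma R_wa (a : En n) : R (wa a) = wa a - 1 := by
  refine ext_val fun z => ?_
  simp only [R_apply, dz_wa]
  simp [wa, X_val, mul_comm]

lemma R_wab (a : En n) : R (conj (wa a)) = 0 := by simp [R_apply, dz_wab]

/-- The function `|1 - ⟨z,a⟩|² / (1 - |z|²)`, cut off near the sphere. -/
noncomputable def geo (a : En n) (k : ℕ) : SF n := wa a * conj (wa a) * W (pw (-1) k)

lemma isOpen_cut (k : ℕ) : IsOpen {z : En n | 2 < 2 ^ k * (1 - ‖z‖ ^ 2)} :=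
  isOpen_lt (by fun_prop) (by fun_prop)

lemma W_der_pw {k : ℕ} {z : En n} (hz : 2 < 2 ^ k * (1 - ‖z‖ ^ 2)) (α : ℝ) :
    (W (pw α k).der : SF n) z = α * W (pw (α - 1) k) z := by
  have hx : 0 < 1 - ‖z‖ ^ 2 := pos_of_cut (by linarith : 1 ≤ 2 ^ k * (1 - ‖z‖ ^ 2))
  have h : (pw α k : ℝ → ℝ) =ᶠ[nhds (1 - ‖z‖ ^ 2)] fun x => x ^ α := by
    have : IsOpen {x : ℝ | 2 < 2 ^ k * x} := isOpen_lt (by fun_prop) (by fun_prop)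
    filter_upwards [this.mem_nhds hz] with y hy using pw_one (le_of_lt hy)
  rw [W_val, W_val, der_val, h.deriv_eq, pw_one hz.le, Real.deriv_rpow_const]
  push_cast; ring

lemma dz_inv {k : ℕ} {z : En n} (hz : 2 < 2 ^ k * (1 - ‖z‖ ^ 2)) (j : Fin n) :
    dz j (W (pw (-1) k)) z = (W (pw (-1) k) * W (pw (-1) k) * Xb j : SF n) z := by
  have hx : 0 < 1 - ‖z‖ ^ 2 := pos_of_cut (by linarith : 1 ≤ 2 ^ k * (1 - ‖z‖ ^ 2))
  rw [dz_W, mul_val, neg_val, W_der_pw hz, mul_val, mul_val, W_val, W_val, pw_one hz.le, pw_one hz.le,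
    show (-1 : ℝ) - 1 = -1 + -1 by ring, Real.rpow_add hx]
  push_cast; ring

lemma dzb_inv {k : ℕ} {z : En n} (hz : 2 < 2 ^ k * (1 - ‖z‖ ^ 2)) (j : Fin n) :
    dzb j (W (pw (-1) k)) z = (W (pw (-1) k) * W (pw (-1) k) * X j : SF n) z := by
  have hx : 0 < 1 - ‖z‖ ^ 2 := pos_of_cut (by linarith : 1 ≤ 2 ^ k * (1 - ‖z‖ ^ 2))
  rw [dzb_W, mul_val, neg_val, W_der_pw hz, mul_val, mul_val, W_val, W_val, pw_one hz.le, pw_one hz.le,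
    show (-1 : ℝ) - 1 = -1 + -1 by ring, Real.rpow_add hx]
  push_cast; ring

lemma geo_dz (a : En n) {k : ℕ} {z : En n} (hz : 2 < 2 ^ k * (1 - ‖z‖ ^ 2)) (j : Fin n) :
    dz j (geo a k) z = (conj (wa a) * W (pw (-1) k) * (algebraMap ℂ (SF n) (-(starRingEnd ℂ) (a j)) +
      wa a * W (pw (-1) k) * Xb j) : SF n) z := by
  rw [geo, dz_mul, dz_mul, dz_wa, dz_wab, add_val, mul_val (wa a * conj (wa a)), dz_inv hz]
  simp only [mul_val, add_val, zero_val, mul_zero]; ring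

lemma geo_dzb (a : En n) {k : ℕ} {z : En n} (hz : 2 < 2 ^ k * (1 - ‖z‖ ^ 2)) (j : Fin n) :
    dzb j (geo a k) z = (wa a * W (pw (-1) k) * (algebraMap ℂ (SF n) (-(a j)) +
      conj (wa a) * W (pw (-1) k) * X j) : SF n) z := by
  rw [geo, dzb_mul, dzb_mul, dzb_wa, dzb_wab, add_val, mul_val (wa a * conj (wa a)), dzb_inv hz]
  simp only [mul_val, add_val, zero_val, zero_mul]; ring

lemma sum_norm (a : En n) : ∑ j, a j * (starRingEnd ℂ) (a j) = ((‖a‖ ^ 2 : ℝ) : ℂ) := by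
  rw [← tt_val]; simp [tt, Xb, X_val]

lemma sum_wa (a z : En n) : ∑ j, z j * (starRingEnd ℂ) (a j) = 1 - wa a z := by
  simp [wa, X_val, mul_comm]

lemma sum_wab (a z : En n) : ∑ j, a j * (starRingEnd ℂ) (z j) = 1 - (starRingEnd ℂ) (wa a z) := by
  have := congrArg (starRingEnd ℂ) (sum_wa a z)
  simpa [mul_comm] using this

lemma inv_rel {k : ℕ} {z : En n} (hz : 2 < 2 ^ k * (1 - ‖z‖ ^ 2)) :
    (W (pw (-1) k) : SF n) z * (1 - (tt : SF n) z) = 1 := by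
  have hx : 0 < 1 - ‖z‖ ^ 2 := pos_of_cut (by linarith : 1 ≤ 2 ^ k * (1 - ‖z‖ ^ 2))
  rw [W_val, pw_one hz.le, tt_val, Real.rpow_neg_one]
  have : ((1 - ‖z‖ ^ 2 : ℝ) : ℂ) ≠ 0 := by exact_mod_cast hx.ne'
  push_cast at *
  exact inv_mul_cancel₀ this

lemma gr_geo (a : En n) {k : ℕ} {z : En n} (hz : 2 < 2 ^ k * (1 - ‖z‖ ^ 2)) :
    (1 - (tt : SF n) z) * gr (geo a k) z = geo a k z * (geo a k z - ((1 - ‖a‖ ^ 2 : ℝ) : ℂ)) := by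
  have hv := inv_rel hz
  have hR : R (geo a k) z = ∑ j, z j * dz j (geo a k) z := by
    rw [R_apply, sum_val]; rfl
  have hRb : Rb (geo a k) z = ∑ j, (starRingEnd ℂ) (z j) * dzb j (geo a k) z := by
    rw [Rb_apply, sum_val]; rfl
  have ht : (tt : SF n) z = ∑ j, z j * (starRingEnd ℂ) (z j) := by simp [tt, Xb, X_val]
  rw [gr, sub_val, sum_val, mul_val, hR, hRb]
  simp only [mul_val, geo_dz a hz, geo_dzb a hz]
  simp only [mul_val, add_val, algebraMap_val, conj_val, X_val, Xb]
  have hg : geo a k z = wa a z * (starRingEnd ℂ) (wa a z) * (W (pw (-1) k) : SF n) z := rfl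
  rw [hg]
  set w := wa a z with hw
  set w' := (starRingEnd ℂ) w with hw'
  set v := (W (pw (-1) k) : SF n) z
  have e1 : ∑ j, (w' * v * (-(starRingEnd ℂ) (a j) + w * v * (starRingEnd ℂ) (z j))) *
      (w * v * (-(a j) + w' * v * z j)) = w * w' * v ^ 2 * (((‖a‖ ^ 2 : ℝ) : ℂ) - w * v * (1 - w')
        - w' * v * (1 - w) + w * w' * v ^ 2 * (tt : SF n) z) := by
    rw [← sum_norm, ← sum_wa, ← sum_wab, ht]
    simp only [mul_sub, mul_add, Finset.mul_sum, ← Finset.sum_sub_distrib, ← Finset.sum_add_distrib]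
    exact Finset.sum_congr rfl fun j _ => by ring
  have e2 : ∑ j, z j * (w' * v * (-(starRingEnd ℂ) (a j) + w * v * (starRingEnd ℂ) (z j))) =
      w' * v * (-(1 - w) + w * v * (tt : SF n) z) := by
    rw [← sum_wa, ht]
    simp only [mul_add, mul_neg, Finset.mul_sum, ← Finset.sum_neg_distrib, ← Finset.sum_add_distrib]
    exact Finset.sum_congr rfl fun j _ => by ring
  have e3 : ∑ j, (starRingEnd ℂ) (z j) * (w * v * (-(a j) + w' * v * z j)) =
      w * v * (-(1 - w') + w' * v * (tt : SF n) z) := by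
    rw [hw', hw, ← sum_wab, ht]
    simp only [mul_add, mul_neg, Finset.mul_sum, ← Finset.sum_neg_distrib, ← Finset.sum_add_distrib]
    exact Finset.sum_congr rfl fun j _ => by ring
  rw [e1, e2, e3]
  have hv0 : v ≠ 0 := left_ne_zero_of_mul_eq_one hv
  have ht2 : (tt : SF n) z = 1 - v⁻¹ := by
    field_simp; linear_combination -hv
  rw [ht2]; push_cast
  field_simp
  ring

lemma MM_geo (a : En n) {k : ℕ} {z : En n} (hz : 2 < 2 ^ k * (1 - ‖z‖ ^ 2)) :
    (1 - (tt : SF n) z) * MM (geo a k) z = (n + 1) * geo a k z - ((1 - ‖a‖ ^ 2 : ℝ) : ℂ) := by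
  have hv := inv_rel hz
  have hO := isOpen_cut (n := n) k
  have ht : (tt : SF n) z = ∑ j, z j * (starRingEnd ℂ) (z j) := by simp [tt, Xb, X_val]
  have hRW : R (W (pw (-1) k) : SF n) z = ((W (pw (-1) k) : SF n) z) ^ 2 * (tt : SF n) z := by
    rw [R_apply, sum_val, ht, Finset.mul_sum]
    refine Finset.sum_congr rfl fun j _ => ?_
    rw [mul_val, dz_inv hz]; simp only [mul_val, X_val, Xb, conj_val]; ring
  set v := (W (pw (-1) k) : SF n) z with hvdef
  set w := wa a z with hw
  have h1 : Lap (geo a k) z = ((‖a‖ ^ 2 : ℝ) : ℂ) * v - (starRingEnd ℂ) w * v ^ 2 * (1 - w) -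
      w * v ^ 2 * (1 - (starRingEnd ℂ) w) + 2 * w * (starRingEnd ℂ) w * v ^ 3 * (tt : SF n) z +
      n * (w * (starRingEnd ℂ) w * v ^ 2) := by
    have : ∀ j, dz j (dzb j (geo a k)) z = a j * (starRingEnd ℂ) (a j) * v -
        (starRingEnd ℂ) w * v ^ 2 * (z j * (starRingEnd ℂ) (a j)) -
        w * v ^ 2 * (a j * (starRingEnd ℂ) (z j)) +
        2 * w * (starRingEnd ℂ) w * v ^ 3 * (z j * (starRingEnd ℂ) (z j)) +
        w * (starRingEnd ℂ) w * v ^ 2 := fun j => by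
      rw [dz_congr hO (fun y hy => geo_dzb a hy j) j z hz]
      simp only [dz_mul, map_add, dz_wa, dz_wab, dz_X, if_true, add_val, mul_val, dz_inv hz,
        Derivation.map_algebraMap, zero_val, algebraMap_val, one_val, conj_val, X_val, Xb,
        ← hw, ← hvdef]
      ring
    rw [Lap_apply, sum_val, Finset.sum_congr rfl fun j _ => this j]
    simp only [Finset.sum_add_distrib, Finset.sum_sub_distrib, ← Finset.mul_sum, ← Finset.sum_mul]
    rw [sum_norm, sum_wa, sum_wab, ← ht]
    simp [← hw]; ring
  have h2 : ∀ y ∈ {z : En n | 2 < 2 ^ k * (1 - ‖z‖ ^ 2)}, Rb (geo a k) y =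
      (wa a * W (pw (-1) k) * (conj (wa a) - 1 + conj (wa a) * W (pw (-1) k) * tt) : SF n) y := fun y hy => by
    rw [Rb_apply, sum_val]
    simp only [mul_val]
    rw [Finset.sum_congr rfl fun j _ => by rw [geo_dzb a hy j]]
    simp only [mul_val, add_val, sub_val, one_val, algebraMap_val, conj_val, X_val, Xb, tt, sum_val]
    rw [show (starRingEnd ℂ) (wa a y) - 1 = -(1 - (starRingEnd ℂ) (wa a y)) by ring, ← sum_wab]
    simp only [mul_add, mul_neg, Finset.mul_sum, ← Finset.sum_neg_distrib, ← Finset.sum_add_distrib]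
    exact Finset.sum_congr rfl fun j _ => by ring
  have h3 : R (Rb (geo a k)) z = (w - 1) * v * ((starRingEnd ℂ) w - 1 + (starRingEnd ℂ) w * v * (tt : SF n) z) +
      w * (v ^ 2 * (tt : SF n) z) * ((starRingEnd ℂ) w - 1 + (starRingEnd ℂ) w * v * (tt : SF n) z) +
      w * v * ((starRingEnd ℂ) w * (v ^ 2 * (tt : SF n) z) * (tt : SF n) z + (starRingEnd ℂ) w * v * (tt : SF n) z) := by
    have : R (Rb (geo a k)) z = R (wa a * W (pw (-1) k) *
        (conj (wa a) - 1 + conj (wa a) * W (pw (-1) k) * tt) : SF n) z := by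
      simp only [R_apply, sum_val, mul_val]
      exact Finset.sum_congr rfl fun j _ => by rw [dz_congr hO h2 j z hz]
    rw [this]
    simp only [R_mul, map_add, map_sub, Derivation.map_one_eq_zero, R_wa, R_wab, R_tt, add_val, mul_val,
      sub_val, one_val, zero_val, hRW, conj_val, ← hw, ← hvdef]
    ring
  have hg : geo a k z = w * (starRingEnd ℂ) w * v := rfl
  rw [MM_apply, sub_val, h1, h3, hg]
  have hv0 : v ≠ 0 := left_ne_zero_of_mul_eq_one hv
  have ht2 : (tt : SF n) z = 1 - v⁻¹ := by
    field_simp; linear_combination -hv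
  rw [ht2]; push_cast
  field_simp
  ring

end SF

lemma fderiv_wd_comm {n : ℕ} {F : En n → ℂ} (hF : ContDiff ℝ 2 F) (j k : Fin n) (z : En n) :
    wdb n k (wd n j F) z = wd n j (wdb n k F) z := by
  have hs := (hF.contDiffAt (x := z)).isSymmSndFDerivAt (by simp)
  have hd : DifferentiableAt ℝ (fderiv ℝ F) z :=
    ((hF.fderiv_right (m := 1) (by norm_num)).differentiable (by simp)) z
  have hd' : ∀ v, HasFDerivAt (fun z => fderiv ℝ F z v)
      ((ContinuousLinearMap.apply ℝ ℂ v).comp (fderiv ℝ (fderiv ℝ F) z)) z := fun v =>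
    ((ContinuousLinearMap.apply ℝ ℂ v).hasFDerivAt.comp z hd.hasFDerivAt)
  have h1 : HasFDerivAt (wd n j F) _ z :=
    ((hd' (EuclideanSpace.single j 1)).sub ((hd' (EuclideanSpace.single j Complex.I)).const_mul Complex.I)).const_mul (1 / 2 : ℂ)
  have h2 : HasFDerivAt (wdb n k F) _ z :=
    ((hd' (EuclideanSpace.single k 1)).add ((hd' (EuclideanSpace.single k Complex.I)).const_mul Complex.I)).const_mul (1 / 2 : ℂ)
  rw [wd, wdb, h1.fderiv, h2.fderiv]
  simp
  rw [hs.eq (EuclideanSpace.single j 1) (EuclideanSpace.single k 1),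
    hs.eq (EuclideanSpace.single j 1) (EuclideanSpace.single k Complex.I),
    hs.eq (EuclideanSpace.single j Complex.I) (EuclideanSpace.single k 1),
    hs.eq (EuclideanSpace.single j Complex.I) (EuclideanSpace.single k Complex.I)]
  ring

lemma contDiff_wd {n : ℕ} {F : En n → ℂ} (hF : ContDiff ℝ 2 F) (j : Fin n) :
    ContDiff ℝ 1 (wd n j F) := by
  have h : ∀ v, ContDiff ℝ 1 (fun z => fderiv ℝ F z v) := fun v =>
    (hF.fderiv_right (m := 1) (by norm_num)).clm_apply contDiff_const
  exact contDiff_const.mul ((h _).sub (contDiff_const.mul (h _)))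

namespace SF
variable {n : ℕ}
open Wt

lemma wd_mul (S : SF n) {F : En n → ℂ} {z : En n} (hF : DifferentiableAt ℝ F z) (j : Fin n) :
    wd n j (fun z => S z * F z) z = dz j S z * F z + S z * wd n j F z := by
  have h := (S.differentiableAt z).hasFDerivAt.mul hF.hasFDerivAt
  rw [dz_val]
  simp only [wd]
  rw [show (fun z => S z * F z) = (S : En n → ℂ) * F from rfl, h.fderiv]
  simp; ring

lemma wdb_mul (S : SF n) {F : En n → ℂ} {z : En n} (hF : DifferentiableAt ℝ F z) (j : Fin n) :
    wdb n j (fun z => S z * F z) z = dzb j S z * F z + S z * wdb n j F z := by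
  have h := (S.differentiableAt z).hasFDerivAt.mul hF.hasFDerivAt
  rw [dzb_val]
  simp only [wdb]
  rw [show (fun z => S z * F z) = (S : En n → ℂ) * F from rfl, h.fderiv]
  simp; ring

/-- Coefficients of the invariant Laplacian in divergence form. -/
noncomputable def cf (q : Wt) (j k : Fin n) : SF n := W q * ((if j = k then 1 else 0) - X j * Xb k)

lemma sum_dz_cf (q : Wt) (k : Fin n) : ∑ j, dz j (cf q j k) = -(W q.der.xm + (n : SF n) * W q) * Xb k := by
  have : ∀ j, dz j (cf q j k) = -(W q.der) * ((if j = k then Xb j else 0) - X j * Xb j * Xb k)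
      - W q * Xb k := fun j => by
    rw [cf, dz_mul, dz_W, map_sub, dz_mul, dz_X, dz_Xb']
    simp only [if_true]
    split_ifs <;> simp <;> ring
  rw [Finset.sum_congr rfl fun j _ => this j]
  rw [Finset.sum_sub_distrib, ← Finset.mul_sum, Finset.sum_sub_distrib, ← Finset.sum_mul, W_xm]
  simp [tt]; ring

lemma sum_dzb_cf (q : Wt) (j : Fin n) : ∑ k, dzb k (cf q j k) = -(W q.der.xm + (n : SF n) * W q) * X j := by
  have : ∀ k, dzb k (cf q j k) = -(W q.der) * ((if j = k then X k else 0) - X k * Xb k * X j)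
      - W q * X j := fun k => by
    rw [cf, dzb_mul, dzb_W, map_sub, dzb_mul, dzb_X, dzb_Xb']
    simp only [if_true]
    split_ifs <;> simp <;> ring
  rw [Finset.sum_congr rfl fun j _ => this j]
  rw [Finset.sum_sub_distrib, ← Finset.mul_sum, Finset.sum_sub_distrib, ← Finset.sum_mul, W_xm]
  simp [tt]; ring

lemma sum_cf (q : Wt) (G : SF n) : ∑ j, ∑ k, cf q j k * dz j (dzb k G) = W q * MM G := by
  refine ext_val fun z => ?_
  rw [mul_val, MM_val, sum_val, Finset.mul_sum]
  refine Finset.sum_congr rfl fun j _ => ?_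
  rw [sum_val, Finset.mul_sum]
  refine Finset.sum_congr rfl fun k _ => ?_
  simp only [cf, mul_val, sub_val, X_val, Xb, conj_val, dz_val, coe_dzb]
  split_ifs <;> simp <;> ring

lemma green {k : ℕ} {F : En n → ℂ} (hF : ContDiff ℝ 2 F)
    (hM : ∀ z, 1 < 2 ^ k * (1 - ‖z‖ ^ 2) → ∑ j : Fin n, ∑ k : Fin n,
      ((if j = k then 1 else 0) - z j * (starRingEnd ℂ) (z k)) * wd n j (wdb n k F) z = 0)
    {G : SF n} (hG : ∀ z, 2 ^ k * (1 - ‖z‖ ^ 2) ≤ 2 → G z = 0) :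
    ∫ z, (W (pw (-n) (k + 1)) * MM G : SF n) z * F z = 0 := by
  set q := pw (-n) (k + 1) with hq
  have hFd : ∀ z, DifferentiableAt ℝ F z := fun z => hF.differentiable (by simp) z
  have hc : HasCompactSupport (W q : En n → ℂ) := hcs_W q
  have hcf : ∀ (j l : Fin n) (S : SF n) (H : En n → ℂ),
      HasCompactSupport (fun z => (cf q j l * S : SF n) z * H z) := fun j l S H => by
    refine hc.mono fun z hz => ?_
    rw [Function.mem_support] at hz ⊢
    contrapose! hz
    simp [cf, hz]
  have hA : ∀ j l, ContDiff ℝ 1 (fun z => (cf q j l * dzb l G : SF n) z * F z) := fun j l =>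
    ((cf q j l * dzb l G).contDiff.of_le (WithTop.coe_le_coe.2 le_top)).mul (hF.of_le (by norm_num))
  have hB : ∀ j l, ContDiff ℝ 1 (fun z => (cf q j l * G : SF n) z * wd n j F z) := fun j l =>
    ((cf q j l * G).contDiff.of_le (WithTop.coe_le_coe.2 le_top)).mul (contDiff_wd hF j)
  have IA := fun j l => integral_wd_eq_zero (hA j l) (hcf j l _ _) j
  have IB := fun j l => integral_wdb_eq_zero (hB j l) (hcf j l _ _) l
  have int_fderiv : ∀ {H : En n → ℂ}, ContDiff ℝ 1 H → HasCompactSupport H → ∀ v,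
      Integrable (fun z => fderiv ℝ H z v) := fun hH hHc v =>
    ((hH.continuous_fderiv (by simp)).clm_apply continuous_const).integrable_of_hasCompactSupport
      (hHc.fderiv_apply (𝕜 := ℝ) v)
  have JA : ∀ j l, Integrable (wd n j (fun z => (cf q j l * dzb l G : SF n) z * F z)) := fun j l =>
    ((int_fderiv (hA j l) (hcf _ _ _ _) _).sub ((int_fderiv (hA j l) (hcf _ _ _ _) _).const_mul _)).const_mul _
  have JB : ∀ j l, Integrable (wdb n l (fun z => (cf q j l * G : SF n) z * wd n j F z)) := fun j l =>
    ((int_fderiv (hB j l) (hcf _ _ _ _) _).add ((int_fderiv (hB j l) (hcf _ _ _ _) _).const_mul _)).const_mul _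
  have key : ∀ z, (W q * MM G : SF n) z * F z =
      ∑ j, ∑ l, (wd n j (fun z => (cf q j l * dzb l G : SF n) z * F z) z -
        wdb n l (fun z => (cf q j l * G : SF n) z * wd n j F z) z) := fun z => by
    have e : ∀ j l, wd n j (fun z => (cf q j l * dzb l G : SF n) z * F z) z -
        wdb n l (fun z => (cf q j l * G : SF n) z * wd n j F z) z =
        dz j (cf q j l * dzb l G) z * F z + cf q j l z * dzb l G z * wd n j F z -
        (dzb l (cf q j l * G) z * wd n j F z + cf q j l z * G z * wd n j (wdb n l F) z) := fun j l => by
      rw [wd_mul _ (hFd z), wdb_mul _ ((contDiff_wd hF j).differentiable (by simp) z),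
        fderiv_wd_comm hF]; rfl
    simp only [e]
    rcases lt_or_ge (2 ^ k * (1 - ‖z‖ ^ 2)) 2 with hz | hz
    · have hO : IsOpen {z : En n | 2 ^ k * (1 - ‖z‖ ^ 2) < 2} := isOpen_lt (by fun_prop) (by fun_prop)
      have g0 : ∀ y ∈ {z : En n | 2 ^ k * (1 - ‖z‖ ^ 2) < 2}, G y = (0 : SF n) y :=
        fun y hy => hG y (le_of_lt hy)
      have g1 : ∀ l, ∀ y ∈ {z : En n | 2 ^ k * (1 - ‖z‖ ^ 2) < 2}, dzb l G y = (0 : SF n) y :=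
        fun l y hy => by rw [dzb_congr hO g0 l y hy, map_zero]
      have g2 : ∀ j l, dz j (dzb l G) z = 0 := fun j l => by
        rw [dz_congr hO (g1 l) j z hz, map_zero]; rfl
      have gz : G z = 0 := g0 z hz
      have gz1 : ∀ l, dzb l G z = 0 := fun l => g1 l z hz
      rw [← sum_cf]
      simp [g2, gz, gz1]
    · have hx : 2 < 2 ^ (k + 1) * (1 - ‖z‖ ^ 2) := by rw [pow_succ]; linarith
      have hder : (W q.der.xm + (n : SF n) * W q : SF n) z = 0 := by
        have hx0 : 0 < 1 - ‖z‖ ^ 2 := pos_of_cut (by linarith : 1 ≤ 2 ^ k * (1 - ‖z‖ ^ 2))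
        rw [W_xm, add_val, mul_val, mul_val, W_der_pw hx, W_val, W_val, pw_one hx.le, pw_one hx.le,
          Real.rpow_sub_one hx0.ne']
        simp [tt_val]
        have : (1 : ℂ) - ‖z‖ ^ 2 ≠ 0 := by exact_mod_cast hx0.ne'
        field_simp
        ring
      have c1 : ∀ l, ∑ j, dz j (cf q j l) z = 0 := fun l => by
        rw [← sum_val, sum_dz_cf, mul_val, neg_val, hder]; simp
      have c2 : ∀ j, ∑ l, dzb l (cf q j l) z = 0 := fun l => by
        rw [← sum_val, sum_dzb_cf, mul_val, neg_val, hder]; simp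
      have c3 : ∑ j, ∑ l, cf q j l z * wd n j (wdb n l F) z = 0 := by
        have := congrArg (fun t => (W q : SF n) z * t) (hM z (by linarith))
        simp only [mul_zero, Finset.mul_sum] at this
        rw [← this]
        refine Finset.sum_congr rfl fun j _ => Finset.sum_congr rfl fun l _ => ?_
        simp only [cf, mul_val, sub_val, X_val, Xb, conj_val]
        split_ifs <;> simp <;> ring
      have c4 : (W q * MM G : SF n) z = ∑ j, ∑ l, cf q j l z * dz j (dzb l G) z := by
        rw [← sum_cf]; simp
      have s1 : ∑ j, ∑ l, dz j (cf q j l) z * dzb l G z * F z = 0 := by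
        rw [Finset.sum_comm]
        simp only [← Finset.sum_mul, c1, zero_mul, Finset.sum_const_zero]
      have s2 : ∑ j, ∑ l, dzb l (cf q j l) z * G z * wd n j F z = 0 := by
        simp only [← Finset.sum_mul, c2, zero_mul, Finset.sum_const_zero]
      have s3 : ∑ j, ∑ l, cf q j l z * G z * wd n j (wdb n l F) z = 0 := by
        have := congrArg (fun t => G z * t) c3
        simp only [mul_zero, Finset.mul_sum] at this
        rw [← this]
        exact Finset.sum_congr rfl fun j _ => Finset.sum_congr rfl fun l _ => by ring
      rw [c4, Finset.sum_mul]
      have : ∀ j l, dz j (cf q j l * dzb l G) z * F z + cf q j l z * dzb l G z * wd n j F z -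
        (dzb l (cf q j l * G) z * wd n j F z + cf q j l z * G z * wd n j (wdb n l F) z) =
        cf q j l z * dz j (dzb l G) z * F z + dz j (cf q j l) z * dzb l G z * F z -
          dzb l (cf q j l) z * G z * wd n j F z - cf q j l z * G z * wd n j (wdb n l F) z := fun j l => by
        simp only [dz_mul, dzb_mul, add_val, mul_val]; ring
      simp only [this, Finset.sum_sub_distrib, Finset.sum_add_distrib, s1, s2, s3, Finset.sum_mul]
      ring
  simp only [key]
  have JS : ∀ j l, Integrable (fun z => wd n j (fun z => (cf q j l * dzb l G : SF n) z * F z) z -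
        wdb n l (fun z => (cf q j l * G : SF n) z * wd n j F z) z) := fun j l => (JA j l).sub (JB j l)
  rw [integral_finsetSum _ fun j _ => integrable_finsetSum _ fun l _ => JS j l]
  refine Finset.sum_eq_zero fun j _ => ?_
  rw [integral_finsetSum _ fun l _ => JS j l]
  refine Finset.sum_eq_zero fun l _ => ?_
  rw [integral_sub (JA j l) (JB j l), IA, IB, sub_zero]

end SF

/-- A smooth transition from `0` for `y ≤ ε` to `1` for `2 * ε ≤ y`. -/
noncomputable def trn (ε y : ℝ) : ℝ := Real.smoothTransition (y / ε - 1)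

lemma contDiff_trn (ε : ℝ) : ContDiff ℝ ((⊤ : ℕ∞) : WithTop ℕ∞) (trn ε) :=
  Real.smoothTransition.contDiff.comp (by fun_prop)

lemma trn_zero {ε y : ℝ} (hε : 0 < ε) (hy : y ≤ ε) : trn ε y = 0 :=
  Real.smoothTransition.zero_of_nonpos (by linarith [(div_le_one hε).2 hy])

lemma trn_one {ε y : ℝ} (hε : 0 < ε) (hy : 2 * ε ≤ y) : trn ε y = 1 :=
  Real.smoothTransition.one_of_one_le (by linarith [(le_div_iff₀ hε).2 hy])

lemma deriv_trn_nonneg {ε : ℝ} (hε : 0 < ε) (y : ℝ) : 0 ≤ deriv (trn ε) y := by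
  have : Monotone (trn ε) := fun a b hab => Real.smoothTransition.monotone (by gcongr)
  exact this.deriv_nonneg

lemma deriv_trn_zero {ε y : ℝ} (hε : 0 < ε) (hy : y ≤ ε ∨ 2 * ε ≤ y) : deriv (trn ε) y = 0 := by
  rcases hy with hy | hy
  · refine IsLocalMin.deriv_eq_zero (Filter.Eventually.of_forall fun x => ?_)
    rw [trn_zero hε hy]; exact Real.smoothTransition.nonneg _
  · refine IsLocalMax.deriv_eq_zero (Filter.Eventually.of_forall fun x => ?_)
    rw [trn_one hε hy]; exact Real.smoothTransition.le_one _

lemma deriv_trn_scale {ε : ℝ} (y : ℝ) : deriv (trn ε) y = ε⁻¹ * deriv (trn 1) (y / ε) := by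
  have h1 : HasDerivAt (trn 1) (deriv (trn 1) (y / ε)) (y / ε) :=
    ((contDiff_trn 1).differentiable (by simp) _).hasDerivAt
  have h2 : HasDerivAt (fun y : ℝ => y / ε) (1 / ε) y := (hasDerivAt_id y).div_const ε
  have h3 := (h1.comp y h2).deriv
  have : trn 1 ∘ (fun y => y / ε) = trn ε := by funext y; simp [trn]
  rw [this] at h3
  rw [h3]; ring

lemma exists_deriv_trn_pos : ∃ y : ℝ, 1 < y ∧ 0 < deriv (trn 1) y := by
  by_contra! h
  have hd : Differentiable ℝ (trn 1) := (contDiff_trn 1).differentiable (by simp)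
  have h0 : ∀ y, deriv (trn 1) y = 0 := fun y => by
    rcases le_or_gt y 1 with hy | hy
    · exact deriv_trn_zero one_pos (Or.inl hy)
    · exact le_antisymm (h y hy) (deriv_trn_nonneg one_pos y)
  have := is_const_of_deriv_eq_zero hd h0 1 2
  rw [trn_zero one_pos le_rfl, trn_one one_pos (by norm_num)] at this
  exact zero_ne_one this

lemma contDiff_mul_of_zero {H g : ℝ → ℝ} {ε : ℝ} (hε : 0 < ε)
    (hH : ContDiff ℝ ((⊤ : ℕ∞) : WithTop ℕ∞) H) (h0 : ∀ y ≤ ε, H y = 0)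
    (hg : ∀ y > 0, ContDiffAt ℝ ((⊤ : ℕ∞) : WithTop ℕ∞) g y) :
    ContDiff ℝ ((⊤ : ℕ∞) : WithTop ℕ∞) (fun y => H y * g y) := by
  refine contDiff_iff_contDiffAt.2 fun y => ?_
  rcases lt_or_ge y ε with hy | hy
  · refine (contDiffAt_const (c := (0 : ℝ))).congr_of_eventuallyEq ?_
    filter_upwards [Iio_mem_nhds hy] with x hx
    rw [h0 x (le_of_lt hx), zero_mul]
  · exact hH.contDiffAt.mul (hg y (hε.trans_le hy))

/-- The radial profile of the averaging kernel. -/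
noncomputable def kap (n : ℕ) (ε y : ℝ) : ℝ := deriv (trn ε) y * (y ^ (n - 1))⁻¹

lemma contDiff_kap (n : ℕ) {ε : ℝ} (hε : 0 < ε) : ContDiff ℝ ((⊤ : ℕ∞) : WithTop ℕ∞) (kap n ε) :=
  contDiff_mul_of_zero hε (ContDiff.deriv' (n := ((⊤ : ℕ∞) : WithTop ℕ∞)) (contDiff_trn ε))
    (fun _ hy => deriv_trn_zero hε (Or.inl hy))
    (fun _ hy => (contDiffAt_id.pow _).inv (pow_pos hy _).ne')

lemma kap_nonneg (n : ℕ) {ε : ℝ} (hε : 0 < ε) (y : ℝ) : 0 ≤ kap n ε y := by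
  rcases le_or_gt y 0 with hy | hy
  · rw [kap, deriv_trn_zero hε (Or.inl (hy.trans hε.le)), zero_mul]
  · exact mul_nonneg (deriv_trn_nonneg hε y) (by positivity)

lemma kap_zero (n : ℕ) {ε y : ℝ} (hε : 0 < ε) (hy : 2 * ε ≤ y) : kap n ε y = 0 := by
  rw [kap, deriv_trn_zero hε (Or.inr hy), zero_mul]

/-- Primitive data for the radial test functions. -/
noncomputable def prf (n : ℕ) (ε y : ℝ) : ℝ := (trn ε y - trn 1 y) * (y ^ n * (1 + y))⁻¹

lemma contDiff_prf (n : ℕ) {ε : ℝ} (hε : 0 < ε) (hε1 : ε ≤ 1) :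
    ContDiff ℝ ((⊤ : ℕ∞) : WithTop ℕ∞) (prf n ε) :=
  contDiff_mul_of_zero hε ((contDiff_trn ε).sub (contDiff_trn 1))
    (fun _ hy => by rw [trn_zero hε hy, trn_zero one_pos (hy.trans hε1), sub_zero])
    (fun y hy => ((contDiffAt_id.pow _).mul (contDiffAt_const.add contDiffAt_id)).inv
      (by have : 0 < y ^ n * (1 + y) := by positivity
          exact this.ne'))

lemma prf_ode {n : ℕ} (hn : 1 ≤ n) {ε : ℝ} (hε : 0 < ε) (hε1 : ε ≤ 1) (y : ℝ) :
    y * (1 + y) * deriv (prf n ε) y + (n + (n + 1) * y) * prf n ε y = kap n ε y - kap n 1 y := by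
  rcases lt_or_ge y ε with hy | hy
  · have h0 : prf n ε =ᶠ[nhds y] fun _ => 0 := by
      filter_upwards [Iio_mem_nhds hy] with x hx
      rw [prf, trn_zero hε (le_of_lt hx), trn_zero one_pos ((le_of_lt hx).trans hε1), sub_zero, zero_mul]
    rw [h0.deriv_eq, h0.eq_of_nhds, kap, kap, deriv_trn_zero hε (Or.inl hy.le),
      deriv_trn_zero one_pos (Or.inl (hy.le.trans hε1))]
    simp
  · have hy0 : 0 < y := hε.trans_le hy
    have d1 : HasDerivAt (fun y => trn ε y - trn 1 y) (deriv (trn ε) y - deriv (trn 1) y) y :=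
      ((contDiff_trn ε).differentiable (by simp) y).hasDerivAt.sub
        ((contDiff_trn 1).differentiable (by simp) y).hasDerivAt
    have d2 : HasDerivAt (fun y : ℝ => y ^ n * (1 + y)) (n * y ^ (n - 1) * (1 + y) + y ^ n) y := by
      have := (hasDerivAt_pow n y).mul ((hasDerivAt_id y).const_add 1)
      exact this.congr_deriv (by simp)
    have hne : y ^ n * (1 + y) ≠ 0 := by positivity
    have d3 := (d1.mul (d2.inv hne)).deriv
    have d3' : deriv (prf n ε) y = _ := d3
    rw [d3', prf, kap, kap]
    obtain ⟨m, rfl⟩ : ∃ m, n = m + 1 := ⟨n - 1, by omega⟩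
    simp only [Nat.add_sub_cancel, Pi.inv_apply]
    field_simp
    push_cast
    ring

/-- The radial test function. -/
noncomputable def pri (n : ℕ) (ε y : ℝ) : ℝ := ∫ t in (2 : ℝ)..y, prf n ε t

lemma deriv_pri (n : ℕ) {ε : ℝ} (hε : 0 < ε) (hε1 : ε ≤ 1) : deriv (pri n ε) = prf n ε := by
  funext y
  have hc := (contDiff_prf n hε hε1).continuous
  exact (intervalIntegral.integral_hasDerivAt_right (hc.intervalIntegrable _ _)
    (hc.stronglyMeasurableAtFilter _ _) hc.continuousAt).deriv

lemma contDiff_pri (n : ℕ) {ε : ℝ} (hε : 0 < ε) (hε1 : ε ≤ 1) :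
    ContDiff ℝ ((⊤ : ℕ∞) : WithTop ℕ∞) (pri n ε) := by
  refine contDiff_infty_iff_deriv.2 ⟨fun y => ?_, ?_⟩
  · have hc := (contDiff_prf n hε hε1).continuous
    exact (intervalIntegral.integral_hasDerivAt_right (hc.intervalIntegrable _ _)
      (hc.stronglyMeasurableAtFilter _ _) hc.continuousAt).differentiableAt
  · rw [deriv_pri n hε hε1]; exact contDiff_prf n hε hε1

lemma pri_zero (n : ℕ) {ε y : ℝ} (hε : 0 < ε) (hε1 : ε ≤ 1) (hy : 2 ≤ y) : pri n ε y = 0 := by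
  refine intervalIntegral.integral_zero_ae (Filter.Eventually.of_forall fun t ht => ?_)
  rw [Set.uIoc_of_le hy] at ht
  rw [prf, trn_one hε (by linarith [ht.1]), trn_one one_pos (by linarith [ht.1]), sub_self, zero_mul]

namespace SF
variable {n : ℕ}
open Wt

lemma MM_congr {F G : SF n} {U : Set (En n)} (hU : IsOpen U) (h : ∀ z ∈ U, F z = G z) :
    ∀ z ∈ U, MM F z = MM G z := by
  intro z hz
  rw [MM_val, MM_val]
  refine Finset.sum_congr rfl fun j _ => Finset.sum_congr rfl fun k _ => ?_
  rw [← coe_dzb, ← dz_val, ← coe_dzb, ← dz_val, dz_congr hU (dzb_congr hU h k) j z hz]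

/-- The real point-pair function `|1 - ⟨z,a⟩|² / ((1 - |a|²)(1 - |z|²)) - 1`, cut off near the sphere. -/
noncomputable def ppf (k : ℕ) (a z : En n) : ℝ :=
  (1 - ‖a‖ ^ 2)⁻¹ * (‖1 - inner ℂ a z‖ ^ 2 * pw (-1) k (1 - ‖z‖ ^ 2)) - 1

/-- `ppf` as a smooth function of `z`. -/
noncomputable def geoY (a : En n) (k : ℕ) : SF n := (((1 - ‖a‖ ^ 2)⁻¹ : ℝ) : ℂ) • geo a k - 1

lemma geoY_val (a z : En n) (k : ℕ) : geoY a k z = (ppf k a z : ℂ) := by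
  simp only [geoY, sub_val, smul_val, geo, mul_val, conj_val, wa_val, W_val, one_val, ppf,
    Complex.mul_conj, Complex.normSq_eq_norm_sq]
  push_cast; ring

lemma conj_geoY (a : En n) (k : ℕ) : conj (geoY a k) = geoY a k :=
  ext_val fun z => by rw [conj_val, geoY_val, Complex.conj_ofReal]

lemma one_sub_sq_pos {a : En n} (ha : ‖a‖ < 1) : 0 < 1 - ‖a‖ ^ 2 := by
  nlinarith [norm_nonneg a]

lemma gr_geoY {a : En n} (ha : ‖a‖ < 1) {k : ℕ} {z : En n} (hz : 2 < 2 ^ k * (1 - ‖z‖ ^ 2)) :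
    (1 - (tt : SF n) z) * gr (geoY a k) z = geoY a k z * (1 + geoY a k z) := by
  have hA : ((1 - ‖a‖ ^ 2 : ℝ) : ℂ) ≠ 0 := by exact_mod_cast (one_sub_sq_pos ha).ne'
  have h : gr (geoY a k) z = (((1 - ‖a‖ ^ 2)⁻¹ : ℝ) : ℂ) ^ 2 * gr (geo a k) z := by
    have : gr (geoY a k) = (((1 - ‖a‖ ^ 2)⁻¹ : ℝ) : ℂ) ^ 2 • gr (geo a k) := by
      simp only [gr, geoY, map_sub, Derivation.map_smul, Derivation.map_one_eq_zero, sub_zero, smul_sub,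
        Finset.smul_sum]
      congr 1
      · exact Finset.sum_congr rfl fun j _ => by rw [smul_mul_smul_comm, ← sq]
      · rw [smul_mul_smul_comm, ← sq]
    rw [this]; rfl
  have h1 := gr_geo a hz
  have hY : geoY a k z = (((1 - ‖a‖ ^ 2)⁻¹ : ℝ) : ℂ) * geo a k z - 1 := rfl
  rw [h, hY, mul_left_comm, h1]
  rw [Complex.ofReal_inv]
  field_simp
  ring

lemma MM_geoY {a : En n} (ha : ‖a‖ < 1) {k : ℕ} {z : En n} (hz : 2 < 2 ^ k * (1 - ‖z‖ ^ 2)) :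
    (1 - (tt : SF n) z) * MM (geoY a k) z = n + (n + 1) * geoY a k z := by
  have hA : ((1 - ‖a‖ ^ 2 : ℝ) : ℂ) ≠ 0 := by exact_mod_cast (one_sub_sq_pos ha).ne'
  have h : MM (geoY a k) z = (((1 - ‖a‖ ^ 2)⁻¹ : ℝ) : ℂ) * MM (geo a k) z := by
    have : MM (1 : SF n) = 0 := by simp [MM_apply, Lap_apply]
    rw [geoY, map_sub, map_smul, this, sub_zero]; rfl
  have h1 := MM_geo a hz
  have hY : geoY a k z = (((1 - ‖a‖ ^ 2)⁻¹ : ℝ) : ℂ) * geo a k z - 1 := rfl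
  rw [h, hY, mul_left_comm, h1]
  rw [Complex.ofReal_inv]
  field_simp
  ring

lemma ppf_large {a z : En n} (ha : ‖a‖ < 1) {k : ℕ} (hk : 12 ≤ 2 ^ k * (1 - ‖a‖))
    (h1 : 1 < 2 ^ k * (1 - ‖z‖ ^ 2)) (h2 : 2 ^ k * (1 - ‖z‖ ^ 2) ≤ 2) : 2 ≤ ppf (k + 1) a z := by
  have hu : 0 < 1 - ‖z‖ ^ 2 := pos_of_cut h1.le
  have hA := one_sub_sq_pos ha
  have hz1 : ‖z‖ ≤ 1 := by nlinarith [norm_nonneg z]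
  have hw : 1 - ‖a‖ ≤ ‖1 - inner ℂ a z‖ := by
    have e1 : ‖(1 : ℂ)‖ - ‖inner ℂ a z‖ ≤ ‖1 - inner ℂ a z‖ := norm_sub_norm_le _ _
    have e2 : ‖inner ℂ a z‖ ≤ ‖a‖ * ‖z‖ := norm_inner_le_norm a z
    rw [norm_one] at e1
    nlinarith [norm_nonneg a]
  have hw2 : (1 - ‖a‖) ^ 2 ≤ ‖1 - inner ℂ a z‖ ^ 2 := by gcongr
  have hp : pw (-1) (k + 1) (1 - ‖z‖ ^ 2) = (1 - ‖z‖ ^ 2)⁻¹ := by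
    rw [pw_one (by rw [pow_succ]; linarith), Real.rpow_neg_one]
  rw [ppf, hp]
  have h3 : 3 * ((1 - ‖a‖ ^ 2) * (1 - ‖z‖ ^ 2)) ≤ ‖1 - inner ℂ a z‖ ^ 2 := by
    have e0 : 0 < 1 - ‖a‖ := by linarith
    have e1 : 1 - ‖a‖ ^ 2 ≤ 2 * (1 - ‖a‖) := by nlinarith [norm_nonneg a]
    have e2 : 12 * (1 - ‖z‖ ^ 2) ≤ 2 * (1 - ‖a‖) := by
      have := mul_le_mul_of_nonneg_right hk hu.le
      nlinarith
    have e3 : 3 * ((1 - ‖a‖ ^ 2) * (1 - ‖z‖ ^ 2)) ≤ 3 * (2 * (1 - ‖a‖) * (1 - ‖z‖ ^ 2)) := by gcongr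
    nlinarith
  have h4 : (1 - ‖a‖ ^ 2)⁻¹ * (‖1 - inner ℂ a z‖ ^ 2 * (1 - ‖z‖ ^ 2)⁻¹) =
      ‖1 - inner ℂ a z‖ ^ 2 / ((1 - ‖a‖ ^ 2) * (1 - ‖z‖ ^ 2)) := by field_simp
  rw [h4]
  have := (le_div_iff₀ (by positivity)).2 h3
  linarith

/-- The averaging kernel. -/
noncomputable def ker (ε : ℝ) (k : ℕ) (a z : En n) : ℝ :=
  kap n ε (ppf (k + 1) a z) * pw (-(n + 1)) k (1 - ‖z‖ ^ 2)

lemma green_ker (hn : 1 ≤ n) {ε : ℝ} (hε : 0 < ε) (hε1 : ε ≤ 1) {a : En n} (ha : ‖a‖ < 1) {k : ℕ}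
    (hk : 12 ≤ 2 ^ k * (1 - ‖a‖)) {F : En n → ℂ} (hF : ContDiff ℝ 2 F)
    (hM : ∀ z, 1 < 2 ^ k * (1 - ‖z‖ ^ 2) → ∑ j : Fin n, ∑ k : Fin n,
      ((if j = k then 1 else 0) - z j * (starRingEnd ℂ) (z k)) * wd n j (wdb n k F) z = 0) :
    ∫ z, ((ker ε k a z - ker 1 k a z : ℝ) : ℂ) * F z = 0 := by
  set Y := geoY a (k + 1) with hY
  have hG2 : ∀ z, (cmp (pri n ε) (contDiff_pri n hε hε1) Y * W (pw 0 k) : SF n) z =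
    ((pri n ε (ppf (k + 1) a z) * pw 0 k (1 - ‖z‖ ^ 2) : ℝ) : ℂ) := fun z => by
      rw [mul_val, cmp_val, hY, geoY_val, W_val, Complex.ofReal_re]; push_cast; rfl
  set G : SF n := cmp (pri n ε) (contDiff_pri n hε hε1) Y * W (pw 0 k) with hG
  have hG0 : ∀ z, 2 ^ k * (1 - ‖z‖ ^ 2) ≤ 2 → G z = 0 := fun z hz => by
    rw [hG2]
    rcases le_or_gt (2 ^ k * (1 - ‖z‖ ^ 2)) 1 with h | h
    · rw [pw_zero h]; simp
    · rw [pri_zero n hε hε1 (ppf_large ha hk h hz)]; simp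
  have hG1 : ∀ z ∈ {z : En n | 2 < 2 ^ (k + 1) * (1 - ‖z‖ ^ 2)},
      G z = cmp (pri n ε) (contDiff_pri n hε hε1) Y z := fun z hz => by
    have hz' : 1 < 2 ^ k * (1 - ‖z‖ ^ 2) := by
      have : 2 < 2 ^ (k + 1) * (1 - ‖z‖ ^ 2) := hz
      rw [pow_succ] at this; linarith
    rcases le_or_gt (2 ^ k * (1 - ‖z‖ ^ 2)) 2 with h | h
    · rw [hG0 z h, cmp_val, hY, geoY_val, Complex.ofReal_re, pri_zero n hε hε1 (ppf_large ha hk hz' h)]; simp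
    · rw [hG2, cmp_val, hY, geoY_val, Complex.ofReal_re, pw_one h.le, Real.rpow_zero, mul_one]
  rw [← green hF hM hG0]
  refine integral_congr_ae (Filter.Eventually.of_forall fun z => ?_)
  simp only
  congr 1
  rcases lt_or_ge (2 ^ k * (1 - ‖z‖ ^ 2)) 2 with hz | hz
  · have hO : IsOpen {z : En n | 2 ^ k * (1 - ‖z‖ ^ 2) < 2} := isOpen_lt (by fun_prop) (by fun_prop)
    have g0 : MM G z = 0 := by
      rw [MM_congr (G := 0) hO (fun y hy => hG0 y (le_of_lt hy)) z hz, map_zero]; rfl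
    rw [mul_val, g0, mul_zero, ker, ker]
    rcases le_or_gt (2 ^ k * (1 - ‖z‖ ^ 2)) 1 with h | h
    · rw [pw_zero h]; simp
    · have := ppf_large ha hk h hz.le
      rw [kap_zero n hε (by linarith), kap_zero n one_pos (by linarith)]; simp
  · have hz2 : 2 < 2 ^ (k + 1) * (1 - ‖z‖ ^ 2) := by rw [pow_succ]; linarith
    have hu : 0 < 1 - ‖z‖ ^ 2 := pos_of_cut (by linarith : 1 ≤ 2 ^ k * (1 - ‖z‖ ^ 2))
    have e0 := MM_congr (isOpen_cut (k + 1)) hG1 z hz2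
    have e1 := gr_geoY ha hz2
    have e2 := MM_geoY ha hz2
    rw [← hY] at e1 e2
    have hyv : Y z = (ppf (k + 1) a z : ℂ) := geoY_val a z (k + 1)
    have e3 := prf_ode hn hε hε1 (ppf (k + 1) a z)
    rw [mul_val, e0, MM_cmp _ _ (conj_geoY a (k + 1)), add_val, mul_val, mul_val, cmp_val, cmp_val, W_val,
      deriv_pri n hε hε1, ← hY, hyv, Complex.ofReal_re]
    rw [hyv] at e1 e2
    have ht : (1 - (tt : SF n) z) = ((1 - ‖z‖ ^ 2 : ℝ) : ℂ) := by rw [tt_val]; push_cast; ring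
    rw [ht] at e1 e2
    have hune : ((1 - ‖z‖ ^ 2 : ℝ) : ℂ) ≠ 0 := by exact_mod_cast hu.ne'
    rw [ker, ker, pw_one hz2.le, pw_one hz, ← sub_mul, ← e3, neg_add, Real.rpow_add hu, Real.rpow_neg_one]
    rw [← mul_right_inj' hune]
    generalize prf n ε (ppf (k + 1) a z) = p at *
    generalize deriv (prf n ε) (ppf (k + 1) a z) = p' at *
    generalize ppf (k + 1) a z = y at *
    generalize (1 - ‖z‖ ^ 2) ^ (-(n : ℝ)) = q at *
    generalize gr Y z = g at *
    generalize MM Y z = m at *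
    generalize 1 - ‖z‖ ^ 2 = u at *
    push_cast
    field_simp
    linear_combination (-(q : ℂ) * p') * e1 + (-(q : ℂ) * p) * e2

end SF

namespace SF
variable {n : ℕ}
open Wt

lemma ker_nonneg {ε : ℝ} (hε : 0 < ε) (k : ℕ) (a z : En n) : 0 ≤ ker ε k a z :=
  mul_nonneg (kap_nonneg n hε _) (pw_nonneg _ _ _)

lemma ppf_bound {a z : En n} (ha : ‖a‖ < 1) {k : ℕ} (hz : 2 ≤ 2 ^ k * (1 - ‖z‖ ^ 2)) :
    ‖z - a‖ ^ 2 ≤ ppf k a z * (1 - ‖z‖ ^ 2) := by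
  have hA := one_sub_sq_pos ha
  have hu : 0 < 1 - ‖z‖ ^ 2 := pos_of_cut (by linarith : 1 ≤ 2 ^ k * (1 - ‖z‖ ^ 2))
  rw [ppf, pw_one hz, Real.rpow_neg_one, @norm_sub_sq ℂ, ← inner_conj_symm z a, Complex.sq_norm, Complex.normSq_apply]
  simp only [RCLike.re_to_complex, Complex.conj_re, Complex.sub_re, Complex.sub_im, Complex.one_re, Complex.one_im]
  generalize (inner ℂ a z).re = x
  generalize (inner ℂ a z).im = y
  generalize ‖a‖ ^ 2 = A at *
  generalize ‖z‖ ^ 2 = B at *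
  have h : ((1 - A)⁻¹ * (((1 - x) * (1 - x) + (0 - y) * (0 - y)) * (1 - B)⁻¹) - 1) * (1 - B) =
      ((1 - x) ^ 2 + y ^ 2 - (1 - A) * (1 - B)) / (1 - A) := by field_simp; ring
  rw [h, le_div_iff₀ hA]
  nlinarith [sq_nonneg (x - A), sq_nonneg y]

lemma cut_of_pw_ne {α : ℝ} {k : ℕ} {x : ℝ} (h : pw α k x ≠ 0) : 1 < 2 ^ k * x := by
  by_contra! h1; exact h (pw_zero h1)

lemma ker_support {ε : ℝ} (hε : 0 < ε) {k : ℕ} {a z : En n} (ha : ‖a‖ < 1) (h : ker ε k a z ≠ 0) :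
    ‖z - a‖ ^ 2 ≤ 2 * ε := by
  have h1 : 1 < 2 ^ k * (1 - ‖z‖ ^ 2) := cut_of_pw_ne (right_ne_zero_of_mul h)
  have h2 : ppf (k + 1) a z < 2 * ε := by
    by_contra! h2; exact left_ne_zero_of_mul h (kap_zero n hε h2)
  have h3 := ppf_bound ha (k := k + 1) (z := z) (by rw [pow_succ]; linarith)
  have h4 : 1 - ‖z‖ ^ 2 ≤ 1 := by nlinarith [norm_nonneg z]
  have hu : 0 < 1 - ‖z‖ ^ 2 := pos_of_cut h1.le
  nlinarith [mul_le_mul_of_nonneg_right h2.le hu.le]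

lemma ker_zero_out {ε : ℝ} {k : ℕ} {a z : En n} (hz : 1 ≤ ‖z‖) : ker ε k a z = 0 := by
  rw [ker, pw_zero, mul_zero]
  have : (2 : ℝ) ^ k * (1 - ‖z‖ ^ 2) ≤ 0 :=
    mul_nonpos_of_nonneg_of_nonpos (by positivity) (by nlinarith)
  linarith

lemma contDiffOn_ker {ε : ℝ} (hε : 0 < ε) (k : ℕ) :
    ContDiffOn ℝ ((⊤ : ℕ∞) : WithTop ℕ∞) (fun q : En n × En n => ker ε k q.1 q.2)
      (Metric.ball 0 1 ×ˢ Set.univ) := by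
  intro q hq
  have hq1 : ‖q.1‖ < 1 := by simpa using hq.1
  refine ContDiffAt.contDiffWithinAt ?_
  have h1 : ContDiff ℝ ((⊤ : ℕ∞) : WithTop ℕ∞) fun q : En n × En n => 1 - ‖q.1‖ ^ 2 :=
    contDiff_const.sub (contDiff_fst.norm_sq ℂ)
  have h2 : ContDiff ℝ ((⊤ : ℕ∞) : WithTop ℕ∞) fun q : En n × En n => 1 - ‖q.2‖ ^ 2 :=
    contDiff_const.sub (contDiff_snd.norm_sq ℂ)
  have h3 : ContDiff ℝ ((⊤ : ℕ∞) : WithTop ℕ∞) fun q : En n × En n => ‖1 - inner ℂ q.1 q.2‖ ^ 2 :=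
    (contDiff_const.sub (contDiff_fst.inner ℂ contDiff_snd)).norm_sq ℂ
  have h4 : ContDiffAt ℝ ((⊤ : ℕ∞) : WithTop ℕ∞) (fun q : En n × En n => ppf (k + 1) q.1 q.2) q :=
    ((h1.contDiffAt.inv (one_sub_sq_pos hq1).ne').mul
      (h3.mul ((pw (-1) (k + 1)).contDiff.comp h2)).contDiffAt).sub contDiffAt_const
  exact ((contDiff_kap n hε).contDiffAt.comp q h4).mul ((pw (-(n + 1)) k).contDiff.comp h2).contDiffAt

lemma continuous_ker {ε : ℝ} (hε : 0 < ε) (k : ℕ) {a : En n} (ha : ‖a‖ < 1) :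
    Continuous (ker ε k a) := by
  have h := (contDiffOn_ker (n := n) hε k).continuousOn
  have h1 : Continuous fun z : En n => (a, z) := by fun_prop
  have ha' : a ∈ Metric.ball (0 : En n) 1 := by rw [mem_ball_zero_iff]; exact ha
  exact ContinuousOn.comp_continuous (g := fun q : En n × En n => ker ε k q.1 q.2)
    (f := fun z => (a, z)) h h1 fun z => Set.mem_prod.2 ⟨ha', Set.mem_univ _⟩

lemma hcs_ker {ε : ℝ} (k : ℕ) (a : En n) : HasCompactSupport (ker ε k a) :=
  HasCompactSupport.of_support_subset_isCompact (isCompact_closedBall (0 : En n) 1) fun z hz => by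
    by_contra h
    simp only [Metric.mem_closedBall, dist_zero_right, not_le] at h
    exact hz (ker_zero_out h.le)

lemma integrable_ker_mul {ε : ℝ} (hε : 0 < ε) (k : ℕ) {a : En n} (ha : ‖a‖ < 1) {F : En n → ℂ}
    (hF : Continuous F) : Integrable fun z => (ker ε k a z : ℂ) * F z := by
  have hc : Continuous fun z => (ker ε k a z : ℂ) := Complex.continuous_ofReal.comp (continuous_ker hε k ha)
  have hs : HasCompactSupport fun z => (ker ε k a z : ℂ) := (hcs_ker k a).comp_left Complex.ofReal_zero
  exact (hc.mul hF).integrable_of_hasCompactSupport hs.mul_right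

lemma integrable_ker {ε : ℝ} (hε : 0 < ε) (k : ℕ) {a : En n} (ha : ‖a‖ < 1) :
    Integrable (ker ε k a) := (continuous_ker hε k ha).integrable_of_hasCompactSupport (hcs_ker k a)

lemma ker_indep (hn : 1 ≤ n) {ε : ℝ} (hε : 0 < ε) (hε1 : ε ≤ 1) {a : En n} (ha : ‖a‖ < 1) {k : ℕ}
    (hk : 12 ≤ 2 ^ k * (1 - ‖a‖)) {F : En n → ℂ} (hF : ContDiff ℝ 2 F)
    (hM : ∀ z, 1 < 2 ^ k * (1 - ‖z‖ ^ 2) → ∑ j : Fin n, ∑ k : Fin n,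
      ((if j = k then 1 else 0) - z j * (starRingEnd ℂ) (z k)) * wd n j (wdb n k F) z = 0) :
    ∫ z, (ker ε k a z : ℂ) * F z = ∫ z, (ker 1 k a z : ℂ) * F z := by
  have h := green_ker hn hε hε1 ha hk hF hM
  simp_rw [Complex.ofReal_sub, sub_mul] at h
  rw [integral_sub (integrable_ker_mul hε k ha hF.continuous)
    (integrable_ker_mul one_pos k ha hF.continuous)] at h
  exact sub_eq_zero.1 h

lemma ker_indep_one (hn : 1 ≤ n) {ε : ℝ} (hε : 0 < ε) (hε1 : ε ≤ 1) {a : En n} (ha : ‖a‖ < 1) {k : ℕ}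
    (hk : 12 ≤ 2 ^ k * (1 - ‖a‖)) : ∫ z, ker ε k a z = ∫ z, ker 1 k a z := by
  have h := ker_indep hn hε hε1 ha hk (F := fun _ => 1) contDiff_const fun z _ => by
    have h0 : ∀ k : Fin n, wdb n k (fun _ : En n => (1 : ℂ)) = fun _ => 0 := fun k => by
      funext z; simp [wdb]
    simp [h0, wd]
  simp only [mul_one, integral_complex_ofReal] at h
  exact_mod_cast h

lemma ker_pos (hn : 1 ≤ n) {a : En n} (ha : ‖a‖ < 1) {k : ℕ}
    (hk : 12 ≤ 2 ^ k * (1 - ‖a‖)) : 0 < ∫ z, ker 1 k a z := by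
  obtain ⟨y, hy1, hy⟩ := exists_deriv_trn_pos
  have hy0 : 0 < y := by linarith
  have hcut : 2 < 2 ^ k * (1 - ‖a‖ ^ 2) := by
    have : 2 ^ k * (1 - ‖a‖) ≤ 2 ^ k * (1 - ‖a‖ ^ 2) := by
      gcongr; nlinarith [norm_nonneg a]
    linarith
  have hA := one_sub_sq_pos ha
  have hp0 : ppf (k + 1) a a = 0 := by
    rw [ppf, pw_one (by rw [pow_succ]; linarith), Real.rpow_neg_one, inner_self_eq_norm_sq_to_K]
    have : ‖(1 : ℂ) - (‖a‖ : ℂ) ^ 2‖ = 1 - ‖a‖ ^ 2 := by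
      rw [← Complex.ofReal_pow, ← Complex.ofReal_one, ← Complex.ofReal_sub, Complex.norm_real, Real.norm_of_nonneg hA.le]
    simp only [Complex.coe_algebraMap, this]
    field_simp; ring
  have hpc : Continuous (ppf (k + 1) a) := by
    have := (pw (-1) (k + 1)).contDiff.continuous
    unfold ppf
    fun_prop
  have : Nonempty (Fin n) := ⟨⟨0, hn⟩⟩
  have ev : ∀ᶠ z in nhdsWithin a {a}ᶜ, ppf (k + 1) a z < y ∧ 2 < 2 ^ k * (1 - ‖z‖ ^ 2) ∧ z ≠ a := by
    refine Filter.Eventually.and ?_ (Filter.Eventually.and ?_ self_mem_nhdsWithin)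
    · exact nhdsWithin_le_nhds (hpc.continuousAt.eventually_lt continuousAt_const (by rw [hp0]; exact hy0))
    · exact nhdsWithin_le_nhds (ContinuousAt.eventually_lt (f := fun _ : En n => (2 : ℝ))
        (g := fun z : En n => 2 ^ k * (1 - ‖z‖ ^ 2)) continuousAt_const (by fun_prop) hcut)
  have : (nhdsWithin a {a}ᶜ).NeBot := Module.punctured_nhds_neBot ℝ (En n) a
  obtain ⟨z, hz1, hz2, hza⟩ := ev.exists
  have hb := ppf_bound ha (k := k + 1) (z := z) (by rw [pow_succ]; linarith)
  have hu : 0 < 1 - ‖z‖ ^ 2 := pos_of_cut (by linarith : 1 ≤ 2 ^ k * (1 - ‖z‖ ^ 2))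
  have hpp : 0 < ppf (k + 1) a z := by
    have h1 : 0 < ‖z - a‖ ^ 2 := by
      have := norm_pos_iff.2 (sub_ne_zero.2 hza); positivity
    exact (pos_iff_pos_of_mul_pos (h1.trans_le hb)).2 hu
  have hε : 0 < ppf (k + 1) a z / y := div_pos hpp hy0
  rw [← ker_indep_one hn hε ((div_le_one hy0).2 hz1.le) ha hk]
  refine (continuous_ker hε k ha).integral_pos_of_hasCompactSupport_nonneg_nonzero (x := z)
    (hcs_ker k a) (fun z => ker_nonneg hε k a z) ?_
  refine ne_of_gt (mul_pos ?_ ?_)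
  · rw [kap, deriv_trn_scale, div_div_cancel₀ hpp.ne']
    positivity
  · rw [pw_one hz2.le]; positivity

lemma mean_value (hn : 1 ≤ n) {a : En n} (ha : ‖a‖ < 1) {k : ℕ}
    (hk : 12 ≤ 2 ^ k * (1 - ‖a‖)) {F : En n → ℂ} (hF : ContDiff ℝ 2 F)
    (hM : ∀ z, 1 < 2 ^ k * (1 - ‖z‖ ^ 2) → ∑ j : Fin n, ∑ k : Fin n,
      ((if j = k then 1 else 0) - z j * (starRingEnd ℂ) (z k)) * wd n j (wdb n k F) z = 0) :
    ∫ z, (ker 1 k a z : ℂ) * F z = (∫ z, ker 1 k a z : ℝ) * F a := by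
  have hc := ker_pos hn ha hk
  rw [← sub_eq_zero, ← norm_le_zero_iff]
  refine le_of_forall_pos_le_add fun η hη => ?_
  rw [zero_add]
  obtain ⟨δ, hδ, hd⟩ := Metric.continuous_iff.1 hF.continuous a (η / ∫ z, ker 1 k a z) (by positivity)
  set ε := min 1 (δ ^ 2 / 3) with hεd
  have hε : 0 < ε := by positivity
  have hε1 : ε ≤ 1 := min_le_left _ _
  rw [← ker_indep hn hε hε1 ha hk hF hM]
  have e1 : ((∫ z, ker 1 k a z : ℝ) : ℂ) * F a = ∫ z, (ker ε k a z : ℂ) * F a := by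
    rw [← ker_indep_one hn hε hε1 ha hk, integral_mul_const, integral_complex_ofReal]
  rw [e1, ← integral_sub (integrable_ker_mul hε k ha hF.continuous) (integrable_ker_mul hε k ha continuous_const)]
  have e2 : ‖∫ z, ((ker ε k a z : ℂ) * F z - (ker ε k a z : ℂ) * F a)‖ ≤
      ∫ z, ker ε k a z * (η / ∫ z, ker 1 k a z) := by
    refine norm_integral_le_of_norm_le ((integrable_ker hε k ha).mul_const _)
      (Filter.Eventually.of_forall fun z => ?_)
    rw [← mul_sub, norm_mul, Complex.norm_real, Real.norm_of_nonneg (ker_nonneg hε k a z)]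
    by_cases h0 : ker ε k a z = 0
    · rw [h0]; simp
    · refine mul_le_mul_of_nonneg_left ?_ (ker_nonneg hε k a z)
      have h1 := ker_support hε ha h0
      have h2 : ε ≤ δ ^ 2 / 3 := min_le_right _ _
      have h3 : ‖z - a‖ < δ := by
        refine lt_of_pow_lt_pow_left₀ 2 hδ.le ?_
        nlinarith [sq_pos_of_pos hδ]
      have := hd z (by rw [dist_eq_norm]; exact h3)
      rw [dist_eq_norm] at this
      exact this.le
  refine e2.trans (le_of_eq ?_)
  rw [integral_mul_const, ker_indep_one hn hε hε1 ha hk]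
  field_simp

lemma contDiffOn_ker_integral (k : ℕ) {F : En n → ℂ} (hF : Continuous F) :
    ContDiffOn ℝ ((⊤ : ℕ∞) : WithTop ℕ∞) (fun a => ∫ z, (ker 1 k a z : ℂ) * F z) (Metric.ball 0 1) := by
  have h := contDiffOn_convolution_right_with_param (𝕜 := ℝ) (μ := (volume : Measure (En n))) (f := F)
    (n := (⊤ : ℕ∞))
    (ContinuousLinearMap.mul ℝ ℂ) (g := fun a z : En n => (ker 1 k a (-z) : ℂ))
    (s := Metric.ball 0 1) (k := Metric.closedBall 0 1) Metric.isOpen_ball (isCompact_closedBall _ _)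
    (fun p x _ hx => by
      simp only [Metric.mem_closedBall, dist_zero_right, not_le] at hx
      rw [ker_zero_out (by rw [norm_neg]; exact hx.le), Complex.ofReal_zero])
    hF.locallyIntegrable
    (by
      have h1 := (contDiffOn_ker (n := n) one_pos k).comp (s := Metric.ball 0 1 ×ˢ Set.univ)
        (f := fun q : En n × En n => (q.1, -q.2)) (contDiff_fst.prodMk contDiff_snd.neg).contDiffOn
        (fun q hq => ⟨hq.1, trivial⟩)
      exact Complex.ofRealCLM.contDiff.comp_contDiffOn h1)
  have h2 := h.comp (s := Metric.ball 0 1) (f := fun a : En n => (a, (0 : En n)))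
    (contDiff_id.prodMk contDiff_const).contDiffOn (fun q hq => ⟨hq, trivial⟩)
  refine h2.congr fun a _ => ?_
  simp only [Function.comp, convolution, zero_sub, neg_neg, ContinuousLinearMap.mul_apply']
  exact integral_congr_ae (Filter.Eventually.of_forall fun z => mul_comm _ _)

end SF

lemma wd_germ {n : ℕ} {F G : En n → ℂ} {z : En n} (h : F =ᶠ[nhds z] G) (j : Fin n) :
    wd n j F =ᶠ[nhds z] wd n j G := by
  filter_upwards [h.fderiv (𝕜 := ℝ)] with y hy
  rw [wd, wd, hy]

lemma wdb_germ {n : ℕ} {F G : En n → ℂ} {z : En n} (h : F =ᶠ[nhds z] G) (j : Fin n) :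
    wdb n j F =ᶠ[nhds z] wdb n j G := by
  filter_upwards [h.fderiv (𝕜 := ℝ)] with y hy
  rw [wdb, wdb, hy]

lemma BoxOp_germ {n : ℕ} {F G : En n → ℂ} {z : En n} (h : F =ᶠ[nhds z] G) :
    BoxOp n F z = BoxOp n G z := by
  have h1 : ∀ j k, Lop n j k F =ᶠ[nhds z] Lop n j k G := fun j k => by
    filter_upwards [wd_germ h j, wd_germ h k] with y h1 h2
    rw [Lop, Lop, h1, h2]
  have h2 : ∀ j k, Lbarop n j k F =ᶠ[nhds z] Lbarop n j k G := fun j k => by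
    filter_upwards [wdb_germ h j, wdb_germ h k] with y h1 h2
    rw [Lbarop, Lbarop, h1, h2]
  simp only [BoxOp]
  congr 1
  refine Finset.sum_congr rfl fun j _ => Finset.sum_congr rfl fun k _ => ?_
  rw [Lop, Lop, Lbarop, Lbarop]
  congr 1
  · rw [(wd_germ (h2 j k) j).eq_of_nhds, (wd_germ (h2 j k) k).eq_of_nhds]
  · rw [(wdb_germ (h1 j k) j).eq_of_nhds, (wdb_germ (h1 j k) k).eq_of_nhds]

/-- The inner sum in the invariant Laplacian. -/
noncomputable def MOp (n : ℕ) (f : En n → ℂ) (z : En n) : ℂ :=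
  ∑ j : Fin n, ∑ k : Fin n,
    ((if j = k then 1 else 0) - z j * (starRingEnd ℂ) (z k)) * wd n j (wdb n k f) z

lemma MOp_germ {n : ℕ} {F G : En n → ℂ} {z : En n} (h : F =ᶠ[nhds z] G) : MOp n F z = MOp n G z :=
  Finset.sum_congr rfl fun j _ => Finset.sum_congr rfl fun k _ => by
    rw [(wd_germ (wdb_germ h k) j).eq_of_nhds]

open Wt in
lemma contDiff_cut_mul {n : ℕ} {m : WithTop ℕ∞} (hm : m ≤ ((⊤ : ℕ∞) : WithTop ℕ∞)) {f : En n → ℂ}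
    (hf : ContDiffOn ℝ m f (Metric.ball 0 1)) (k : ℕ) :
    ContDiff ℝ m fun z => (pw 0 k (1 - ‖z‖ ^ 2) : ℂ) * f z := by
  refine contDiff_iff_contDiffAt.2 fun z => ?_
  rcases lt_or_ge ‖z‖ 1 with hz | hz
  · refine ContDiffAt.mul ?_ (hf.contDiffAt (Metric.isOpen_ball.mem_nhds (by simpa using hz)))
    have h2 : ContDiff ℝ ((⊤ : ℕ∞) : WithTop ℕ∞) fun z : En n => 1 - ‖z‖ ^ 2 :=
      contDiff_const.sub (contDiff_id.norm_sq ℂ)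
    exact ((Complex.ofRealCLM.contDiff.comp ((pw 0 k).contDiff.comp h2)).contDiffAt).of_le hm
  · refine (contDiffAt_const (c := (0 : ℂ))).congr_of_eventuallyEq ?_
    have hO : IsOpen {z : En n | 2 ^ k * (1 - ‖z‖ ^ 2) < 1} := isOpen_lt (by fun_prop) (by fun_prop)
    have hz' : z ∈ {z : En n | 2 ^ k * (1 - ‖z‖ ^ 2) < 1} := by
      have : (2 : ℝ) ^ k * (1 - ‖z‖ ^ 2) ≤ 0 :=
        mul_nonpos_of_nonneg_of_nonpos (by positivity) (by nlinarith)
      exact this.trans_lt one_pos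
    filter_upwards [hO.mem_nhds hz'] with y hy
    rw [pw_zero (le_of_lt hy)]; simp

open Wt in
lemma cut_mul_germ {n : ℕ} (f : En n → ℂ) {k : ℕ} {z : En n} (hz : 1 < 2 ^ k * (1 - ‖z‖ ^ 2)) :
    (fun z => (pw 0 (k + 1) (1 - ‖z‖ ^ 2) : ℂ) * f z) =ᶠ[nhds z] f := by
  have hO : IsOpen {z : En n | 1 < 2 ^ k * (1 - ‖z‖ ^ 2)} := isOpen_lt (by fun_prop) (by fun_prop)
  filter_upwards [hO.mem_nhds hz] with y hy
  have : 1 < 2 ^ k * (1 - ‖y‖ ^ 2) := hy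
  rw [pw_one (by rw [pow_succ]; linarith), Real.rpow_zero, Complex.ofReal_one, one_mul]

lemma MHarm.MOp_zero {n : ℕ} {m : ℕ∞} {f : En n → ℂ} (hf : MHarm n m f) {z : En n} (hz : ‖z‖ < 1) :
    MOp n f z = 0 := by
  have h := hf.2 z (by simpa using hz)
  have h1 : (4 : ℂ) * (1 - (‖z‖ : ℂ) ^ 2) ≠ 0 := by
    have : ((4 * (1 - ‖z‖ ^ 2) : ℝ) : ℂ) ≠ 0 := by
      have := SF.one_sub_sq_pos hz
      exact_mod_cast (by positivity : 4 * (1 - ‖z‖ ^ 2) ≠ 0)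
    push_cast at this; exact this
  exact (mul_eq_zero.1 h).resolve_left h1

lemma norm_lt_one_of_cut {n : ℕ} {z : En n} {k : ℕ} (h : 1 < 2 ^ k * (1 - ‖z‖ ^ 2)) : ‖z‖ < 1 := by
  have := Wt.pos_of_cut h.le
  nlinarith [norm_nonneg z]

/-- Interior regularity of `M`-harmonic functions. -/
lemma MHarm.contDiffOn_top {n : ℕ} (hn : 1 ≤ n) {f : En n → ℂ} (hf : MHarm n 2 f) :
    ContDiffOn ℝ ((⊤ : ℕ∞) : WithTop ℕ∞) f (Metric.ball 0 1) := by
  intro a ha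
  have ha1 : ‖a‖ < 1 := by simpa using ha
  set r := (‖a‖ + 1) / 2 with hr
  have hr1 : r < 1 := by linarith
  have har : ‖a‖ < r := by linarith
  obtain ⟨k, hk⟩ := pow_unbounded_of_one_lt (12 / (1 - r)) (by norm_num : (1 : ℝ) < 2)
  have hkr : ∀ b : En n, ‖b‖ < r → 12 ≤ 2 ^ k * (1 - ‖b‖) := fun b hb => by
    have h1 := (div_lt_iff₀ (by linarith)).1 hk
    have : (2 : ℝ) ^ k * (1 - r) ≤ 2 ^ k * (1 - ‖b‖) := by gcongr
    linarith
  set F : En n → ℂ := fun z => (Wt.pw 0 (k + 1) (1 - ‖z‖ ^ 2) : ℂ) * f z with hF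
  have hFc : ContDiff ℝ 2 F := contDiff_cut_mul (WithTop.coe_le_coe.2 le_top) hf.1 (k + 1)
  have hFM : ∀ z, 1 < 2 ^ k * (1 - ‖z‖ ^ 2) → MOp n F z = 0 := fun z hz => by
    rw [MOp_germ (cut_mul_germ f hz), hf.MOp_zero (norm_lt_one_of_cut hz)]
  have hd1 := SF.contDiffOn_ker_integral k hFc.continuous
  have hd2 := SF.contDiffOn_ker_integral (n := n) k (F := fun _ => 1) continuous_const
  have hb : ∀ b : En n, ‖b‖ < r → (∫ z, (SF.ker 1 k b z : ℂ) * (1 : ℂ)) ≠ 0 ∧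
      f b = (∫ z, (SF.ker 1 k b z : ℂ) * F z) * (∫ z, (SF.ker 1 k b z : ℂ) * (1 : ℂ))⁻¹ := fun b hb => by
    have h1 := SF.mean_value hn (hb.trans hr1) (hkr b hb) hFc hFM
    have h2 := SF.ker_pos hn (hb.trans hr1) (hkr b hb)
    have h3 : (∫ z, (SF.ker 1 k b z : ℂ) * (1 : ℂ)) = ((∫ z, SF.ker 1 k b z : ℝ) : ℂ) := by
      simp only [mul_one, integral_complex_ofReal]
    have h4 : ((∫ z, SF.ker 1 k b z : ℝ) : ℂ) ≠ 0 := by exact_mod_cast h2.ne'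
    have h5 : F b = f b := by
      refine (cut_mul_germ f (k := k) (z := b) ?_).eq_of_nhds
      have : 2 ^ k * (1 - ‖b‖) ≤ 2 ^ k * (1 - ‖b‖ ^ 2) := by
        gcongr; nlinarith [norm_nonneg b]
      linarith [hkr b hb]
    rw [h3, h1, h5]
    exact ⟨h4, by field_simp⟩
  have hsub : a ∈ Metric.ball (0 : En n) r := by simpa using har
  refine ContDiffAt.contDiffWithinAt ?_
  have key : ContDiffAt ℝ ((⊤ : ℕ∞) : WithTop ℕ∞) (fun b => (∫ z, (SF.ker 1 k b z : ℂ) * F z) *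
      (∫ z, (SF.ker 1 k b z : ℂ) * (1 : ℂ))⁻¹) a :=
    (hd1.contDiffAt (Metric.isOpen_ball.mem_nhds ha)).mul
      ((hd2.contDiffAt (Metric.isOpen_ball.mem_nhds ha)).inv (hb a har).1)
  refine key.congr_of_eventuallyEq ?_
  filter_upwards [Metric.isOpen_ball.mem_nhds hsub] with b hbm
  exact (hb b (by simpa using hbm)).2

/-- Smooth `M`-harmonic functions on the ball. -/
def SmoothMHarm (n : ℕ) (f : En n → ℂ) : Prop :=
  ContDiffOn ℝ ((⊤ : ℕ∞) : WithTop ℕ∞) f (Metric.ball 0 1) ∧ ∀ z, ‖z‖ < 1 → MOp n f z = 0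

lemma MHarm.smoothMHarm {n : ℕ} (hn : 1 ≤ n) {f : En n → ℂ} (hf : MHarm n 2 f) : SmoothMHarm n f :=
  ⟨hf.contDiffOn_top hn, fun _ hz => hf.MOp_zero hz⟩

namespace SmoothMHarm
variable {n : ℕ} {f : En n → ℂ}

/-- A global smooth function which agrees with `f` away from the sphere. -/
noncomputable def cut (hf : SmoothMHarm n f) (k : ℕ) : SF n :=
  ⟨fun z => (Wt.pw 0 (k + 1) (1 - ‖z‖ ^ 2) : ℂ) * f z, contDiff_cut_mul le_rfl hf.1 (k + 1)⟩

lemma cut_germ (hf : SmoothMHarm n f) {k : ℕ} {z : En n} (hz : 1 < 2 ^ k * (1 - ‖z‖ ^ 2)) :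
    (hf.cut k : En n → ℂ) =ᶠ[nhds z] f := cut_mul_germ f hz

lemma harmTo_cut (hf : SmoothMHarm n f) (k : ℕ) : SF.HarmTo k (hf.cut k) := fun z hz => by
  rw [SF.MM_val]
  exact (MOp_germ (hf.cut_germ hz)).trans (hf.2 z (norm_lt_one_of_cut hz))

lemma cut_IpB (hf : SmoothMHarm n f) {k : ℕ} {z : En n} (hz : 1 < 2 ^ k * (1 - ‖z‖ ^ 2)) :
    (hf.cut k + SF.Box (hf.cut k) : SF n) z = IpB n f z := by
  rw [SF.add_val, SF.Box_val, IpB, BoxOp_germ (hf.cut_germ hz), (hf.cut_germ hz).eq_of_nhds]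

lemma isOpen_cutset (k : ℕ) : IsOpen {z : En n | 1 < 2 ^ k * (1 - ‖z‖ ^ 2)} :=
  isOpen_lt (by fun_prop) (by fun_prop)

lemma exists_cut {z : En n} (hz : ‖z‖ < 1) : ∃ k : ℕ, 2 < 2 ^ k * (1 - ‖z‖ ^ 2) := by
  have h := SF.one_sub_sq_pos hz
  obtain ⟨k, hk⟩ := pow_unbounded_of_one_lt (2 / (1 - ‖z‖ ^ 2)) (by norm_num : (1 : ℝ) < 2)
  exact ⟨k, (div_lt_iff₀ h).1 hk⟩

lemma IpB (hf : SmoothMHarm n f) : SmoothMHarm n (IpB n f) := by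
  have key : ∀ z : En n, ‖z‖ < 1 → ∃ k : ℕ, 1 < 2 ^ k * (1 - ‖z‖ ^ 2) ∧
      _root_.IpB n f =ᶠ[nhds z] (hf.cut k + SF.Box (hf.cut k) : SF n) := fun z hz => by
    obtain ⟨k, hk⟩ := exists_cut hz
    have hk1 : 1 < 2 ^ k * (1 - ‖z‖ ^ 2) := by linarith
    refine ⟨k, hk1, ?_⟩
    filter_upwards [(isOpen_cutset k).mem_nhds hk1] with y hy
    exact (hf.cut_IpB hy).symm
  refine ⟨fun z hz => ?_, fun z hz => ?_⟩
  · obtain ⟨k, -, h⟩ := key z (by simpa using hz)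
    exact ((SF.contDiff _).contDiffAt.congr_of_eventuallyEq h).contDiffWithinAt
  · obtain ⟨k, hk, h⟩ := key z hz
    rw [MOp_germ h]
    refine (SF.MM_val _ z).symm.trans ?_
    have h0 : (SF.MM (hf.cut k) : En n → ℂ) =ᶠ[nhds z] (0 : SF n) := by
      filter_upwards [(isOpen_cutset k).mem_nhds hk] with y hy
      exact hf.harmTo_cut k y hy
    rw [map_add, SF.MM_Box, SF.add_val, hf.harmTo_cut k z hk, SF.Box_val, BoxOp_germ h0, ← SF.Box_val, map_zero,
      SF.zero_val, add_zero]

end SmoothMHarm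

/-- The unnormalized weighted integral. -/
noncomputable def wInt (n : ℕ) (α : ℝ) (f : En n → ℂ) : ℝ≥0∞ :=
  ∫⁻ z in Metric.ball (0 : En n) 1, ENNReal.ofReal ((1 - ‖z‖ ^ 2) ^ α) * ENNReal.ofReal (‖f z‖ ^ 2)

/-- The weighted integral with cut off weight. -/
noncomputable def wIntCut (n : ℕ) (α : ℝ) (k : ℕ) (f : En n → ℂ) : ℝ≥0∞ :=
  ∫⁻ z in Metric.ball (0 : En n) 1, ENNReal.ofReal (Wt.pw α k (1 - ‖z‖ ^ 2)) * ENNReal.ofReal (‖f z‖ ^ 2)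

lemma Wt.pw_le_rpow (α : ℝ) (k : ℕ) {x : ℝ} (hx : 0 ≤ x) : Wt.pw α k x ≤ x ^ α :=
  mul_le_of_le_one_left (Real.rpow_nonneg hx _) (Real.smoothTransition.le_one _)

lemma iSup_wIntCut {n : ℕ} (α : ℝ) {f : En n → ℂ} (hf : ContinuousOn f (Metric.ball 0 1)) :
    ⨆ k, wIntCut n α k f = wInt n α f := by
  simp only [wIntCut, wInt]
  rw [← lintegral_iSup']
  · refine setLIntegral_congr_fun Metric.isOpen_ball.measurableSet fun z hz => ?_
    have hz1 : ‖z‖ < 1 := by simpa using hz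
    rw [← ENNReal.iSup_mul]
    congr 1
    refine le_antisymm (iSup_le fun k => ENNReal.ofReal_le_ofReal
      (Wt.pw_le_rpow α k (SF.one_sub_sq_pos hz1).le)) ?_
    obtain ⟨k, hk⟩ := SmoothMHarm.exists_cut hz1
    rw [← Wt.pw_one (α := α) hk.le]
    exact le_iSup (fun k => ENNReal.ofReal (Wt.pw α k (1 - ‖z‖ ^ 2))) k
  · intro k
    refine AEMeasurable.fun_mul ?_ ?_
    · have : Continuous fun z : En n => Wt.pw α k (1 - ‖z‖ ^ 2) :=
        (Wt.pw α k).contDiff.continuous.comp (by fun_prop)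
      exact (ENNReal.continuous_ofReal.comp this).measurable.aemeasurable
    · exact ((ENNReal.continuous_ofReal.comp_continuousOn (hf.norm.pow 2)).aemeasurable
        Metric.isOpen_ball.measurableSet)
  · refine Filter.Eventually.of_forall fun z k l hkl => ?_
    exact mul_le_mul_left (ENNReal.ofReal_le_ofReal (Wt.pw_mono_cut α hkl _)) _

lemma ofReal_en_eq_wIntCut {n : ℕ} (α : ℝ) {k l : ℕ} (hkl : k ≤ l) {f : En n → ℂ} {F : SF n}
    (h : ∀ z : En n, 1 < 2 ^ l * (1 - ‖z‖ ^ 2) → F z = f z) :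
    ENNReal.ofReal (SF.en (Wt.pw α k) F) = wIntCut n α k f := by
  rw [SF.ofReal_en (fun _ _ => Wt.pw_nonneg _ _ _), wIntCut,
    ← lintegral_indicator Metric.isOpen_ball.measurableSet]
  refine lintegral_congr fun z => ?_
  rcases le_or_gt (2 ^ k * (1 - ‖z‖ ^ 2)) 1 with hz | hz
  · classical
    rw [Set.indicator_apply, Wt.pw_zero hz]; simp
  · have hz1 := norm_lt_one_of_cut hz
    rw [Set.indicator_of_mem (by simpa using hz1), h z (hz.trans_le ?_)]
    exact mul_le_mul_of_nonneg_right (pow_le_pow_right₀ (by norm_num) hkl) (SF.one_sub_sq_pos hz1).le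

lemma wInt_lower {n : ℕ} (hn : 2 ≤ n) {s : ℝ} (hs : -1 < s) : ∃ C : ℝ, 0 < C ∧ ∀ f : En n → ℂ,
    SmoothMHarm n f → wInt n s f ≤ ENNReal.ofReal C * wInt n (s + 2) (IpB n f) := by
  obtain ⟨C, hC, H⟩ := SF.lower_main hn hs
  refine ⟨C, hC, fun f hf => ?_⟩
  rw [← iSup_wIntCut s hf.1.continuousOn, ← iSup_wIntCut (s + 2) hf.IpB.1.continuousOn]
  refine iSup_le fun k => ?_
  refine le_trans ?_ (mul_le_mul_right (le_iSup _ (k + 2)) _)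
  rw [← ofReal_en_eq_wIntCut s (Nat.le_add_right k 2) fun z hz => (hf.cut_germ hz).eq_of_nhds,
    ← ofReal_en_eq_wIntCut (s + 2) le_rfl fun z hz => hf.cut_IpB hz, ← ENNReal.ofReal_mul hC.le]
  exact ENNReal.ofReal_le_ofReal (H k _ (hf.harmTo_cut _))

lemma wInt_upper (n : ℕ) (s : ℝ) : ∃ C : ℝ, 0 < C ∧ ∀ f : En n → ℂ,
    SmoothMHarm n f → wInt n (s + 2) (IpB n f) ≤ ENNReal.ofReal C * wInt n s f := by
  obtain ⟨C, hC, H⟩ := SF.upper_main n s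
  refine ⟨C, hC, fun f hf => ?_⟩
  rw [← iSup_wIntCut s hf.1.continuousOn, ← iSup_wIntCut (s + 2) hf.IpB.1.continuousOn]
  refine iSup_le fun k => ?_
  refine le_trans ?_ (mul_le_mul_right (le_iSup _ (k + 2)) _)
  rw [← ofReal_en_eq_wIntCut s le_rfl fun z hz => (hf.cut_germ hz).eq_of_nhds,
    ← ofReal_en_eq_wIntCut (s + 2) (Nat.le_add_right k 2) fun z hz => hf.cut_IpB hz, ← ENNReal.ofReal_mul hC.le]
  exact ENNReal.ofReal_le_ofReal (H k _ (hf.harmTo_cut _))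

lemma exists_nsqE_eq (n : ℕ) {s : ℝ} (hs : -1 < s) : ∃ c : ℝ, 0 < c ∧
    ∀ f : En n → ℂ, nsqE n s f = ENNReal.ofReal c * wInt n s f := by
  have hc : 0 < poch (s + 1) n / Real.pi ^ n :=
    div_pos (div_pos (Real.Gamma_pos_of_pos (by have : (0 : ℝ) ≤ n := Nat.cast_nonneg n
                                                linarith))
      (Real.Gamma_pos_of_pos (by linarith))) (by positivity)
  refine ⟨_, hc, fun f => ?_⟩
  rw [nsqE, wInt, ← lintegral_const_mul' _ _ ENNReal.ofReal_ne_top]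
  refine setLIntegral_congr_fun Metric.isOpen_ball.measurableSet fun z hz => ?_
  have hz1 : ‖z‖ < 1 := by simpa using hz
  have hp := Real.rpow_nonneg (SF.one_sub_sq_pos hz1).le s
  rw [ENNReal.ofReal_mul (mul_nonneg hc.le hp), ENNReal.ofReal_mul hc.le, mul_assoc]

lemma ofReal_mul_chain {a b c : ℝ} (ha : 0 < a) (hb : 0 < b) (hc : 0 < c) {I J : ℝ≥0∞}
    (h : I ≤ ENNReal.ofReal c * J) :
    ENNReal.ofReal a * I ≤ ENNReal.ofReal (a * c * b⁻¹) * (ENNReal.ofReal b * J) := by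
  rw [← mul_assoc, ← ENNReal.ofReal_mul (by positivity), inv_mul_cancel_right₀ hb.ne',
    ENNReal.ofReal_mul ha.le, mul_assoc]
  exact mul_le_mul_right h _

lemma nsqE_step {n : ℕ} (hn : 2 ≤ n) {s : ℝ} (hs : -1 < s) : ∃ A B : ℝ, 0 < A ∧ 0 < B ∧
    ∀ f : En n → ℂ, SmoothMHarm n f →
      nsqE n s f ≤ ENNReal.ofReal A * nsqE n (s + 2) (IpB n f) ∧
      nsqE n (s + 2) (IpB n f) ≤ ENNReal.ofReal B * nsqE n s f := by
  obtain ⟨c, hc, Hc⟩ := exists_nsqE_eq n hs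
  obtain ⟨d, hd, Hd⟩ := exists_nsqE_eq n (s := s + 2) (by linarith)
  obtain ⟨A, hA, HA⟩ := wInt_lower hn hs
  obtain ⟨B, hB, HB⟩ := wInt_upper n s
  refine ⟨c * A * d⁻¹, d * B * c⁻¹, by positivity, by positivity, fun f hf => ?_⟩
  rw [Hc, Hd]
  exact ⟨ofReal_mul_chain hc hd hA (HA f hf), ofReal_mul_chain hd hc hB (HB f hf)⟩

lemma nsqE_iterate {n : ℕ} (hn : 2 ≤ n) (j : ℕ) : ∀ s : ℝ, -1 < s → ∃ A B : ℝ, 0 < A ∧ 0 < B ∧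
    ∀ f : En n → ℂ, SmoothMHarm n f →
      nsqE n s f ≤ ENNReal.ofReal A * nsqE n (s + 2 * j) ((IpB n)^[j] f) ∧
      nsqE n (s + 2 * j) ((IpB n)^[j] f) ≤ ENNReal.ofReal B * nsqE n s f := by
  induction j with
  | zero => exact fun s _ => ⟨1, 1, one_pos, one_pos, fun f _ => by simp⟩
  | succ j ih =>
    intro s hs
    obtain ⟨A, B, hA, hB, H⟩ := nsqE_step hn hs
    obtain ⟨A', B', hA', hB', H'⟩ := ih (s + 2) (by linarith)
    refine ⟨A * A', B' * B, by positivity, by positivity, fun f hf => ?_⟩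
    obtain ⟨h1, h2⟩ := H f hf
    obtain ⟨h3, h4⟩ := H' _ hf.IpB
    have e : s + 2 * ((j + 1 : ℕ) : ℝ) = s + 2 + 2 * j := by push_cast; ring
    rw [e, Function.iterate_succ_apply, ENNReal.ofReal_mul hA.le, ENNReal.ofReal_mul hB'.le, mul_assoc, mul_assoc]
    exact ⟨h1.trans (mul_le_mul_right h3 _), h4.trans (mul_le_mul_right h2 _)⟩

/-- Theorem 4.1, parts (a) ⟺ (c) for even `t = 2j`, `s > -1`:
`‖f‖²_s ≍ ‖(I+□)^j f‖²_{s+2j}` for `M`-harmonic `f`. -/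
theorem statement5 (n : ℕ) (hn : 2 ≤ n) (s : ℝ) (hs : -1 < s) (j : ℕ) :
    ∃ c C : ℝ, 0 < c ∧ c < C ∧ ∀ f : En n → ℂ, MHarm n 2 f →
      ENNReal.ofReal c * nsqE n s f ≤ nsqE n (s + 2 * j) ((IpB n)^[j] f) ∧
      nsqE n (s + 2 * j) ((IpB n)^[j] f) ≤ ENNReal.ofReal C * nsqE n s f := by
  obtain ⟨A, B, hA, hB, H⟩ := nsqE_iterate hn j s hs
  refine ⟨A⁻¹, B + A⁻¹, by positivity, by linarith, fun f hf => ?_⟩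
  obtain ⟨h1, h2⟩ := H f (hf.smoothMHarm (by omega))
  refine ⟨?_, h2.trans (mul_le_mul_left (ENNReal.ofReal_le_ofReal (by have := inv_pos.2 hA
                                                                      linarith)) _)⟩
  refine (mul_le_mul_right h1 _).trans (le_of_eq ?_)
  rw [← mul_assoc, ← ENNReal.ofReal_mul (by positivity), inv_mul_cancel₀ hA.ne', ENNReal.ofReal_one, one_mul]
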